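/- Let H ⊆ U(N), N ≥ 2, be a connected closed subgroup with dim H = (N-1)². Then H is conjugate in U(N) to one of: (A) e^{iℝ}·SO(3, ℝ) (only possible for N = 3); (B) the block-diagonal SU(N-1) × U(1) (for N ≥ 3); or (C) a group H^N_{k₁,k₂} = { diag(A, a) : A ∈ U(N-1), a ∈ (det A)^{k₂/k₁} } for coprime integers k₁ > 0 and k₂. -/

import Mathlib

open scoped ENNReal

/-- The dimension of a subgroup of the unitary group `U(N)`, measured as the Hausdorff
dimension of its underlying set of matrices. -/
noncomputable def unitarySubgroupDim (N : ℕ) (H : Subgroup ↥(Matrix.unitaryGroup (Fin N) ℂ)) :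
    ℝ≥0∞ :=
  dimH ((fun A : ↥(Matrix.unitaryGroup (Fin N) ℂ) =>
    fun i j : Fin N => (A : Matrix (Fin N) (Fin N) ℂ) i j) ''
      (H : Set ↥(Matrix.unitaryGroup (Fin N) ℂ)))

/-- The set of block-diagonal unitary matrices (the block splitting off the last
coordinate), i.e. the subgroup `U(N-1) × U(1)` of `U(N)` as a set. -/
def blockDiagSet (N : ℕ) : Set ↥(Matrix.unitaryGroup (Fin N) ℂ) :=
  {A : ↥(Matrix.unitaryGroup (Fin N) ℂ) | ∀ i j : Fin N,
    ¬(((i : ℕ) = N - 1) ↔ ((j : ℕ) = N - 1)) → (A : Matrix (Fin N) (Fin N) ℂ) i j = 0}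

/-- The subgroup `e^{iℝ}·SO(3, ℝ)` of `U(3)` (unit-modulus scalar multiples of real special
orthogonal matrices), as a set; stated for general `N`. -/
def eSO3Set (N : ℕ) : Set ↥(Matrix.unitaryGroup (Fin N) ℂ) :=
  {B : ↥(Matrix.unitaryGroup (Fin N) ℂ) | ∃ (t : ℝ) (R : Matrix (Fin N) (Fin N) ℝ),
    R ∈ Matrix.orthogonalGroup (Fin N) ℝ ∧ R.det = 1 ∧
    (B : Matrix (Fin N) (Fin N) ℂ) =
      Complex.exp (t * Complex.I) • R.map (fun r : ℝ => (r : ℂ))}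

/-- The block-diagonal subgroup `SU(N-1) × U(1)` of `U(N)`, as a set: `A` is block
diagonal and the determinant of the upper `(N-1) × (N-1)` block is `1` (equivalently,
`det A` equals the last diagonal entry). -/
def suTimesU1Set (N : ℕ) : Set ↥(Matrix.unitaryGroup (Fin N) ℂ) :=
  {A : ↥(Matrix.unitaryGroup (Fin N) ℂ) | A ∈ blockDiagSet N ∧ ∀ i j : Fin N,
    (i : ℕ) = N - 1 → (j : ℕ) = N - 1 →
      (A : Matrix (Fin N) (Fin N) ℂ).det = (A : Matrix (Fin N) (Fin N) ℂ) i j}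

/-- The subgroup `H^N_{k₁,k₂}` of `U(N)`: block-diagonal matrices `diag(B, a)` with
`B ∈ U(N-1)`, `a ∈ U(1)` and `a^{k₁} = (det B)^{k₂}`. Here `a` is the last diagonal entry
and `det B = det A · a⁻¹`. -/
def HkSet (N : ℕ) (k₁ k₂ : ℤ) : Set ↥(Matrix.unitaryGroup (Fin N) ℂ) :=
  {A : ↥(Matrix.unitaryGroup (Fin N) ℂ) | A ∈ blockDiagSet N ∧ ∀ i j : Fin N,
    (i : ℕ) = N - 1 → (j : ℕ) = N - 1 →
      ((A : Matrix (Fin N) (Fin N) ℂ) i j) ^ k₁ =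
        ((A : Matrix (Fin N) (Fin N) ℂ).det * ((A : Matrix (Fin N) (Fin N) ℂ) i j)⁻¹) ^ k₂}

set_option linter.all false

section PartA1
open Filter Topology NormedSpace
section LieGen
variable {𝔸 : Type*} [NormedRing 𝔸] [NormedAlgebra ℝ 𝔸] [CompleteSpace 𝔸]

structure ClGrp (G : Set 𝔸) : Prop where
  closed : IsClosed G
  one : (1 : 𝔸) ∈ G
  mul : ∀ a ∈ G, ∀ b ∈ G, a * b ∈ G
  inv : ∀ a ∈ G, ∃ b ∈ G, a * b = 1 ∧ b * a = 1

theorem exists_log (𝔸 : Type*) [NormedRing 𝔸] [NormedAlgebra ℝ 𝔸] [CompleteSpace 𝔸] :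
    ∃ L : 𝔸 → 𝔸, L 1 = 0 ∧ HasStrictFDerivAt L (ContinuousLinearMap.id ℝ 𝔸) 1 ∧
      (∀ᶠ g in 𝓝 (1:𝔸), exp (L g) = g) ∧ (∀ᶠ x in 𝓝 (0:𝔸), L (exp x) = x) := by
  have h : HasStrictFDerivAt (exp : 𝔸 → 𝔸) ((ContinuousLinearEquiv.refl ℝ 𝔸 : 𝔸 ≃L[ℝ] 𝔸) : 𝔸 →L[ℝ] 𝔸) 0 :=
    hasStrictFDerivAt_exp_zero
  refine ⟨h.localInverse, ?_, ?_, ?_, ?_⟩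
  · have := h.localInverse_apply_image
    simpa [exp_zero] using this
  · have := h.to_localInverse
    simpa [exp_zero] using this
  · have := h.eventually_right_inverse
    simpa [exp_zero] using this
  · exact h.eventually_left_inverse

theorem exp_nsmul_real (k : ℕ) (x : 𝔸) : exp ((k:ℝ) • x) = exp x ^ k := by
  letI : NormedAlgebra ℚ 𝔸 := NormedAlgebra.restrictScalars ℚ ℝ 𝔸
  rw [← exp_nsmul]; congr 1; exact Nat.cast_smul_eq_nsmul ℝ k x

theorem exp_add_smul_real (s t : ℝ) (x : 𝔸) : exp ((s + t) • x) = exp (s • x) * exp (t • x) := by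
  letI : NormedAlgebra ℚ 𝔸 := NormedAlgebra.restrictScalars ℚ ℝ 𝔸
  rw [add_smul, exp_add_of_commute]
  exact ((Commute.refl x).smul_left s).smul_right t

theorem exp_mul_exp_neg (x : 𝔸) : exp x * exp (-x) = 1 := by
  letI : NormedAlgebra ℚ 𝔸 := NormedAlgebra.restrictScalars ℚ ℝ 𝔸
  rw [← exp_add_of_commute ((Commute.refl x).neg_right)]; simp

theorem exp_cont : Continuous (exp : 𝔸 → 𝔸) := by
  letI : NormedAlgebra ℚ 𝔸 := NormedAlgebra.restrictScalars ℚ ℝ 𝔸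
  exact exp_continuous

theorem ClGrp.pow {G : Set 𝔸} (hG : ClGrp G) {g : 𝔸} (h : g ∈ G) (k : ℕ) : g ^ k ∈ G := by
  induction k with
  | zero => simpa using hG.one
  | succ k ih => rw [pow_succ]; exact hG.mul _ ih _ h

theorem ClGrp.exp_neg {G : Set 𝔸} (hG : ClGrp G) {x : 𝔸} (h : exp x ∈ G) : exp (-x) ∈ G := by
  obtain ⟨b, hb, h1, h2⟩ := hG.inv _ h
  have : exp (-x) = b := by
    calc exp (-x) = b * exp x * exp (-x) := by rw [h2, one_mul]
      _ = b := by rw [mul_assoc, exp_mul_exp_neg, mul_one]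
  rwa [this]

theorem ClGrp.T0 {G : Set 𝔸} (hG : ClGrp G) (g : ℕ → 𝔸) (hg : ∀ n, g n ∈ G) (c : ℕ → ℝ)
    (hc : Tendsto c atTop atTop) (Z : 𝔸) (hZ : Tendsto (fun n => c n • (g n - 1)) atTop (𝓝 Z))
    (t : ℝ) : exp (t • Z) ∈ G := by
  obtain ⟨L, hL1, hLd, hL2, -⟩ := exists_log 𝔸
  have hg1 : Tendsto (fun n => g n - 1) atTop (𝓝 0) := by
    have h1 : Tendsto (fun n => (c n)⁻¹ • (c n • (g n - 1))) atTop (𝓝 ((0:ℝ) • Z)) :=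
      (tendsto_inv_atTop_zero.comp hc).smul hZ
    rw [zero_smul] at h1
    refine h1.congr' ?_
    filter_upwards [hc.eventually_gt_atTop 0] with n hn
    rw [smul_smul, inv_mul_cancel₀ hn.ne', one_smul]
  have hg1' : Tendsto g atTop (𝓝 1) := by
    have := hg1.add_const 1
    simpa using this
  have hLZ : Tendsto (fun n => c n • L (g n)) atTop (𝓝 Z) := by
    have h := hLd.hasFDerivAt.hasFDerivWithinAt (s := Set.univ) |>.lim (l := atTop) (c := c) (d := fun n => g n - 1) (v := Z)
      hg1 (Eventually.of_forall fun _ => Set.mem_univ _) hZ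
    simpa [hL1] using h
  have key : ∀ t : ℝ, 0 ≤ t → exp (t • Z) ∈ G := by
    intro t ht
    have h1 : Tendsto (fun n => ((⌊t * c n⌋₊ : ℝ) / c n) • (c n • L (g n))) atTop (𝓝 (t • Z)) :=
      Tendsto.smul ((tendsto_nat_floor_mul_div_atTop ht).comp hc) hLZ
    have h2 := (exp_cont.tendsto (t • Z)).comp h1
    refine hG.closed.mem_of_tendsto h2 ?_
    filter_upwards [hc.eventually_gt_atTop 0, hg1'.eventually hL2] with n hn hn2
    simp only [Function.comp]
    rw [smul_smul, div_mul_cancel₀ _ hn.ne', exp_nsmul_real, hn2]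
    exact hG.pow (hg n) _
  rcases le_total 0 t with ht | ht
  · exact key t ht
  · have := hG.exp_neg (key (-t) (by linarith))
    simpa using this

theorem exp_deriv_zero (X : 𝔸) : HasDerivAt (fun s : ℝ => exp (s • X)) X 0 := by
  have := hasDerivAt_exp_smul_const (𝕂 := ℝ) X (0:ℝ)
  simpa using this

theorem ClGrp.of_curve {G : Set 𝔸} (hG : ClGrp G) (γ : ℝ → 𝔸) (h1 : γ 0 = 1) (hγ : ∀ s, γ s ∈ G)
    (Z : 𝔸) (hd : HasDerivAt γ Z 0) (t : ℝ) : exp (t • Z) ∈ G := by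
  refine hG.T0 (fun n => γ ((n + 1 : ℝ)⁻¹)) (fun n => hγ _) (fun n => (n:ℝ) + 1)
    (tendsto_atTop_add_const_right _ _ tendsto_natCast_atTop_atTop) Z ?_ t
  have h2 := hd.tendsto_slope_zero
  have h3 : Tendsto (fun n : ℕ => ((n:ℝ) + 1)⁻¹) atTop (𝓝[≠] 0) := by
    refine tendsto_nhdsWithin_iff.2 ⟨?_, ?_⟩
    · exact tendsto_inv_atTop_zero.comp (tendsto_atTop_add_const_right _ _ tendsto_natCast_atTop_atTop)
    · filter_upwards with n
      simp only [Set.mem_compl_iff, Set.mem_singleton_iff]; positivity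
  have := h2.comp h3
  simpa [Function.comp_def, h1] using this

/-- Lie algebra of a closed matrix group. -/
def ClGrp.lie {G : Set 𝔸} (hG : ClGrp G) : Submodule ℝ 𝔸 where
  carrier := {X | ∀ t : ℝ, exp (t • X) ∈ G}
  zero_mem' := by intro t; simpa using hG.one
  add_mem' := by
    intro X Y hX hY
    apply hG.of_curve (fun s => exp (s • X) * exp (s • Y)) (by simp)
      (fun s => hG.mul _ (hX s) _ (hY s))
    have := (exp_deriv_zero X).mul (exp_deriv_zero Y)
    have e : ((fun s : ℝ => exp (s • X)) * fun s : ℝ => exp (s • Y)) =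
      fun s : ℝ => exp (s • X) * exp (s • Y) := rfl
    rw [e] at this
    simpa [add_comm] using this
  smul_mem' := by
    intro c X hX t
    rw [smul_smul]; exact hX _

theorem ClGrp.mem_lie {G : Set 𝔸} (hG : ClGrp G) {X : 𝔸} : X ∈ hG.lie ↔ ∀ t : ℝ, exp (t • X) ∈ G :=
  Iff.rfl

theorem ClGrp.exp_mem {G : Set 𝔸} (hG : ClGrp G) {X : 𝔸} (h : X ∈ hG.lie) : exp X ∈ G := by
  simpa using h 1

theorem ClGrp.Ad_mem {G : Set 𝔸} (hG : ClGrp G) {X a b : 𝔸} (h : X ∈ hG.lie) (ha : a ∈ G) (hb : b ∈ G)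
    (h1 : a * b = 1) (h2 : b * a = 1) : a * X * b ∈ hG.lie := by
  letI : NormedAlgebra ℚ 𝔸 := NormedAlgebra.restrictScalars ℚ ℝ 𝔸
  intro t
  have := exp_units_conj (⟨a, b, h1, h2⟩ : 𝔸ˣ) (t • X)
  simp only [Units.val_mk, Units.inv_mk] at this
  have e : t • (a * X * b) = a * (t • X) * b := by simp
  rw [e, this]
  exact hG.mul _ (hG.mul _ ha _ (h t)) _ hb

theorem ClGrp.lie_bracket [FiniteDimensional ℝ 𝔸] {G : Set 𝔸} (hG : ClGrp G) {X Y : 𝔸}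
    (hX : X ∈ hG.lie) (hY : Y ∈ hG.lie) : X * Y - Y * X ∈ hG.lie := by
  have hcl : IsClosed (hG.lie : Set 𝔸) := Submodule.closed_of_finiteDimensional _
  have hm : ∀ s : ℝ, exp (s • X) * Y * exp (s • (-X)) ∈ hG.lie := by
    intro s
    have e : s • (-X) = -(s • X) := by simp
    refine hG.Ad_mem hY (hX s) ?_ ?_ ?_
    · rw [e]; exact hG.exp_neg (hX s)
    · rw [e]; exact exp_mul_exp_neg _
    · rw [e]; simpa using exp_mul_exp_neg (-(s • X))
  have hd : HasDerivAt (fun s : ℝ => exp (s • X) * Y * exp (s • (-X))) (X * Y - Y * X) 0 := by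
    have := ((exp_deriv_zero X).mul_const Y).mul (exp_deriv_zero (-X))
    have e : ((fun s : ℝ => exp (s • X) * Y) * fun s : ℝ => exp (s • (-X))) =
      fun s : ℝ => exp (s • X) * Y * exp (s • (-X)) := rfl
    rw [e] at this
    simpa [sub_eq_add_neg] using this
  refine hcl.mem_of_tendsto hd.tendsto_slope_zero ?_
  filter_upwards with s
  apply Submodule.smul_mem
  exact Submodule.sub_mem _ (hm _) (hm _)

end LieGen

end PartA1

section PartA2
open Filter Topology NormedSpace
section LieGen2
variable {𝔸 : Type*} [NormedRing 𝔸] [NormedAlgebra ℝ 𝔸] [FiniteDimensional ℝ 𝔸] [CompleteSpace 𝔸]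

theorem exists_log2 (p q : Submodule ℝ 𝔸) (hpq : IsCompl p q) :
    ∃ ψ : 𝔸 → p × q, ψ 1 = 0 ∧ ContinuousAt ψ 1 ∧
      (∀ᶠ g in 𝓝 (1:𝔸), exp ((ψ g).1 : 𝔸) * exp ((ψ g).2 : 𝔸) = g) := by
  let e : (p × q) ≃L[ℝ] 𝔸 := (Submodule.prodEquivOfIsCompl p q hpq).toContinuousLinearEquiv
  have h : HasStrictFDerivAt (fun x : p × q => exp (x.1 : 𝔸) * exp (x.2 : 𝔸))
      (e : p × q →L[ℝ] 𝔸) 0 := by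
    have h1 : HasStrictFDerivAt (fun x : p × q => exp (x.1 : 𝔸))
        (p.subtypeL.comp (ContinuousLinearMap.fst ℝ p q)) 0 := by
      have := HasStrictFDerivAt.comp (g := (exp : 𝔸 → 𝔸)) (f := fun x : p × q => (x.1 : 𝔸))
        (g' := ContinuousLinearMap.id ℝ 𝔸) (0 : p × q) 
        (hasStrictFDerivAt_exp_zero (𝕂 := ℝ) (𝔸 := 𝔸))
        (p.subtypeL.comp (ContinuousLinearMap.fst ℝ p q)).hasStrictFDerivAt
      simpa [Function.comp_def] using this
    have h2 : HasStrictFDerivAt (fun x : p × q => exp (x.2 : 𝔸))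
        (q.subtypeL.comp (ContinuousLinearMap.snd ℝ p q)) 0 := by
      have := HasStrictFDerivAt.comp (g := (exp : 𝔸 → 𝔸)) (f := fun x : p × q => (x.2 : 𝔸))
        (g' := ContinuousLinearMap.id ℝ 𝔸) (0 : p × q) 
        (hasStrictFDerivAt_exp_zero (𝕂 := ℝ) (𝔸 := 𝔸))
        (q.subtypeL.comp (ContinuousLinearMap.snd ℝ p q)).hasStrictFDerivAt
      simpa [Function.comp_def] using this
    have h3 := h1.mul' h2
    have e1 : ((fun x : p × q => exp (x.1 : 𝔸)) * fun x : p × q => exp (x.2 : 𝔸)) =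
      fun x : p × q => exp (x.1 : 𝔸) * exp (x.2 : 𝔸) := rfl
    rw [e1] at h3
    have e2 : (e : p × q →L[ℝ] 𝔸) = (exp (((0 : p × q).1 : p) : 𝔸) • q.subtypeL ∘SL ContinuousLinearMap.snd ℝ p q +
      MulOpposite.op (exp (((0 : p × q).2 : q) : 𝔸)) • p.subtypeL ∘SL ContinuousLinearMap.fst ℝ p q) := by
      ext x <;> simp [e]
    rw [e2]; exact h3
  refine ⟨h.localInverse, ?_, ?_, ?_⟩
  · have := h.localInverse_apply_image
    simpa [exp_zero] using this
  · have := h.localInverse_continuousAt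
    simpa [exp_zero] using this
  · have := h.eventually_right_inverse
    simpa [exp_zero] using this

theorem ClGrp.local_exp {G : Set 𝔸} (hG : ClGrp G) :
    ∀ᶠ g in 𝓝 (1:𝔸), g ∈ G → ∃ X ∈ hG.lie, exp X = g := by
  obtain ⟨q, hq⟩ := Submodule.exists_isCompl hG.lie
  obtain ⟨ψ, h0, hc, hψ⟩ := exists_log2 _ _ hq
  by_contra hcon
  have hf := (not_eventually.1 hcon).and_eventually hψ
  obtain ⟨g, hg1, hg⟩ := exists_seq_forall_of_frequently hf
  push Not at hg
  have hYG : ∀ n, exp ((ψ (g n)).2 : 𝔸) ∈ G := by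
    intro n
    obtain ⟨⟨hgG, -⟩, h2⟩ := hg n
    have h3 := hG.exp_neg (hG.exp_mem (ψ (g n)).1.2)
    have h4 := hG.mul _ h3 _ (h2.symm ▸ hgG)
    rw [← mul_assoc] at h4
    have h5 := exp_mul_exp_neg (-((ψ (g n)).1 : 𝔸))
    rw [neg_neg] at h5
    rwa [h5, one_mul] at h4
  have hY0 : ∀ n, (ψ (g n)).2 ≠ 0 := by
    intro n hn
    obtain ⟨⟨hgG, h1⟩, h2⟩ := hg n
    apply h1 _ (ψ (g n)).1.2
    rw [hn] at h2
    simpa using h2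
  have hYt : Tendsto (fun n => (ψ (g n)).2) atTop (𝓝 0) := by
    have := (hc.tendsto.comp hg1)
    rw [h0] at this
    exact (continuous_snd.tendsto _).comp this
  have hsph : ∀ n, (‖(ψ (g n)).2‖⁻¹ • (ψ (g n)).2) ∈ Metric.sphere (0 : q) 1 := by
    intro n
    simp [norm_smul, hY0 n]
  obtain ⟨Y, hY, φ, hφ, hlim⟩ := (isCompact_sphere (0 : q) 1).tendsto_subseq hsph
  have hYl : (Y : 𝔸) ∈ hG.lie := by
    intro t
    refine hG.T0 (fun n => exp ((ψ (g (φ n))).2 : 𝔸)) (fun n => hYG _)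
      (fun n => ‖(ψ (g (φ n))).2‖⁻¹) ?_ _ ?_ t
    · apply Tendsto.inv_tendsto_nhdsGT_zero
      refine tendsto_nhdsWithin_iff.2 ⟨?_, ?_⟩
      · have := (hYt.comp hφ.tendsto_atTop).norm
        simpa using this
      · filter_upwards with n
        simpa using hY0 _
    · have h := (hasFDerivAt_exp_zero (𝕂 := ℝ) (𝔸 := 𝔸)).hasFDerivWithinAt (s := Set.univ) |>.lim 
        (l := atTop) (c := fun n => ‖(ψ (g (φ n))).2‖⁻¹) (d := fun n => ((ψ (g (φ n))).2 : 𝔸)) (v := (Y : 𝔸)) ?_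
          (Eventually.of_forall fun _ => Set.mem_univ _) ?_
      · simpa using h
      · have := (continuous_subtype_val.tendsto (0:q)).comp (hYt.comp hφ.tendsto_atTop)
        simpa [Function.comp_def] using this
      · have := (continuous_subtype_val.tendsto (Y:q)).comp hlim
        simpa [Function.comp_def] using this
  have : (Y : 𝔸) = 0 := Submodule.disjoint_def.1 hq.disjoint _ hYl Y.2
  have : Y = 0 := by simpa using this
  simp [this] at hY

theorem ClGrp.local_exp_at {G : Set 𝔸} (hG : ClGrp G) {a : 𝔸} (ha : a ∈ G) :
    ∀ᶠ g in 𝓝 a, g ∈ G → ∃ X ∈ hG.lie, a * exp X = g := by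
  obtain ⟨b, hb, h1, h2⟩ := hG.inv a ha
  have hc : Tendsto (fun g => b * g) (𝓝 a) (𝓝 1) := by
    have : Continuous (fun g : 𝔸 => b * g) := by fun_prop
    have := this.tendsto a
    rwa [h2] at this
  filter_upwards [hc.eventually hG.local_exp] with g hg hgG
  obtain ⟨X, hX, h⟩ := hg (hG.mul _ hb _ hgG)
  refine ⟨X, hX, ?_⟩
  rw [h, ← mul_assoc, h1, one_mul]

theorem ClGrp.sub_of_conn {G : Set 𝔸} (hG : ClGrp G) (hconn : IsPreconnected G) (K : Set 𝔸)
    (K1 : 1 ∈ K) (Kmul : ∀ a ∈ K, ∀ b ∈ K, a * b ∈ K) (hK : ∀ X ∈ hG.lie, exp X ∈ K) : G ⊆ K := by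
  have key : ∀ a ∈ G, ∀ᶠ g in 𝓝[G] a, (a ∈ K ↔ g ∈ K) := by
    intro a ha
    filter_upwards [mem_nhdsWithin_of_mem_nhds (hG.local_exp_at ha), self_mem_nhdsWithin] with g hg hgG
    obtain ⟨X, hX, rfl⟩ := hg hgG
    constructor
    · intro h; exact Kmul _ h _ (hK X hX)
    · intro h
      have h3 := Kmul _ h _ (hK (-X) (neg_mem hX))
      rwa [mul_assoc, exp_mul_exp_neg, mul_one] at h3
  intro g hg
  have := hconn.induction₂ (fun a b => (a ∈ K ↔ b ∈ K)) key (fun x y z _ _ _ h1 h2 => h1.trans h2)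
    (fun x y _ _ h => h.symm) hG.one hg
  exact this.1 K1

open scoped ENNReal

theorem ClGrp.dimH_eq {G : Set 𝔸} (hG : ClGrp G) :
    dimH G = (Module.finrank ℝ hG.lie : ℝ≥0∞) := by
  letI : NormedAlgebra ℚ 𝔸 := NormedAlgebra.restrictScalars ℚ ℝ 𝔸
  apply le_antisymm
  · by_contra! hlt
    obtain ⟨a, ha, h⟩ := exists_mem_nhdsWithin_lt_dimH_of_lt_dimH hlt
    let f : hG.lie → 𝔸 := fun X => a * exp (X : 𝔸)
    have hf : ContDiff ℝ 1 f := by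
      have h1 : ContDiff ℝ 1 (exp : 𝔸 → 𝔸) := by
        rw [contDiff_iff_contDiffAt]
        intro x
        exact (exp_analytic (𝕂 := ℝ) x).contDiffAt
      exact contDiff_const.mul (h1.comp hG.lie.subtypeL.contDiff)
    have h2 : Set.range f ∈ 𝓝[G] a := by
      filter_upwards [mem_nhdsWithin_of_mem_nhds (hG.local_exp_at ha), self_mem_nhdsWithin] with g hg hgG
      obtain ⟨X, hX, h⟩ := hg hgG
      exact ⟨⟨X, hX⟩, h⟩
    exact absurd (h _ h2) (not_lt.2 hf.dimH_range_le)
  · obtain ⟨L, hL1, hLd, hL2, hL3⟩ := exists_log 𝔸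
    obtain ⟨C, s, hs, hLip⟩ := hLd.exists_lipschitzOnWith
    have h1 : ∀ᶠ x : 𝔸 in 𝓝 0, exp x ∈ s := by
      have := (exp_cont (𝔸 := 𝔸)).tendsto 0
      rw [exp_zero] at this
      exact this.eventually hs
    have h2 : ∀ᶠ x : hG.lie in 𝓝 0, exp (x:𝔸) ∈ s ∧ L (exp (x:𝔸)) = x :=
      (continuous_subtype_val.tendsto (0:hG.lie)).eventually (h1.and hL3)
    set B : Set hG.lie := {x | exp (x:𝔸) ∈ s ∧ L (exp (x:𝔸)) = x} with hB
    have hd : dimH B = (Module.finrank ℝ hG.lie : ℝ≥0∞) := Real.dimH_of_mem_nhds h2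
    have hd2 : dimH ((fun x : hG.lie => (x : 𝔸)) '' B) = dimH B :=
      (isometry_subtype_coe).dimH_image _
    rw [← hd, ← hd2]
    have hsub : (fun x : hG.lie => (x : 𝔸)) '' B ⊆ L '' (s ∩ G) := by
      rintro _ ⟨x, ⟨hx1, hx2⟩, rfl⟩
      exact ⟨exp (x:𝔸), ⟨hx1, hG.exp_mem x.2⟩, hx2⟩
    calc _ ≤ dimH (L '' (s ∩ G)) := dimH_mono hsub
      _ ≤ dimH (s ∩ G) := (hLip.mono Set.inter_subset_left).dimH_image_le
      _ ≤ dimH G := dimH_mono Set.inter_subset_right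
end LieGen2

end PartA2

section PartA3
section MatLie
attribute [local instance] Matrix.linftyOpNormedRing Matrix.linftyOpNormedAlgebra

open NormedSpace

theorem eq_neg_of_exp_mul_exp {𝔸 : Type*} [NormedRing 𝔸] [NormedAlgebra ℝ 𝔸] [CompleteSpace 𝔸]
    (Y X : 𝔸) (h1 : ∀ t : ℝ, exp (t • Y) * exp (t • X) = 1) : Y = -X := by
  have h2 := (exp_deriv_zero Y).mul (exp_deriv_zero X)
  have e : ((fun t : ℝ => exp (t • Y)) * fun t : ℝ => exp (t • X)) = fun _ => 1 := by
    funext t; exact h1 t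
  rw [e] at h2
  have h3 := h2.unique (hasDerivAt_const (0:ℝ) (1 : 𝔸))
  simp at h3
  exact eq_neg_of_add_eq_zero_left h3

theorem exists_lie_matrix {N : ℕ} (H : Subgroup ↥(Matrix.unitaryGroup (Fin N) ℂ))
    (hclosed : IsClosed (H : Set ↥(Matrix.unitaryGroup (Fin N) ℂ)))
    (hconn : IsPreconnected (H : Set ↥(Matrix.unitaryGroup (Fin N) ℂ))) :
    ∃ 𝔥 : Submodule ℝ (Matrix (Fin N) (Fin N) ℂ),
      (∀ X ∈ 𝔥, X.conjTranspose = - X) ∧ (∀ X ∈ 𝔥, ∀ Y ∈ 𝔥, X * Y - Y * X ∈ 𝔥) ∧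
      unitarySubgroupDim N H = (Module.finrank ℝ 𝔥 : ℝ≥0∞) ∧
      (∀ X, X ∈ 𝔥 ↔ ∀ t : ℝ, ∃ g ∈ H, (g : Matrix (Fin N) (Fin N) ℂ) = exp (t • X)) ∧
      (∀ K : Subgroup ↥(Matrix.unitaryGroup (Fin N) ℂ),
        (∀ X ∈ 𝔥, ∃ g ∈ K, (g : Matrix (Fin N) (Fin N) ℂ) = exp X) → H ≤ K) := by
  let G : Set (Matrix (Fin N) (Fin N) ℂ) := (fun A : ↥(Matrix.unitaryGroup (Fin N) ℂ) => 
    (A : Matrix (Fin N) (Fin N) ℂ)) '' (H : Set ↥(Matrix.unitaryGroup (Fin N) ℂ))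
  have hGmem : ∀ x, x ∈ G ↔ ∃ g ∈ H, (g : Matrix (Fin N) (Fin N) ℂ) = x := fun x => Iff.rfl
  have hcl : IsClosed ((Matrix.unitaryGroup (Fin N) ℂ : Submonoid (Matrix (Fin N) (Fin N) ℂ)) : Set (Matrix (Fin N) (Fin N) ℂ)) := by
    have : ((Matrix.unitaryGroup (Fin N) ℂ : Submonoid (Matrix (Fin N) (Fin N) ℂ)) : Set (Matrix (Fin N) (Fin N) ℂ))
      = {A | A * A.conjTranspose = 1} := by
      ext A; exact Matrix.mem_unitaryGroup_iff
    rw [this]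
    exact isClosed_eq (by fun_prop) continuous_const
  have hG : ClGrp G := by
    refine ⟨?_, ?_, ?_, ?_⟩
    · exact hcl.isClosedEmbedding_subtypeVal.isClosedMap _ hclosed
    · exact ⟨1, H.one_mem, rfl⟩
    · rintro _ ⟨a, ha, rfl⟩ _ ⟨b, hb, rfl⟩
      exact ⟨a * b, H.mul_mem ha hb, rfl⟩
    · rintro _ ⟨a, ha, rfl⟩
      refine ⟨((a⁻¹ : ↥(Matrix.unitaryGroup (Fin N) ℂ)) : Matrix (Fin N) (Fin N) ℂ), ⟨a⁻¹, H.inv_mem ha, rfl⟩, ?_, ?_⟩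
      · have := congrArg (Subtype.val) (mul_inv_cancel a); exact this
      · have := congrArg (Subtype.val) (inv_mul_cancel a); exact this
  refine ⟨hG.lie, ?_, fun X hX Y hY => hG.lie_bracket hX hY, ?_, fun X => Iff.rfl, ?_⟩
  · intro X hX
    have h1 : ∀ t : ℝ, exp (t • X.conjTranspose) * exp (t • X) = 1 := by
      intro t
      obtain ⟨g, hg, h⟩ := hX t
      have h' : (g : Matrix (Fin N) (Fin N) ℂ) = exp (t • X) := h
      have h2 := Matrix.mem_unitaryGroup_iff'.1 g.2
      rw [h', Matrix.star_eq_conjTranspose, ← Matrix.exp_conjTranspose] at h2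
      simpa using h2
    exact eq_neg_of_exp_mul_exp _ _ h1
  · rw [← hG.dimH_eq]
    let e : (Matrix (Fin N) (Fin N) ℂ) ≃L[ℝ] (Fin N → Fin N → ℂ) := 
      (LinearEquiv.toContinuousLinearEquiv (LinearEquiv.refl ℝ (Fin N → Fin N → ℂ) : Matrix (Fin N) (Fin N) ℂ ≃ₗ[ℝ] (Fin N → Fin N → ℂ)))
    rw [← e.dimH_image G]
    unfold unitarySubgroupDim
    congr 1
    rw [Set.image_image]
    rfl
  · intro K hK g hg
    have := hG.sub_of_conn (hconn.image _ continuous_subtype_val.continuousOn) 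
      ((fun A : ↥(Matrix.unitaryGroup (Fin N) ℂ) => (A : Matrix (Fin N) (Fin N) ℂ)) '' (K : Set ↥(Matrix.unitaryGroup (Fin N) ℂ))) 
        ⟨1, K.one_mem, rfl⟩ (by
          rintro _ ⟨a, ha, rfl⟩ _ ⟨b, hb, rfl⟩
          exact ⟨a * b, K.mul_mem ha hb, rfl⟩) hK
    obtain ⟨k, hk, h⟩ := this ⟨g, hg, rfl⟩
    have : k = g := Subtype.ext h
    rwa [← this]
end MatLie

end PartA3

section PartB1
section OpAlg
variable {V : Type*} [NormedAddCommGroup V] [InnerProductSpace ℂ V]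
open LinearMap (adjoint)

/-- rank one operator -/
noncomputable def ro (x y : V) : V →ₗ[ℂ] V := (LinearMap.toSpanSingleton ℂ V x) ∘ₗ (innerₛₗ ℂ y)

theorem ro_apply (x y z : V) : ro x y z = inner ℂ y z • x := by simp [ro]
theorem ro_add_left (x x' y : V) : ro (x + x') y = ro x y + ro x' y := by
  ext z; simp [ro_apply]
theorem ro_add_right (x y y' : V) : ro x (y + y') = ro x y + ro x y' := by
  ext z; simp [ro_apply, inner_add_left, add_smul]
theorem ro_smul_left (c : ℂ) (x y : V) : ro (c • x) y = c • ro x y := by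
  ext z; simp [ro_apply, smul_smul, mul_comm]
theorem ro_smul_right (c : ℂ) (x y : V) : ro x (c • y) = (starRingEnd ℂ c) • ro x y := by
  ext z; simp [ro_apply, inner_smul_left, smul_smul, mul_comm]
theorem ro_neg_left (x y : V) : ro (-x) y = - ro x y := by
  ext z; simp [ro_apply]
theorem ro_neg_right (x y : V) : ro x (-y) = - ro x y := by
  ext z; simp [ro_apply]
theorem ro_sub_left (x x' y : V) : ro (x - x') y = ro x y - ro x' y := by
  ext z; simp [ro_apply, smul_sub]
theorem ro_sub_right (x y y' : V) : ro x (y - y') = ro x y - ro x y' := by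
  ext z; simp [ro_apply, inner_sub_left, sub_smul]
@[simp] theorem ro_zero_left (y : V) : ro 0 y = 0 := by
  ext z; simp [ro_apply]
@[simp] theorem ro_zero_right (y : V) : ro y 0 = 0 := by
  ext z; simp [ro_apply]
theorem ro_mul_ro (x y z w : V) : ro x y * ro z w = inner ℂ y z • ro x w := by
  ext u; simp [ro_apply, smul_smul, inner_smul_right, mul_comm]
theorem mul_ro (X : V →ₗ[ℂ] V) (x y : V) : X * ro x y = ro (X x) y := by
  ext u; simp [ro_apply]
theorem ro_mul [FiniteDimensional ℂ V] (X : V →ₗ[ℂ] V) (x y : V) : ro x y * X = ro x (adjoint X y) := by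
  ext u; simp [ro_apply, LinearMap.adjoint_inner_left]
theorem ro_adjoint [FiniteDimensional ℂ V] (x y : V) : adjoint (ro x y) = ro y x := by
  symm
  rw [LinearMap.eq_adjoint_iff]
  intro z w
  simp only [ro_apply, inner_smul_left, inner_smul_right, inner_conj_symm]
  ring
theorem ro_ne_zero {x y : V} (hx : x ≠ 0) (hy : y ≠ 0) : ro x y ≠ 0 := by
  intro h
  have := congrArg (fun f => f y) h
  simp [ro_apply, hx, hy] at this

structure IsG [FiniteDimensional ℂ V] (g : Submodule ℂ (V →ₗ[ℂ] V)) : Prop where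
  br : ∀ X ∈ g, ∀ Y ∈ g, X * Y - Y * X ∈ g
  ad : ∀ X ∈ g, adjoint X ∈ g

variable [FiniteDimensional ℂ V] {g : Submodule ℂ (V →ₗ[ℂ] V)}

theorem IsG.ro_symm (hg : IsG g) {x y : V} (h : ro x y ∈ g) : ro y x ∈ g := by
  have := hg.ad _ h
  rwa [ro_adjoint] at this

theorem IsG.ro_br (hg : IsG g) {x y z w : V} (h : ro x y ∈ g) (h' : ro z w ∈ g) :
    inner ℂ y z • ro x w - inner ℂ w x • ro z y ∈ g := by
  have := hg.br _ h _ h'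
  rwa [ro_mul_ro, ro_mul_ro] at this

theorem IsG.X_ro (hg : IsG g) {X : V →ₗ[ℂ] V} (hX : X ∈ g) {x y : V} (h : ro x y ∈ g) :
    ro (X x) y - ro x (adjoint X y) ∈ g := by
  have := hg.br _ hX _ h
  rwa [mul_ro, ro_mul] at this

/-- if all `ro u e`, `u ∈ T`, `u ⊥ e` are in `g` then so are all `ro x y - ⟪y,x⟫ ro e e` on `T` -/
theorem IsG.SLT (hg : IsG g) (T : Submodule ℂ V) {e : V} (heT : e ∈ T) (he : inner ℂ e e = 1)
    (h : ∀ u ∈ T, inner ℂ e u = 0 → ro u e ∈ g) {x y : V} (hx : x ∈ T) (hy : y ∈ T) :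
    ro x y - inner ℂ y x • ro e e ∈ g := by
  have h1 : ∀ x ∈ T, ∃ (a : ℂ) (u : V), u ∈ T ∧ inner ℂ e u = 0 ∧ inner ℂ u e = 0 ∧ x = a • e + u := by
    intro x hx
    have h2 : inner ℂ e (x - inner ℂ e x • e) = 0 := by
      rw [inner_sub_right, inner_smul_right, he]; ring
    refine ⟨inner ℂ e x, x - inner ℂ e x • e, T.sub_mem hx (T.smul_mem _ heT), h2, ?_, by abel⟩
    rw [← inner_conj_symm, h2, map_zero]
  obtain ⟨a, u, huT, hu1, hu2, rfl⟩ := h1 x hx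
  obtain ⟨b, w, hwT, hw1, hw2, rfl⟩ := h1 y hy
  have hu := h _ huT hu1
  have hw := hg.ro_symm (h _ hwT hw1)
  have hb := hg.ro_br hu hw
  rw [he, one_smul] at hb
  have key : ro (a • e + u) (b • e + w) - inner ℂ (b • e + w) (a • e + u) • ro e e =
      (ro u w - inner ℂ w u • ro e e) + a • ro e w + starRingEnd ℂ b • ro u e := by
    simp only [ro_add_left, ro_add_right, ro_smul_left, ro_smul_right, inner_add_left, inner_add_right,
      inner_smul_left, inner_smul_right, he, hu1, hw2]
    module
  rw [key]
  exact g.add_mem (g.add_mem hb (g.smul_mem _ hw)) (g.smul_mem _ hu)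

theorem sum_ro (b : OrthonormalBasis (Fin (Module.finrank ℂ V)) ℂ V) : ∑ i, ro (b i) (b i) = 1 := by
  ext z; simp [ro_apply, LinearMap.sum_apply, b.sum_repr']

theorem expand_ro (b : OrthonormalBasis (Fin (Module.finrank ℂ V)) ℂ V) (X : V →ₗ[ℂ] V) :
    X = ∑ i, ro (X (b i)) (b i) := by
  calc X = X * 1 := by rw [mul_one]
    _ = _ := by rw [← sum_ro b, Finset.mul_sum]; simp [mul_ro]

/-- If g contains all `ro x y` it is everything. -/
theorem eq_top_of_ro (h : ∀ x y, ro x y ∈ g) : g = ⊤ := by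
  rw [eq_top_iff]
  intro X _
  rw [expand_ro (stdOrthonormalBasis ℂ V) X]
  exact g.sum_mem fun i _ => h _ _

theorem IsG.top_of (hg : IsG g) (h1 : (1 : V →ₗ[ℂ] V) ∈ g) {e : V} (he : inner ℂ e e = 1)
    (h : ∀ u, inner ℂ e u = 0 → ro u e ∈ g) : g = ⊤ := by
  have h2 : ∀ x y, ro x y - inner ℂ y x • ro e e ∈ g := fun x y =>
    hg.SLT ⊤ trivial he (fun u _ => h u) trivial trivial
  have h3 : ro e e ∈ g := by
    let b := stdOrthonormalBasis ℂ V
    have h4 : ∑ i, (ro (b i) (b i) - inner ℂ (b i) (b i) • ro e e) ∈ g := g.sum_mem fun i _ => h2 _ _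
    rw [Finset.sum_sub_distrib, sum_ro] at h4
    have h5 := (g.sub_mem_iff_right h1).1 h4
    have h6 : ∑ i, inner ℂ (b i) (b i) • ro e e = (Module.finrank ℂ V : ℂ) • ro e e := by
      simp [Nat.cast_smul_eq_nsmul]
    rw [h6] at h5
    have : Nontrivial V := ⟨⟨e, 0, by rintro rfl; simp at he⟩⟩
    have h7 : (Module.finrank ℂ V : ℂ) ≠ 0 := by
      exact_mod_cast (Module.finrank_pos (R := ℂ) (M := V)).ne'
    have := g.smul_mem (Module.finrank ℂ V : ℂ)⁻¹ h5
    rwa [smul_smul, inv_mul_cancel₀ h7, one_smul] at this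
  apply eq_top_of_ro
  intro x y
  have := g.add_mem (h2 x y) (g.smul_mem (inner ℂ y x) h3)
  rwa [sub_add_cancel] at this

end OpAlg

end PartB1

section PartB2
section L1
variable {V : Type*} [NormedAddCommGroup V] [InnerProductSpace ℂ V] [FiniteDimensional ℂ V]
  {g : Submodule ℂ (V →ₗ[ℂ] V)}
open LinearMap (adjoint)

def Irr (g : Submodule ℂ (V →ₗ[ℂ] V)) : Prop :=
  ∀ W : Submodule ℂ V, (∀ X ∈ g, ∀ w ∈ W, X w ∈ W) → W = ⊥ ∨ W = ⊤

structure Ctx (g : Submodule ℂ (V →ₗ[ℂ] V)) (e1 e2 : V) : Prop where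
  hg : IsG g
  one : (1 : V →ₗ[ℂ] V) ∈ g
  n1 : inner ℂ e1 e1 = (1:ℂ)
  n2 : inner ℂ e2 e2 = (1:ℂ)
  o12 : inner ℂ e1 e2 = (0:ℂ)
  o21 : inner ℂ e2 e1 = (0:ℂ)
  E : ro e1 e2 ∈ g
  E' : ro e2 e1 ∈ g

structure Kp (e1 e2 u : V) : Prop where
  a1 : inner ℂ e1 u = (0:ℂ)
  a2 : inner ℂ e2 u = (0:ℂ)
  b1 : inner ℂ u e1 = (0:ℂ)
  b2 : inner ℂ u e2 = (0:ℂ)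

theorem Kp.mk' {e1 e2 u : V} (h1 : inner ℂ e1 u = (0:ℂ)) (h2 : inner ℂ e2 u = (0:ℂ)) : Kp e1 e2 u :=
  ⟨h1, h2, inner_eq_zero_symm.1 h1, inner_eq_zero_symm.1 h2⟩
theorem Kp.swap {e1 e2 u : V} (h : Kp e1 e2 u) : Kp e2 e1 u := ⟨h.a2, h.a1, h.b2, h.b1⟩
theorem Kp.add {e1 e2 u v : V} (h : Kp e1 e2 u) (h' : Kp e1 e2 v) : Kp e1 e2 (u + v) :=
  Kp.mk' (by rw [inner_add_right, h.a1, h'.a1, add_zero]) (by rw [inner_add_right, h.a2, h'.a2, add_zero])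
theorem Kp.smul {e1 e2 u : V} (c : ℂ) (h : Kp e1 e2 u)  : Kp e1 e2 (c • u) :=
  Kp.mk' (by rw [inner_smul_right, h.a1, mul_zero]) (by rw [inner_smul_right, h.a2, mul_zero])
theorem Kp.neg {e1 e2 u : V} (h : Kp e1 e2 u)  : Kp e1 e2 (-u) := by
  simpa using h.smul (-1)
theorem Kp.sub {e1 e2 u v : V} (h : Kp e1 e2 u) (h' : Kp e1 e2 v) : Kp e1 e2 (u - v) := by
  rw [sub_eq_add_neg]; exact h.add h'.neg
theorem Kp.zero {e1 e2 : V} : Kp e1 e2 (0:V) := Kp.mk' (by simp) (by simp)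

theorem Ctx.swap {e1 e2 : V} (c : Ctx g e1 e2) : Ctx g e2 e1 :=
  ⟨c.hg, c.one, c.n2, c.n1, c.o21, c.o12, c.E', c.E⟩

theorem Ctx.decomp {e1 e2 : V} (c : Ctx g e1 e2) (x : V) :
    ∃ (a b : ℂ) (u : V), Kp e1 e2 u ∧ x = a • e1 + b • e2 + u := by
  refine ⟨inner ℂ e1 x, inner ℂ e2 x, x - inner ℂ e1 x • e1 - inner ℂ e2 x • e2, Kp.mk' ?_ ?_, by abel⟩
  · simp only [inner_sub_right, inner_smul_right, c.n1, c.o12]; ring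
  · simp only [inner_sub_right, inner_smul_right, c.n2, c.o21]; ring

theorem Ctx.h {e1 e2 : V} (c : Ctx g e1 e2) : ro e1 e1 - ro e2 e2 ∈ g := by
  have := c.hg.ro_br c.E c.E'
  simpa [-inner_self_eq_norm_sq_to_K, c.n1, c.n2] using this

theorem Ctx.stepa {e1 e2 : V} (c : Ctx g e1 e2) {X : V →ₗ[ℂ] V} (hX : X ∈ g) {a b a' b' : ℂ} {u w : V}
    (hu : Kp e1 e2 u) (hw : Kp e1 e2 w) (h1 : X e2 = a • e1 + b • e2 + u)
    (h2 : adjoint X e1 = a' • e1 + b' • e2 + w) : ro u e1 - ro e2 w ∈ g := by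
  have h3 := c.hg.X_ro hX c.E'
  have h4 : starRingEnd ℂ b' = a := by
    have := LinearMap.adjoint_inner_left X e2 e1
    rw [h1, h2] at this
    simpa [-inner_self_eq_norm_sq_to_K, inner_add_left, inner_add_right, inner_smul_left, inner_smul_right, c.n1, c.n2, c.o12, c.o21, hu.a1, hw.b2] using this
  rw [h1, h2] at h3
  have e : ro u e1 - ro e2 w = (ro (a • e1 + b • e2 + u) e1 - ro e2 (a' • e1 + b' • e2 + w))
      - (a • (ro e1 e1 - ro e2 e2) + (b - starRingEnd ℂ a') • ro e2 e1) := by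
    simp only [ro_add_left, ro_add_right, ro_smul_left, ro_smul_right, h4]
    module
  rw [e]
  exact g.sub_mem h3 (g.add_mem (g.smul_mem _ c.h) (g.smul_mem _ c.E'))

theorem Ctx.stepa' {e1 e2 : V} (c : Ctx g e1 e2) {X : V →ₗ[ℂ] V} (hX : X ∈ g) {a b a' b' : ℂ} {u w : V}
    (hu : Kp e1 e2 u) (hw : Kp e1 e2 w) (h1 : X e1 = a • e1 + b • e2 + u)
    (h2 : adjoint X e2 = a' • e1 + b' • e2 + w) : ro u e1 + ro e2 w ∈ g := by
  have h3 := c.swap.stepa hX hu.swap hw.swap (a := b) (b := a) (a' := b') (b' := a')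
    (by rw [h1]; abel) (by rw [h2]; abel)
  have h4 := c.hg.br _ c.E' _ h3
  have e : ro u e1 + ro e2 w = - (ro e2 e1 * (ro u e2 - ro e1 w) - (ro u e2 - ro e1 w) * ro e2 e1) := by
    simp only [mul_sub, sub_mul, ro_mul_ro, c.n1, c.n2, hu.a1, hw.b2]
    module
  rw [e]
  exact g.neg_mem h4

def Ctx.W {e1 e2 : V} (c : Ctx g e1 e2) : Submodule ℂ V where
  carrier := {x | ∃ (a b : ℂ) (u w : V), Kp e1 e2 u ∧ Kp e1 e2 w ∧ x = a • e1 + b • e2 + u ∧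
    ro u e1 + ro e2 w ∈ g}
  zero_mem' := ⟨0, 0, 0, 0, Kp.zero, Kp.zero, by simp, by simp⟩
  add_mem' := by
    rintro _ _ ⟨a, b, u, w, hu, hw, rfl, h⟩ ⟨a', b', u', w', hu', hw', rfl, h'⟩
    refine ⟨a + a', b + b', u + u', w + w', hu.add hu', hw.add hw', by module, ?_⟩
    have := g.add_mem h h'
    rw [ro_add_left, ro_add_right]
    convert this using 1; abel
  smul_mem' := by
    rintro k _ ⟨a, b, u, w, hu, hw, rfl, h⟩
    refine ⟨k * a, k * b, k • u, starRingEnd ℂ k • w, hu.smul _, hw.smul _, by module, ?_⟩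
    have := g.smul_mem k h
    rw [ro_smul_left, ro_smul_right]
    simpa using this

theorem Ctx.stepb {e1 e2 : V} (c : Ctx g e1 e2) (hirr : Irr g) {u : V} (hu : Kp e1 e2 u) :
    ∃ w, Kp e1 e2 w ∧ ro u e1 + ro e2 w ∈ g := by
  have m1 : e1 ∈ c.W := ⟨1, 0, 0, 0, Kp.zero, Kp.zero, by simp, by simp⟩
  have m2 : e2 ∈ c.W := ⟨0, 1, 0, 0, Kp.zero, Kp.zero, by simp, by simp⟩
  have x1 : ∀ X ∈ g, X e1 ∈ c.W := by
    intro X hX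
    obtain ⟨a, b, u, hu, h⟩ := c.decomp (X e1)
    obtain ⟨a', b', w, hw, h'⟩ := c.decomp (adjoint X e2)
    exact ⟨a, b, u, w, hu, hw, h, c.stepa' hX hu hw h h'⟩
  have x2 : ∀ X ∈ g, X e2 ∈ c.W := by
    intro X hX
    obtain ⟨a, b, u, hu, h⟩ := c.decomp (X e2)
    obtain ⟨a', b', w, hw, h'⟩ := c.decomp (adjoint X e1)
    refine ⟨a, b, u, -w, hu, hw.neg, h, ?_⟩
    have := c.stepa hX hu hw h h'
    rwa [ro_neg_right, ← sub_eq_add_neg]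
  have inv : ∀ X ∈ g, ∀ x ∈ c.W, X x ∈ c.W := by
    rintro X hX _ ⟨a, b, u, w, hu, hw, rfl, h⟩
    have h3 := x1 _ (c.hg.br _ hX _ h)
    have e : X u = (X * (ro u e1 + ro e2 w) - (ro u e1 + ro e2 w) * X) e1 + inner ℂ e1 (X e1) • u +
       inner ℂ w (X e1) • e2 := by
      simp [-inner_self_eq_norm_sq_to_K, ro_apply, c.n1, hw.b1]
      try abel
    have hum : u ∈ c.W := ⟨0, 0, u, w, hu, hw, by simp, h⟩
    have hXu : X u ∈ c.W := by
      rw [e]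
      exact c.W.add_mem (c.W.add_mem h3 (c.W.smul_mem _ hum)) (c.W.smul_mem _ m2)
    rw [map_add, map_add, map_smul, map_smul]
    exact c.W.add_mem (c.W.add_mem (c.W.smul_mem _ (x1 X hX)) (c.W.smul_mem _ (x2 X hX))) hXu
  rcases hirr _ inv with h | h
  · exfalso
    rw [h] at m1
    have := c.n1
    rw [(Submodule.mem_bot ℂ).1 m1] at this
    simp at this
  · have : u ∈ c.W := by rw [h]; trivial
    obtain ⟨a, b, u', w, hu', hw, h1, h2⟩ := this
    have ha : a = 0 := by
      have := congrArg (fun z => inner ℂ e1 z) h1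
      simpa [-inner_self_eq_norm_sq_to_K, inner_add_right, inner_smul_right, c.n1, c.o12, hu.a1, hu'.a1] using this.symm
    have hb : b = 0 := by
      have := congrArg (fun z => inner ℂ e2 z) h1
      simpa [-inner_self_eq_norm_sq_to_K, inner_add_right, inner_smul_right, c.n2, c.o21, hu.a2, hu'.a2] using this.symm
    have : u = u' := by rw [h1, ha, hb]; simp
    rw [← this] at h2
    exact ⟨w, hw, h2⟩

theorem Ctx.top_of {e1 e2 : V} (c : Ctx g e1 e2) (h : ∀ u, Kp e1 e2 u → ro u e1 ∈ g) : g = ⊤ := by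
  refine c.hg.top_of c.one c.n1 ?_
  intro u hu
  obtain ⟨a, b, u', hu', rfl⟩ := c.decomp u
  have ha : a = 0 := by
    simpa [-inner_self_eq_norm_sq_to_K, inner_add_right, inner_smul_right, c.n1, c.o12, hu'.a1] using hu
  rw [ha, ro_add_left, zero_smul, zero_add, ro_smul_left]
  exact g.add_mem (g.smul_mem _ c.E') (h _ hu')

theorem Ctx.stepc {e1 e2 : V} (c : Ctx g e1 e2) (hirr : Irr g) {r : V} (hr : Kp e1 e2 r) (hr0 : r ≠ 0)
    (h : ro r e1 ∈ g) : g = ⊤ := by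
  apply c.top_of
  intro u hu
  obtain ⟨w, hw, hF⟩ := c.stepb hirr hu
  have h' := c.hg.ro_symm h
  have h1 := c.hg.br _ (c.hg.br _ hF _ h') _ h
  have e : (ro u e1 + ro e2 w) * ro e1 r - ro e1 r * (ro u e1 + ro e2 w) = ro u r - inner ℂ r u • ro e1 e1 := by
    simp only [mul_add, add_mul, ro_mul_ro, c.n1, hw.b1, hr.b2]
    module
  rw [e] at h1
  have e2 : (ro u r - inner ℂ r u • ro e1 e1) * ro r e1 - ro r e1 * (ro u r - inner ℂ r u • ro e1 e1) =
    inner ℂ r r • ro u e1 + inner ℂ r u • ro r e1 := by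
    simp only [mul_sub, sub_mul, ro_mul_ro, c.n1, hr.a1, hu.a1, smul_mul_assoc, mul_smul_comm]
    module
  rw [e2] at h1
  have h2 := (g.add_mem_iff_left (g.smul_mem _ h)).1 h1
  have h3 := g.smul_mem (inner ℂ r r : ℂ)⁻¹ h2
  rwa [smul_smul, inv_mul_cancel₀ (inner_self_ne_zero.2 hr0), one_smul] at h3

/-- consequences in the symplectic situation -/
theorem Ctx.stepJ {e1 e2 : V} (c : Ctx g e1 e2) (hirr : Irr g) (htop : g ≠ ⊤) :
    ∃ J : V → V, (∀ u, Kp e1 e2 u → Kp e1 e2 (J u) ∧ ro u e1 + ro e2 (J u) ∈ g) ∧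
      (∀ u w, Kp e1 e2 u → Kp e1 e2 w → ro u e1 + ro e2 w ∈ g → w = J u) ∧
      (∀ u v, Kp e1 e2 u → Kp e1 e2 v → J (u + v) = J u + J v) ∧
      (∀ (k : ℂ) u, Kp e1 e2 u → J (k • u) = starRingEnd ℂ k • J u) ∧
      (∀ u, Kp e1 e2 u → J (J u) = - u) := by
  have hR : ∀ u, Kp e1 e2 u → ro u e1 ∈ g → u = 0 := by
    intro u hu h
    by_contra h0
    exact htop (c.stepc hirr hu h0 h)
  have hR2 : ∀ u, Kp e1 e2 u → ro e2 u ∈ g → u = 0 := by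
    intro u hu h
    apply hR u hu
    have := c.hg.ro_br (c.hg.ro_symm h) c.E'
    simpa [-inner_self_eq_norm_sq_to_K, c.n2, hu.a1] using this
  have hex : ∀ u, ∃ w, Kp e1 e2 u → Kp e1 e2 w ∧ ro u e1 + ro e2 w ∈ g := by
    intro u
    by_cases hu : Kp e1 e2 u
    · obtain ⟨w, h⟩ := c.stepb hirr hu; exact ⟨w, fun _ => h⟩
    · exact ⟨0, fun h => absurd h hu⟩
  choose J hJ using hex
  have huniq : ∀ u w, Kp e1 e2 u → Kp e1 e2 w → ro u e1 + ro e2 w ∈ g → w = J u := by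
    intro u w hu hw h
    have h1 := g.sub_mem h (hJ u hu).2
    have h2 := hR2 (w - J u) (hw.sub (hJ u hu).1) (by
      rw [ro_sub_right]; convert h1 using 1; abel)
    exact sub_eq_zero.1 h2
  refine ⟨J, hJ, huniq, ?_, ?_, ?_⟩
  · intro u v hu hv
    symm
    apply huniq _ _ (hu.add hv) ((hJ u hu).1.add (hJ v hv).1)
    have := g.add_mem (hJ u hu).2 (hJ v hv).2
    rw [ro_add_left, ro_add_right]
    convert this using 1; abel
  · intro k u hu
    symm
    apply huniq _ _ (hu.smul k) ((hJ u hu).1.smul _)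
    have := g.smul_mem k (hJ u hu).2
    rw [ro_smul_left, ro_smul_right]
    simpa using this
  · intro u hu
    have k1 := (hJ u hu).1
    have k2 := (hJ _ k1).1
    have h1 := c.hg.ad _ (hJ u hu).2
    rw [map_add, ro_adjoint, ro_adjoint] at h1
    have h2 := c.hg.br _ c.E _ (hJ _ k1).2
    have e : ro e1 e2 * (ro (J u) e1 + ro e2 (J (J u))) - (ro (J u) e1 + ro e2 (J (J u))) * ro e1 e2 =
      ro e1 (J (J u)) - ro (J u) e2 := by
      simp only [mul_add, add_mul, ro_mul_ro, c.n1, c.n2, k1.a2, k2.b1]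
      module
    rw [e] at h2
    have h3 := g.add_mem h1 h2
    have h4 : ro e1 (u + J (J u)) ∈ g := by
      rw [ro_add_right]; convert h3 using 1; abel
    have := hR _ (hu.add k2) (c.hg.ro_symm h4)
    exact (neg_eq_of_add_eq_zero_right this).symm
end L1

end PartB2

section PartB3

theorem finrank_map_inf_ker {E F : Type*} [AddCommGroup E] [Module ℂ E] [AddCommGroup F] [Module ℂ F]
    [FiniteDimensional ℂ E] (g : Submodule ℂ E) (φ : E →ₗ[ℂ] F) :
    Module.finrank ℂ (g.map φ) + Module.finrank ℂ (g ⊓ LinearMap.ker φ : Submodule ℂ E) = Module.finrank ℂ g := by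
  have h := LinearMap.finrank_range_add_finrank_ker (φ.domRestrict g)
  have h1 : LinearMap.range (φ.domRestrict g) = g.map φ := LinearMap.range_domRestrict _ _
  have h2 : Module.finrank ℂ (LinearMap.ker (φ.domRestrict g)) = Module.finrank ℂ (g ⊓ LinearMap.ker φ : Submodule ℂ E) := by
    have : (LinearMap.ker (φ.domRestrict g)).map g.subtype = g ⊓ LinearMap.ker φ := by
      rw [LinearMap.ker_domRestrict, Submodule.map_comap_subtype]
    rw [← this]
    exact (LinearEquiv.finrank_eq (Submodule.equivMapOfInjective g.subtype g.injective_subtype _))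
  rw [← h, h1, h2]

section L1b
variable {V : Type*} [NormedAddCommGroup V] [InnerProductSpace ℂ V] [FiniteDimensional ℂ V]
  {g : Submodule ℂ (V →ₗ[ℂ] V)}
open LinearMap (adjoint)

structure JC (g : Submodule ℂ (V →ₗ[ℂ] V)) (e1 e2 : V) (J : V → V) : Prop where
  k : ∀ u, Kp e1 e2 u → Kp e1 e2 (J u)
  F : ∀ u, Kp e1 e2 u → ro u e1 + ro e2 (J u) ∈ g
  uniq : ∀ u w, Kp e1 e2 u → Kp e1 e2 w → ro u e1 + ro e2 w ∈ g → w = J u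
  add : ∀ u v, Kp e1 e2 u → Kp e1 e2 v → J (u + v) = J u + J v
  smul : ∀ (k : ℂ) u, Kp e1 e2 u → J (k • u) = starRingEnd ℂ k • J u
  sq : ∀ u, Kp e1 e2 u → J (J u) = - u

theorem JC.G0 {e1 e2 : V} (c : Ctx g e1 e2) {J : V → V} (j : JC g e1 e2 J) {u v : V} (hu : Kp e1 e2 u)
    (hv : Kp e1 e2 v) : ro u v - ro (J v) (J u) + inner ℂ (J u) (J v) • ro e2 e2 - inner ℂ v u • ro e1 e1 ∈ g := by
  have h1 := c.hg.ad _ (j.F v hv)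
  rw [map_add, ro_adjoint, ro_adjoint] at h1
  have h2 := c.hg.br _ (j.F u hu) _ h1
  have hJu := j.k u hu
  have hJv := j.k v hv
  convert h2 using 1
  simp only [mul_add, add_mul, ro_mul_ro, c.n1, c.n2, c.o12, c.o21, hu.a1, hu.a2, hu.b1, hu.b2, hv.a1, hv.a2, hv.b1, hv.b2,
     hJu.a1, hJu.a2, hJu.b1, hJu.b2, hJv.a1, hJv.a2, hJv.b1, hJv.b2]
  module

theorem JC.orth0 {e1 e2 : V} (c : Ctx g e1 e2) {J : V → V} (j : JC g e1 e2 J) {u v : V} (hu : Kp e1 e2 u)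
    (hv : Kp e1 e2 v) : inner ℂ u (J u) • v = (inner ℂ (J v) (J u) - inner ℂ u v) • J u := by
  have hJu := j.k u hu
  have hJv := j.k v hv
  have h2 := c.hg.br _ (j.G0 c hu hv) _ (j.F u hu)
  have e : (ro u v - ro (J v) (J u) + inner ℂ (J u) (J v) • ro e2 e2 - inner ℂ v u • ro e1 e1) * (ro u e1 + ro e2 (J u))
    - (ro u e1 + ro e2 (J u)) * (ro u v - ro (J v) (J u) + inner ℂ (J u) (J v) • ro e2 e2 - inner ℂ v u • ro e1 e1)
    = ro ((2 * inner ℂ v u) • u + (- inner ℂ (J u) u) • J v) e1 +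
      ro e2 ((2 * inner ℂ (J v) (J u)) • J u - inner ℂ u (J u) • v) := by
    simp only [mul_add, add_mul, mul_sub, sub_mul, ro_mul_ro, c.n1, c.n2, c.o12, c.o21, hu.a1, hu.a2, hu.b1, hu.b2, hv.a1, hv.a2, hv.b1, hv.b2,
     hJu.a1, hJu.a2, hJu.b1, hJu.b2, hJv.a1, hJv.a2, hJv.b1, hJv.b2, smul_mul_assoc, mul_smul_comm,
     ro_add_left, ro_smul_left, ro_add_right, ro_sub_right, ro_smul_right, map_mul, inner_conj_symm]
    have h5 : (starRingEnd ℂ) 2 = (2:ℂ) := Complex.conj_ofNat 2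
    simp only [h5]
    module
  rw [e] at h2
  have h3 := j.uniq _ _ ((hu.smul _).add (hJv.smul _)) ((hJu.smul _).sub (hv.smul _)) h2
  rw [j.add _ _ (hu.smul _) (hJv.smul _), j.smul _ _ hu, j.smul _ _ hJv, j.sq v hv] at h3
  simp only [map_mul, map_neg, inner_conj_symm] at h3
  have h4 : (2:ℂ) • (inner ℂ u (J u) • v) = (2:ℂ) • ((inner ℂ (J v) (J u) - inner ℂ u v) • J u) := by
    have h5 : (starRingEnd ℂ) 2 = (2:ℂ) := Complex.conj_ofNat 2
    rw [h5] at h3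
    have h6 := sub_eq_zero.2 h3
    rw [← sub_eq_zero, ← neg_eq_zero, ← h6]
    module
  exact smul_right_injective V (two_ne_zero (α := ℂ)) h4

theorem JC.ne {e1 e2 : V} {J : V → V} (j : JC g e1 e2 J) {u : V} (hu : Kp e1 e2 u) (h0 : u ≠ 0) : J u ≠ 0 := by
  intro h
  have h1 := j.sq u hu
  have h2 := j.smul 0 0 Kp.zero
  simp at h2
  rw [h, h2] at h1
  exact h0 (neg_eq_zero.1 h1.symm)

theorem JC.perp {e1 e2 : V} (c : Ctx g e1 e2) {J : V → V} (j : JC g e1 e2 J) {u : V} (hu : Kp e1 e2 u) :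
    inner ℂ u (J u) = 0 := by
  by_contra h
  have h1 := j.orth0 c hu hu
  set s := (inner ℂ (J u) (J u) - inner ℂ u u : ℂ)
  set t := (inner ℂ u (J u) : ℂ)
  have h2 : u = (t⁻¹ * s) • J u := by
    rw [mul_smul, ← h1, smul_smul, inv_mul_cancel₀ h, one_smul]
  generalize t⁻¹ * s = l at h2
  have h3 : J u = starRingEnd ℂ l • (- u) := by
    conv_lhs => rw [h2]
    rw [j.smul _ _ (j.k u hu), j.sq u hu]
  have h4 : (inner ℂ u (J u) : ℂ) = - (starRingEnd ℂ l * inner ℂ u u) := by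
    rw [h3, inner_smul_right, inner_neg_right]; ring
  rw [h3, smul_smul, smul_neg, ← neg_smul] at h2
  have h5 : (1 + l * starRingEnd ℂ l) • u = 0 := by
    rw [add_smul, one_smul]; nth_rewrite 1 [h2]; rw [← add_smul]; simp
  rcases smul_eq_zero.1 h5 with h6 | h6
  · rw [Complex.mul_conj] at h6
    have h7 : (1 + Complex.normSq l : ℝ) = 0 := by exact_mod_cast h6
    linarith [Complex.normSq_nonneg l]
  · apply h; simp [t, h6]

theorem JC.inn {e1 e2 : V} (c : Ctx g e1 e2) {J : V → V} (j : JC g e1 e2 J) {u v : V} (hu : Kp e1 e2 u)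
    (hv : Kp e1 e2 v) : inner ℂ (J v) (J u) = inner ℂ u v := by
  by_cases h0 : u = 0
  · subst h0
    have h2 := j.smul 0 0 Kp.zero
    simp at h2
    simp [h2]
  · have h1 := j.orth0 c hu hv
    rw [j.perp c hu, zero_smul] at h1
    rcases smul_eq_zero.1 h1.symm with h | h
    · exact sub_eq_zero.1 h
    · exact absurd h (j.ne hu h0)

theorem JC.anti {e1 e2 : V} (c : Ctx g e1 e2) {J : V → V} (j : JC g e1 e2 J) {u v : V} (hu : Kp e1 e2 u)
    (hv : Kp e1 e2 v) : inner ℂ (J u) v = - inner ℂ (J v) u := by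
  have := j.inn c (j.k v hv) hu
  rw [j.sq v hv, inner_neg_right] at this
  rw [← this, neg_neg]

theorem JC.mem {e1 e2 : V} (c : Ctx g e1 e2) {J : V → V} (j : JC g e1 e2 J) {u : V} (hu : Kp e1 e2 u) :
    ro u (J u) ∈ g := by
  have h := j.G0 c hu (j.k u hu)
  rw [j.sq u hu, inner_neg_right, ← inner_conj_symm, j.perp c hu] at h
  simp [ro_neg_left] at h
  have h2 := g.smul_mem (2⁻¹ : ℂ) h
  convert h2 using 1
  module

/-- evaluation at two vectors -/
def ev2 (e1 e2 : V) : (V →ₗ[ℂ] V) →ₗ[ℂ] (V × V) :=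
  (LinearMap.applyₗ e1).prod (LinearMap.applyₗ e2)

theorem ev2_apply (e1 e2 : V) (X : V →ₗ[ℂ] V) : ev2 e1 e2 X = (X e1, X e2) := rfl

theorem JC.rangeTop {e1 e2 : V} (c : Ctx g e1 e2) {J : V → V} (j : JC g e1 e2 J) :
    g.map (ev2 e1 e2) = ⊤ := by
  rw [eq_top_iff]
  rintro ⟨x, y⟩ -
  have t1 : ∀ X ∈ g, (X e1, X e2) ∈ g.map (ev2 e1 e2) := fun X hX => ⟨X, hX, rfl⟩
  have m1 := t1 _ c.one
  have m2 := t1 _ c.h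
  have m3 := t1 _ c.E
  have m4 := t1 _ c.E'
  simp only [ro_apply, c.n1, c.n2, c.o12, c.o21, LinearMap.sub_apply, one_smul, zero_smul, sub_zero, zero_sub, Module.End.one_apply] at m1 m2 m3 m4
  have m5 : ∀ u, Kp e1 e2 u → (u, 0) ∈ g.map (ev2 e1 e2) := by
    intro u hu
    have := t1 _ (j.F u hu)
    simpa [-inner_self_eq_norm_sq_to_K, ro_apply, c.n1, c.o12, (j.k u hu).b1, (j.k u hu).b2] using this
  have m6 : ∀ u, Kp e1 e2 u → (0, u) ∈ g.map (ev2 e1 e2) := by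
    intro u hu
    have h1 := c.hg.br _ (j.F u hu) _ c.E
    have := t1 _ h1
    simpa [-inner_self_eq_norm_sq_to_K, ro_apply, c.n1, c.n2, c.o12, c.o21, hu.a2, (j.k u hu).b1, (j.k u hu).b2] using this
  have m7 : ((e1, 0) : V × V) ∈ g.map (ev2 e1 e2) := by
    have := Submodule.smul_mem _ (2⁻¹ : ℂ) (Submodule.add_mem _ m1 m2)
    convert this using 1
    ext <;> simp
    module
  have m8 : ((0, e2) : V × V) ∈ g.map (ev2 e1 e2) := by
    have := Submodule.sub_mem _ m1 m7
    simpa using this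
  obtain ⟨a, b, u, hu, rfl⟩ := c.decomp x
  obtain ⟨a', b', u', hu', rfl⟩ := c.decomp y
  have := Submodule.add_mem _ (Submodule.add_mem _ (Submodule.add_mem _ (Submodule.smul_mem _ a m7) (Submodule.smul_mem _ b m4)) (m5 u hu))
    (Submodule.add_mem _ (Submodule.add_mem _ (Submodule.smul_mem _ a' m3) (Submodule.smul_mem _ b' m8)) (m6 u' hu'))
  simpa using this

theorem JC.Zprop {e1 e2 : V} (c : Ctx g e1 e2) {J : V → V} (j : JC g e1 e2 J) {X : V →ₗ[ℂ] V}
    (hX : X ∈ g) (h1 : X e1 = 0) (h2 : X e2 = 0) :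
    (adjoint X e1 = 0 ∧ adjoint X e2 = 0) ∧ (∀ u, Kp e1 e2 u → Kp e1 e2 (X u)) ∧
      (∀ u v, Kp e1 e2 u → Kp e1 e2 v → inner ℂ (J u) (X v) = (inner ℂ (J v) (X u) : ℂ)) := by
  have hz : ∀ w, Kp e1 e2 w → ro e2 w ∈ g → w = 0 := by
    intro w hw h
    have h3 := j.uniq 0 w Kp.zero hw (by simpa using h)
    have h4 := j.smul 0 0 Kp.zero
    simp at h4
    rw [h3, h4]
  have A1 : adjoint X e1 = 0 := by
    obtain ⟨a', b', w, hw, h'⟩ := c.decomp (adjoint X e1)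
    have h3 := c.stepa hX Kp.zero hw (a := 0) (b := 0) (by simp [h2]) h'
    have h4 := hz w hw (by simpa using h3)
    have h5 := LinearMap.adjoint_inner_right X e1 e1
    have h6 := LinearMap.adjoint_inner_right X e2 e1
    rw [h', h1] at h5
    rw [h', h2] at h6
    simp [-inner_self_eq_norm_sq_to_K, inner_add_right, inner_smul_right, c.n1, c.n2, c.o12, c.o21, h4] at h5 h6
    rw [h', h5, h6, h4]; simp
  have A2 : adjoint X e2 = 0 := by
    obtain ⟨a', b', w, hw, h'⟩ := c.decomp (adjoint X e2)
    have h3 := c.stepa' hX Kp.zero hw (a := 0) (b := 0) (by simp [h1]) h'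
    have h4 := hz w hw (by simpa using h3)
    have h5 := LinearMap.adjoint_inner_right X e1 e2
    have h6 := LinearMap.adjoint_inner_right X e2 e2
    rw [h', h1] at h5
    rw [h', h2] at h6
    simp [-inner_self_eq_norm_sq_to_K, inner_add_right, inner_smul_right, c.n1, c.n2, c.o12, c.o21, h4] at h5 h6
    rw [h', h5, h6, h4]; simp
  have kX : ∀ u, Kp e1 e2 u → Kp e1 e2 (X u) := by
    intro u hu
    apply Kp.mk'
    · rw [← LinearMap.adjoint_inner_left, A1, inner_zero_left]
    · rw [← LinearMap.adjoint_inner_left, A2, inner_zero_left]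
  have kX' : ∀ u, Kp e1 e2 u → Kp e1 e2 (adjoint X u) := by
    intro u hu
    apply Kp.mk'
    · rw [LinearMap.adjoint_inner_right, h1, inner_zero_left]
    · rw [LinearMap.adjoint_inner_right, h2, inner_zero_left]
  refine ⟨⟨A1, A2⟩, kX, ?_⟩
  intro u v hu hv
  have h3 := c.hg.br _ hX _ (j.F u hu)
  have e : X * (ro u e1 + ro e2 (J u)) - (ro u e1 + ro e2 (J u)) * X = ro (X u) e1 + ro e2 (- adjoint X (J u)) := by
    simp only [mul_add, add_mul, mul_ro, ro_mul, h2, A1, ro_neg_right]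
    simp
    try abel
  rw [e] at h3
  have h4 := j.uniq _ _ (kX u hu) (kX' _ (j.k u hu)).neg h3
  rw [← LinearMap.adjoint_inner_left]
  have h5 : adjoint X (J u) = - J (X u) := by rw [← h4, neg_neg]
  rw [h5, inner_neg_left, j.anti c (kX u hu) hv, neg_neg]

end L1b

end PartB3

section PartB4
section L1c
variable {V : Type*} [NormedAddCommGroup V] [InnerProductSpace ℂ V] [FiniteDimensional ℂ V]
  {g : Submodule ℂ (V →ₗ[ℂ] V)}
open LinearMap (adjoint)

/-- The orthogonal complement of two vectors. -/
def KpS (e1 e2 : V) : Submodule ℂ V where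
  carrier := {u | Kp e1 e2 u}
  add_mem' := fun h h' => Kp.add h h'
  zero_mem' := Kp.zero
  smul_mem' := fun c _ h => Kp.smul c h

theorem mem_KpS {e1 e2 u : V} : u ∈ KpS e1 e2 ↔ Kp e1 e2 u := Iff.rfl

theorem KpS_eq_inf_ker (S : Submodule ℂ V) (e1 e2 : V) : S ⊓ KpS e1 e2 = S ⊓ LinearMap.ker ((innerₛₗ ℂ e1).prod (innerₛₗ ℂ e2)) := by
  congr 1
  ext u
  rw [mem_KpS, LinearMap.mem_ker]
  show Kp e1 e2 u ↔ ((inner ℂ e1 u, inner ℂ e2 u) : ℂ × ℂ) = 0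
  rw [Prod.mk_eq_zero]
  exact ⟨fun h => ⟨h.a1, h.a2⟩, fun h => Kp.mk' h.1 h.2⟩

theorem finrank_KpS_ge (S : Submodule ℂ V) (e1 e2 : V) :
    Module.finrank ℂ S ≤ Module.finrank ℂ (S ⊓ KpS e1 e2 : Submodule ℂ V) + 2 := by
  have h := finrank_map_inf_ker S ((innerₛₗ ℂ e1).prod (innerₛₗ ℂ e2))
  have h1 := Submodule.finrank_le (S.map ((innerₛₗ ℂ e1).prod (innerₛₗ ℂ e2)))
  rw [Module.finrank_prod, Module.finrank_self] at h1
  rw [KpS_eq_inf_ker]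
  omega

theorem Ctx.finrank_K {e1 e2 : V} (c : Ctx g e1 e2) :
    Module.finrank ℂ V = Module.finrank ℂ (KpS e1 e2) + 2 := by
  have h := finrank_map_inf_ker (⊤ : Submodule ℂ V) ((innerₛₗ ℂ e1).prod (innerₛₗ ℂ e2))
  rw [← KpS_eq_inf_ker, top_inf_eq, finrank_top] at h
  have h1 : (⊤ : Submodule ℂ V).map ((innerₛₗ ℂ e1).prod (innerₛₗ ℂ e2)) = ⊤ := by
    rw [eq_top_iff]
    rintro ⟨a, b⟩ -
    refine ⟨a • e1 + b • e2, trivial, ?_⟩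
    show ((inner ℂ e1 _, inner ℂ e2 _) : ℂ × ℂ) = _
    simp only [inner_add_right, inner_smul_right, c.n1, c.n2, c.o12, c.o21]
    simp
  rw [h1, finrank_top, Module.finrank_prod, Module.finrank_self] at h
  omega

theorem JC.zUpper {e1 e2 : V} (c : Ctx g e1 e2) {J : V → V} (j : JC g e1 e2 J) :
    Module.finrank ℂ (g ⊓ LinearMap.ker (ev2 e1 e2) : Submodule ℂ (V →ₗ[ℂ] V)) ≤ (Module.finrank ℂ (KpS e1 e2) + 1).choose 2 := by
  set Z : Submodule ℂ (V →ₗ[ℂ] V) := g ⊓ LinearMap.ker (ev2 e1 e2) with hZ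
  set n := Module.finrank ℂ (KpS e1 e2)
  let b : OrthonormalBasis (Fin n) ℂ (KpS e1 e2) := stdOrthonormalBasis ℂ _
  have hb : ∀ i, Kp e1 e2 (b i : V) := fun i => (b i).2
  have hz : ∀ X ∈ Z, X ∈ g ∧ X e1 = 0 ∧ X e2 = 0 := by
    intro X hX
    refine ⟨hX.1, ?_⟩
    have := hX.2
    rw [SetLike.mem_coe, LinearMap.mem_ker, ev2_apply, Prod.mk_eq_zero] at this
    exact this
  have hs : ∀ X : Z, ∀ i k, inner ℂ (J (b i)) (X.1 (b k)) = (inner ℂ (J (b k)) (X.1 (b i)) : ℂ) := by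
    intro X i k
    obtain ⟨h1, h2, h3⟩ := hz X.1 X.2
    exact (j.Zprop c h1 h2 h3).2.2 _ _ (hb i) (hb k)
  let Φ : Z →ₗ[ℂ] (Sym2 (Fin n) → ℂ) :=
    { toFun := fun X => Sym2.lift ⟨fun i k => inner ℂ (J (b i)) (X.1 (b k)), fun i k => hs X i k⟩
      map_add' := by
        intro X Y; ext s
        induction s using Sym2.ind with | _ i k => simp [inner_add_right]
      map_smul' := by
        intro r X; ext s
        induction s using Sym2.ind with | _ i k => simp [inner_smul_right] }
  have hΦ : Function.Injective Φ := by
    rw [← LinearMap.ker_eq_bot, LinearMap.ker_eq_bot']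
    intro X hX
    obtain ⟨h1, h2, h3⟩ := hz X.1 X.2
    obtain ⟨-, hk, -⟩ := j.Zprop c h1 h2 h3
    have h4 : ∀ i k, inner ℂ (J (b i)) (X.1 (b k)) = (0:ℂ) := by
      intro i k
      exact congrFun hX s(i, k)
    have h5 : ∀ k, X.1 (b k) = 0 := by
      intro k
      have hw := hk _ (hb k)
      by_contra hne
      apply j.ne hw hne
      have h6 : ∀ i, inner ℂ (b i : V) (J (X.1 (b k))) = (0:ℂ) := by
        intro i
        have := j.anti c (hb i) hw
        rw [h4] at this
        exact inner_eq_zero_symm.1 (neg_eq_zero.1 this.symm)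
      have h7 : (⟨J (X.1 (b k)), j.k _ hw⟩ : KpS e1 e2) = 0 := by
        apply InnerProductSpace.ext_inner_left_basis b.toBasis
        intro i
        simp only [OrthonormalBasis.coe_toBasis, inner_zero_right]
        exact h6 i
      exact congrArg Subtype.val h7
    have h8 : ∀ u, Kp e1 e2 u → X.1 u = 0 := by
      intro u hu
      have : (X.1 ∘ₗ (KpS e1 e2).subtype) = 0 := by
        apply b.toBasis.ext
        intro i
        simpa using h5 i
      exact congrArg (fun f => f ⟨u, hu⟩) this
    ext x
    obtain ⟨p, q, u, hu, rfl⟩ := c.decomp x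
    simp [h2, h3, h8 u hu]
  have := LinearMap.finrank_le_finrank_of_injective hΦ
  rwa [Module.finrank_fintype_fun_eq_card, Sym2.card, Fintype.card_fin] at this

theorem JC.zLower {e1 e2 : V} (c : Ctx g e1 e2) {J : V → V} (j : JC g e1 e2 J) {u : V} (hu : Kp e1 e2 u) (hu0 : u ≠ 0) :
    3 ≤ Module.finrank ℂ (g ⊓ LinearMap.ker (ev2 e1 e2) : Submodule ℂ (V →ₗ[ℂ] V)) := by
  set Z : Submodule ℂ (V →ₗ[ℂ] V) := g ⊓ LinearMap.ker (ev2 e1 e2) with hZ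
  have hw := j.k u hu
  have hw0 := j.ne hu hu0
  have huw := j.perp c hu
  have hww := j.inn c hu hu
  set w := J u with hwd
  have hwu : inner ℂ w u = (0:ℂ) := inner_eq_zero_symm.1 huw
  set r : ℂ := inner ℂ u u with hr
  have hr0 : r ≠ 0 := by simpa [hr] using hu0
  have m1 : ro u w ∈ g := j.mem c hu
  have m2 : ro w u ∈ g := c.hg.ro_symm m1
  have m3 : ro u u - ro w w ∈ g := by
    have := c.hg.ro_br m1 m2
    rw [hww, ← hr, ← smul_sub] at this
    have := g.smul_mem r⁻¹ this
    rwa [smul_smul, inv_mul_cancel₀ hr0, one_smul] at this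
  have kz : ∀ X, X ∈ g → X e1 = 0 → X e2 = 0 → X ∈ Z := by
    intro X h1 h2 h3
    refine ⟨h1, ?_⟩
    rw [SetLike.mem_coe, LinearMap.mem_ker, ev2_apply, h2, h3]; rfl
  have z1 : ro u w ∈ Z := kz _ m1 (by rw [ro_apply, hw.b1, zero_smul]) (by rw [ro_apply, hw.b2, zero_smul])
  have z2 : ro w u ∈ Z := kz _ m2 (by rw [ro_apply, hu.b1, zero_smul]) (by rw [ro_apply, hu.b2, zero_smul])
  have z3 : ro u u - ro w w ∈ Z := kz _ m3 (by simp [ro_apply, hu.b1, hw.b1]) (by simp [ro_apply, hu.b2, hw.b2])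
  have hli : LinearIndependent ℂ (![⟨_, z1⟩, ⟨_, z2⟩, ⟨_, z3⟩] : Fin 3 → Z) := by
    rw [Fintype.linearIndependent_iff]
    intro a ha
    rw [Fin.sum_univ_three] at ha
    have h1 : a 0 • ro u w + a 1 • ro w u + a 2 • (ro u u - ro w w) = 0 := congrArg Subtype.val ha
    have h2 := congrArg (fun f => inner ℂ u (f u)) h1
    have h3 := congrArg (fun f => inner ℂ w (f u)) h1
    have h4 := congrArg (fun f => inner ℂ u (f w)) h1
    simp [-inner_self_eq_norm_sq_to_K, ro_apply, inner_add_right, inner_sub_right, inner_smul_right, ← hr, huw, hwu, hww, hr0] at h2 h3 h4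
    intro i
    fin_cases i
    · exact h4
    · exact h3
    · exact h2
  simpa using hli.fintype_card_le_finrank

theorem JC.n3 {e1 e2 : V} (c : Ctx g e1 e2) {J : V → V} (j : JC g e1 e2 J) 
    (hn : Module.finrank ℂ (KpS e1 e2) = 3) : False := by
  have hnz : ∃ u, Kp e1 e2 u ∧ u ≠ 0 := by
    have : KpS e1 e2 ≠ ⊥ := by rintro h; rw [h] at hn; simp at hn
    obtain ⟨u, hu, h⟩ := Submodule.exists_mem_ne_zero_of_ne_bot this
    exact ⟨u, hu, h⟩
  obtain ⟨u, hu, hu0⟩ := hnz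
  have h1 := finrank_KpS_ge (KpS e1 e2) u (J u)
  have : (KpS e1 e2 ⊓ KpS u (J u) : Submodule ℂ V) ≠ ⊥ := by rintro h; rw [h] at h1; simp at h1; omega
  obtain ⟨w, ⟨hw, hwu⟩, hw0⟩ := Submodule.exists_mem_ne_zero_of_ne_bot this
  rw [SetLike.mem_coe, mem_KpS] at hw hwu
  have i1 := j.perp c hu
  have i2 := j.perp c hw
  have i3 : inner ℂ (J w) u = (0:ℂ) := by rw [j.anti c hw hu, hwu.a2, neg_zero]
  have i4 : inner ℂ (J u) (J w) = (0:ℂ) := by rw [j.inn c hw hu, hwu.b1]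
  have i1' := inner_eq_zero_symm.1 i1
  have i2' := inner_eq_zero_symm.1 i2
  have i3' := inner_eq_zero_symm.1 i3
  have i4' := inner_eq_zero_symm.1 i4
  let f : Fin 4 → KpS e1 e2 := ![⟨u, hu⟩, ⟨J u, j.k u hu⟩, ⟨w, hw⟩, ⟨J w, j.k w hw⟩]
  have hli : LinearIndependent ℂ f := by
    apply linearIndependent_of_ne_zero_of_inner_eq_zero
    · intro i h
      have h' := congrArg Subtype.val h
      fin_cases i
      · exact hu0 h'
      · exact j.ne hu hu0 h'
      · exact hw0 h'
      · exact j.ne hw hw0 h'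
    · intro i k hik
      show inner ℂ (f i : V) (f k : V) = 0
      fin_cases i <;> fin_cases k <;> first | exact absurd rfl hik | skip
      · exact i1
      · exact hwu.a1
      · exact i3'
      · exact i1'
      · exact hwu.a2
      · exact i4
      · exact hwu.b1
      · exact hwu.b2
      · exact i2
      · exact i3
      · exact i4'
      · exact i2'
  have := hli.fintype_card_le_finrank
  simp [hn] at this

theorem L1_ctx {e1 e2 : V} (c : Ctx g e1 e2) (hirr : Irr g)
    (hd1 : (Module.finrank ℂ V - 1)^2 ≤ Module.finrank ℂ g) (hd2 : Module.finrank ℂ g ≤ (Module.finrank ℂ V - 1)^2 + 1) : False := by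
  have hN := c.finrank_K
  have htop : g ≠ ⊤ := by
    rintro rfl
    rw [finrank_top, Module.finrank_linearMap, hN] at hd2
    simp at hd2
    nlinarith
  obtain ⟨J, hJ⟩ := c.stepJ hirr htop
  have j : JC g e1 e2 J := ⟨fun u hu => (hJ.1 u hu).1, fun u hu => (hJ.1 u hu).2, hJ.2.1, hJ.2.2.1, hJ.2.2.2.1, hJ.2.2.2.2⟩
  have hd := finrank_map_inf_ker g (ev2 e1 e2)
  rw [j.rangeTop c, finrank_top, Module.finrank_prod] at hd
  have hz := j.zUpper c
  obtain ⟨u, hu, hu0⟩ : ∃ u, Kp e1 e2 u ∧ u ≠ 0 := by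
    by_contra h
    push Not at h
    apply htop
    apply c.top_of
    intro u hu
    rw [h u hu]; simp
  have hz' := j.zLower c hu hu0
  have h3 := j.n3 c
  generalize Module.finrank ℂ (KpS e1 e2) = n at *
  generalize Module.finrank ℂ (g ⊓ LinearMap.ker (ev2 e1 e2) : Submodule ℂ (V →ₗ[ℂ] V)) = z at *
  rw [hN] at hd hd1 hd2
  rw [← hd] at hd1 hd2
  have hz2 : 2 * z ≤ n * (n+1) := by
    have := Nat.triangle_succ n
    rw [Nat.choose_two_right] at hz
    simp at hz
    have := Nat.div_mul_le_self ((n+1) * n) 2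
    nlinarith
  have e1 : n + 2 - 1 = n + 1 := by omega
  rw [e1] at hd1 hd2
  have hn : n ≤ 3 := by nlinarith
  interval_cases n <;> simp_all <;> omega

theorem L1 (hg : IsG g) (h1 : (1 : V →ₗ[ℂ] V) ∈ g) (hirr : Irr g)
    (hd1 : (Module.finrank ℂ V - 1)^2 ≤ Module.finrank ℂ g) (hd2 : Module.finrank ℂ g ≤ (Module.finrank ℂ V - 1)^2 + 1)
    {x y : V} (hx : x ≠ 0) (hy : y ≠ 0) (hxy : inner ℂ x y = (0:ℂ)) (h : ro x y ∈ g) : False := by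
  have hyx := inner_eq_zero_symm.1 hxy
  have h' : ro ((‖x‖⁻¹ : ℂ) • x) ((‖y‖⁻¹ : ℂ) • y) ∈ g := by
    rw [ro_smul_left, ro_smul_right]
    exact g.smul_mem _ (g.smul_mem _ h)
  have n : ∀ x : V, x ≠ 0 → inner ℂ ((‖x‖⁻¹ : ℂ) • x) ((‖x‖⁻¹ : ℂ) • x) = (1:ℂ) := by
    intro x hx
    rw [inner_self_eq_norm_sq_to_K, norm_smul]
    simp [hx]
  exact L1_ctx (e1 := (‖x‖⁻¹ : ℂ) • x) (e2 := (‖y‖⁻¹ : ℂ) • y) ⟨hg, h1, n x hx, n y hy, by simp [inner_smul_left, inner_smul_right, hxy], by simp [inner_smul_left, inner_smul_right, hyx], h', hg.ro_symm h'⟩ hirr hd1 hd2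
end L1c

end PartB4

section PartB5
section L2
variable {V : Type*} [NormedAddCommGroup V] [InnerProductSpace ℂ V] [FiniteDimensional ℂ V]
  {g : Submodule ℂ (V →ₗ[ℂ] V)}
open LinearMap (adjoint)

theorem W0 (hg : IsG g) {t : V →ₗ[ℂ] V} (ht : t ∈ g) (hs : t.IsSymmetric) (S : Finset ℂ) {X : V →ₗ[ℂ] V} (hX : X ∈ g) :
    ∃ Y ∈ g, ∀ (a b : ℝ) (x y : V), t x = (a:ℂ) • x → t y = (b:ℂ) • y →
      inner ℂ x (Y y) = (∏ δ ∈ S, ((a:ℂ) - b - δ)) * inner ℂ x (X y) := by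
  classical
  induction S using Finset.induction_on with
  | empty => exact ⟨X, hX, by intros; simp⟩
  | insert δ S hδ ih =>
    obtain ⟨Y, hY, h⟩ := ih
    refine ⟨(t * Y - Y * t) - δ • Y, g.sub_mem (hg.br _ ht _ hY) (g.smul_mem _ hY), ?_⟩
    intro a b x y hx hy
    rw [Finset.prod_insert hδ, mul_assoc, ← h a b x y hx hy]
    simp only [LinearMap.sub_apply, Module.End.mul_apply, LinearMap.smul_apply, inner_sub_right, inner_smul_right]
    rw [← hs x (Y y), hx, hy, map_smul, inner_smul_left, inner_smul_right, Complex.conj_ofReal]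
    ring

structure W1 (g : Submodule ℂ (V →ₗ[ℂ] V)) (t : V →ₗ[ℂ] V) (α β : ℝ) : Prop where
  exa : ∃ a, a ≠ 0 ∧ t a = (α:ℂ) • a
  exb : ∃ b, b ≠ 0 ∧ t b = (β:ℂ) • b
  scal : α = β → t = (α:ℂ) • 1
  ub : ∀ w, (inner ℂ w (t w)).re ≤ α * ‖w‖^2
  lb : ∀ w, β * ‖w‖^2 ≤ (inner ℂ w (t w)).re
  pr : ∃ c : ℂ, c ≠ 0 ∧ ∀ X ∈ g, ∃ Y ∈ g, t * Y = (α:ℂ) • Y ∧ Y * t = (β:ℂ) • Y ∧ 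
    ∀ x y, t x = (α:ℂ) • x → t y = (β:ℂ) • y → inner ℂ x (Y y) = c * inner ℂ x (X y)

theorem exists_W1 (hg : IsG g) [Nontrivial V] {t : V →ₗ[ℂ] V} (ht : t ∈ g) (hs : t.IsSymmetric) : ∃ α β : ℝ, W1 g t α β := by
  classical
  let b := hs.eigenvectorBasis (rfl : Module.finrank ℂ V = _)
  let l := hs.eigenvalues (rfl : Module.finrank ℂ V = _)
  have hb : ∀ i, t (b i) = (l i : ℂ) • b i := fun i => hs.apply_eigenvectorBasis rfl i
  haveI : Nonempty (Fin (Module.finrank ℂ V)) := ⟨⟨0, Module.finrank_pos⟩⟩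
  obtain ⟨i0, hi0⟩ := Finite.exists_max l
  obtain ⟨j0, hj0⟩ := Finite.exists_min l
  have hb0 : ∀ i, b i ≠ 0 := fun i => b.orthonormal.ne_zero i
  have hray : ∀ w, (inner ℂ w (t w)).re = ∑ i, l i * ‖inner ℂ (b i) w‖^2 := by
    intro w
    have h1 : ∀ i, inner ℂ (b i) (t w) = (l i : ℂ) * inner ℂ (b i) w := by
      intro i
      rw [← hs, hb, inner_smul_left, Complex.conj_ofReal]
    rw [← b.sum_inner_mul_inner w (t w), Complex.re_sum]
    refine Finset.sum_congr rfl fun i _ => ?_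
    rw [h1, ← inner_conj_symm w (b i)]
    rw [show (starRingEnd ℂ) (inner ℂ (b i) w) * ((l i:ℂ) * inner ℂ (b i) w) = (l i : ℂ) * ((starRingEnd ℂ) (inner ℂ (b i) w) * (inner ℂ (b i) w)) by ring,
      Complex.conj_mul']
    norm_cast
  have hnorm : ∀ w, ‖w‖^2 = ∑ i, ‖inner ℂ (b i) w‖^2 := fun w => (b.sum_sq_norm_inner_right w).symm
  refine ⟨l i0, l j0, ⟨⟨b i0, hb0 _, hb _⟩, ⟨b j0, hb0 _, hb _⟩, ?_, ?_, ?_, ?_⟩⟩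
  · intro h
    apply b.toBasis.ext
    intro i
    have : l i = l i0 := le_antisymm (hi0 i) (h ▸ hj0 i)
    simp [hb, this]
  · intro w
    rw [hray, hnorm, Finset.mul_sum]
    exact Finset.sum_le_sum fun i _ => by gcongr; exact hi0 i
  · intro w
    rw [hray, hnorm, Finset.mul_sum]
    exact Finset.sum_le_sum fun i _ => by gcongr; exact hj0 i
  · let S : Finset ℂ := (Finset.univ.image (fun p : Fin (Module.finrank ℂ V) × Fin (Module.finrank ℂ V) => ((l p.1 : ℂ) - l p.2))).erase ((l i0 : ℂ) - l j0)
    refine ⟨∏ δ ∈ S, ((l i0:ℂ) - l j0 - δ), ?_, ?_⟩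
    · rw [Finset.prod_ne_zero_iff]
      intro δ hδ
      exact sub_ne_zero.2 (Finset.ne_of_mem_erase hδ).symm
    · intro X hX
      obtain ⟨Y, hY, h⟩ := W0 hg ht hs S hX
      have key : ∀ i j, inner ℂ (b i) (Y (b j)) = (0:ℂ) ∨ (l i = l i0 ∧ l j = l j0) := by
        intro i j
        by_cases hd : (l i:ℂ) - l j = (l i0 : ℂ) - l j0
        · right
          have hd' : l i - l j = l i0 - l j0 := by exact_mod_cast hd
          have := hi0 i
          have := hj0 j
          constructor <;> linarith
        · left
          rw [h (l i) (l j) _ _ (hb i) (hb j)]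
          have : (l i : ℂ) - l j ∈ S := Finset.mem_erase.2 ⟨hd, Finset.mem_image.2 ⟨(i, j), Finset.mem_univ _, rfl⟩⟩
          rw [Finset.prod_eq_zero this (sub_self _), zero_mul]
      refine ⟨Y, hY, ?_, ?_, fun x y hx hy => h _ _ _ _ hx hy⟩
      · apply b.toBasis.ext
        intro j
        apply InnerProductSpace.ext_inner_left_basis b.toBasis
        intro i
        simp only [OrthonormalBasis.coe_toBasis, Module.End.mul_apply, LinearMap.smul_apply, inner_smul_right]
        rw [← hs, hb, inner_smul_left, Complex.conj_ofReal]
        rcases key i j with h1 | h1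
        · rw [h1]; simp
        · rw [h1.1]
      · apply b.toBasis.ext
        intro j
        apply InnerProductSpace.ext_inner_left_basis b.toBasis
        intro i
        simp only [OrthonormalBasis.coe_toBasis, Module.End.mul_apply, LinearMap.smul_apply, inner_smul_right, hb, map_smul]
        rcases key i j with h1 | h1
        · rw [h1]; simp
        · rw [h1.2]

/-- transitivity -/
def Trs (g : Submodule ℂ (V →ₗ[ℂ] V)) : Prop := ∀ v, v ≠ 0 → ∀ w, ∃ X ∈ g, X v = w

theorem exists_nil (hg : IsG g) [Nontrivial V] (htr : Trs g) {t : V →ₗ[ℂ] V} (ht : t ∈ g) (hs : t.IsSymmetric)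
    (hns : ∀ a : ℂ, t ≠ a • 1) : ∃ Y ∈ g, Y ≠ 0 ∧ Y * Y = 0 := by
  obtain ⟨α, β, h⟩ := exists_W1 hg ht hs
  obtain ⟨a, ha0, ha⟩ := h.exa
  obtain ⟨b, hb0, hb⟩ := h.exb
  obtain ⟨c, hc, hp⟩ := h.pr
  obtain ⟨X, hX, hXb⟩ := htr b hb0 a
  obtain ⟨Y, hY, h1, h2, h3⟩ := hp X hX
  refine ⟨Y, hY, ?_, ?_⟩
  · rintro rfl
    have := h3 a b ha hb
    rw [hXb] at this
    simp [hc, ha0] at this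
  · have h4 : (Y * t) * Y = Y * (t * Y) := mul_assoc _ _ _
    rw [h1, h2, smul_mul_assoc, mul_smul_comm] at h4
    have h5 : ((β:ℂ) - α) • (Y * Y) = 0 := by rw [sub_smul, h4, sub_self]
    rcases smul_eq_zero.1 h5 with h6 | h6
    · exfalso
      have : α = β := by
        have := sub_eq_zero.1 h6
        exact_mod_cast this.symm
      exact hns _ (h.scal this)
    · exact h6

theorem exists_nonscalar_symm (hg : IsG g) (hN : 2 ≤ Module.finrank ℂ V) (htr : Trs g) :
    ∃ t ∈ g, t.IsSymmetric ∧ ∀ a : ℂ, t ≠ a • 1 := by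
  have : Nontrivial V := Module.nontrivial_of_finrank_pos (R := ℂ) (by omega)
  obtain ⟨v, hv⟩ := exists_ne (0:V)
  have h1 := finrank_KpS_ge (⊤ : Submodule ℂ V) v 0
  obtain ⟨w, hw0, hvw⟩ : ∃ w, w ≠ 0 ∧ inner ℂ v w = (0:ℂ) := by
    have h2 := finrank_map_inf_ker (⊤ : Submodule ℂ V) (innerₛₗ ℂ v)
    have h3 := Submodule.finrank_le ((⊤ : Submodule ℂ V).map (innerₛₗ ℂ v))
    rw [Module.finrank_self] at h3
    rw [finrank_top] at h2
    have : (⊤ ⊓ LinearMap.ker (innerₛₗ ℂ v) : Submodule ℂ V) ≠ ⊥ := by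
      rintro h; rw [h, finrank_bot] at h2; omega
    obtain ⟨w, ⟨-, hw⟩, hw0⟩ := Submodule.exists_mem_ne_zero_of_ne_bot this
    exact ⟨w, hw0, hw⟩
  obtain ⟨X, hX, hXv⟩ := htr v hv w
  have hX' := hg.ad _ hX
  by_contra hcon
  push Not at hcon
  obtain ⟨a, ha⟩ := hcon (X + adjoint X) (g.add_mem hX hX') (by
    intro x y
    simp only [LinearMap.add_apply, inner_add_left, inner_add_right, LinearMap.adjoint_inner_left, LinearMap.adjoint_inner_right]
    ring)
  obtain ⟨b, hb⟩ := hcon (Complex.I • (X - adjoint X)) (g.smul_mem _ (g.sub_mem hX hX')) (by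
    intro x y
    simp only [LinearMap.smul_apply, LinearMap.sub_apply, inner_smul_left, inner_smul_right, inner_sub_left, inner_sub_right, LinearMap.adjoint_inner_left, LinearMap.adjoint_inner_right, Complex.conj_I]
    ring)
  have e1 := congrArg (fun f => f v) ha
  have e2 := congrArg (fun f => f v) hb
  simp only [LinearMap.add_apply, LinearMap.sub_apply, LinearMap.smul_apply, Module.End.one_apply, hXv] at e1 e2
  have e3 : (2:ℂ) • w = (a - Complex.I * b) • v := by
    rw [sub_smul, mul_smul, ← e1, ← e2, smul_smul, Complex.I_mul_I]
    module
  have e4 : (2:ℂ) * inner ℂ w w = 0 := by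
    rw [← inner_smul_right, e3, inner_smul_right, inner_eq_zero_symm.1 hvw, mul_zero]
  simp [hw0] at e4

end L2

end PartB5

section PartB6
section L2b
variable {V : Type*} [NormedAddCommGroup V] [InnerProductSpace ℂ V] [FiniteDimensional ℂ V]
  {g : Submodule ℂ (V →ₗ[ℂ] V)}
open LinearMap (adjoint)

/-- eigenspaces -/
def eigS (t : V →ₗ[ℂ] V) (a : ℂ) : Submodule ℂ V := LinearMap.ker (t - a • 1)
theorem mem_eigS {t : V →ₗ[ℂ] V} {a : ℂ} {v : V} : v ∈ eigS t a ↔ t v = a • v := by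
  rw [eigS, LinearMap.mem_ker, LinearMap.sub_apply, sub_eq_zero]; rfl

theorem adj_sym_of_right {t Y : V →ₗ[ℂ] V} (hs : t.IsSymmetric) {β : ℝ} (h : Y * t = (β:ℂ) • Y) (v : V) :
    t (adjoint Y v) = (β:ℂ) • adjoint Y v := by
  apply ext_inner_right ℂ
  intro w
  rw [hs, LinearMap.adjoint_inner_left, inner_smul_left, LinearMap.adjoint_inner_left, Complex.conj_ofReal,
    ← inner_smul_right]
  congr 1
  exact congrArg (fun f => f w) h

theorem comm_symm (X : V →ₗ[ℂ] V) : (X * adjoint X - adjoint X * X).IsSymmetric := by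
  intro x y
  simp only [LinearMap.sub_apply, Module.End.mul_apply, inner_sub_left, inner_sub_right, LinearMap.adjoint_inner_left, LinearMap.adjoint_inner_right]
  congr 1
  rw [← LinearMap.adjoint_inner_left, LinearMap.adjoint_inner_right]

theorem adj_self_inj {X : V →ₗ[ℂ] V} {v : V} (h : adjoint X (X v) = 0) : X v = 0 := by
  have := LinearMap.adjoint_inner_right X v (X v)
  rw [h, inner_zero_right] at this
  exact inner_self_eq_zero.1 this.symm

theorem adj_self_inj' {X : V →ₗ[ℂ] V} {v : V} (h : X (adjoint X v) = 0) : adjoint X v = 0 := by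
  have := LinearMap.adjoint_inner_right X (adjoint X v) v
  rw [h, inner_zero_left] at this
  exact inner_self_eq_zero.1 this

theorem nil_adj {X : V →ₗ[ℂ] V} (h : X * X = 0) : adjoint X * adjoint X = 0 := by
  ext v
  apply ext_inner_right ℂ
  intro w
  rw [Module.End.mul_apply, LinearMap.adjoint_inner_left, LinearMap.adjoint_inner_left]
  have := congrArg (fun f => f w) h
  simp only [Module.End.mul_apply] at this
  rw [this]; simp

theorem eig_pos {X : V →ₗ[ℂ] V} (h : X * X = 0) {α : ℝ} (hα : 0 < α) {v : V}
    (hv : (X * adjoint X - adjoint X * X) v = (α:ℂ) • v) : v ∈ LinearMap.range X := by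
  have hX : ∀ w, X (X w) = 0 := fun w => congrArg (fun f => f w) h
  simp only [LinearMap.sub_apply, Module.End.mul_apply] at hv
  have h1 : X v = 0 := by
    have h2 := congrArg X hv
    rw [map_sub, hX, map_smul, zero_sub] at h2
    have h3 : (inner ℂ (X v) (X (adjoint X (X v))) : ℂ) = - (α * inner ℂ (X v) (X v)) := by
      rw [← inner_smul_right, ← h2, inner_neg_right, neg_neg]
    rw [← LinearMap.adjoint_inner_left, inner_self_eq_norm_sq_to_K, inner_self_eq_norm_sq_to_K] at h3
    have h4 : ‖adjoint X (X v)‖^2 = - (α * ‖X v‖^2) := by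
      have := congrArg Complex.re h3
      simp only [← Complex.ofReal_pow, ← Complex.ofReal_mul, ← Complex.ofReal_neg, Complex.ofReal_re, Complex.coe_algebraMap] at this
      exact this
    have h5 : ‖X v‖^2 ≤ 0 := by nlinarith [sq_nonneg ‖adjoint X (X v)‖]
    have h6 : ‖X v‖ = 0 := by nlinarith [sq_nonneg ‖X v‖]
    exact norm_eq_zero.1 h6
  rw [h1, map_zero, sub_zero] at hv
  refine ⟨(α:ℂ)⁻¹ • adjoint X v, ?_⟩
  rw [map_smul, hv, smul_smul, inv_mul_cancel₀ (by exact_mod_cast hα.ne'), one_smul]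

theorem finrank_range_adj (X : V →ₗ[ℂ] V) : Module.finrank ℂ (LinearMap.range (adjoint X)) = Module.finrank ℂ (LinearMap.range X) := by
  have aux : ∀ X : V →ₗ[ℂ] V, Module.finrank ℂ (LinearMap.range (adjoint X)) ≤ Module.finrank ℂ (LinearMap.range X) := by
    intro X
    have h1 : Function.Injective (X.domRestrict (LinearMap.range (adjoint X))) := by
      rw [← LinearMap.ker_eq_bot, LinearMap.ker_eq_bot']
      rintro ⟨_, v, rfl⟩ h
      have := adj_self_inj' (X := X) (v := v) h
      exact Subtype.ext this
    have h2 : LinearMap.range (X.domRestrict (LinearMap.range (adjoint X))) ≤ LinearMap.range X := by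
      rintro _ ⟨v, rfl⟩; exact ⟨v, rfl⟩
    rw [← LinearMap.finrank_range_of_inj h1]
    exact Submodule.finrank_mono h2
  apply le_antisymm (aux X)
  have := aux (adjoint X)
  rwa [LinearMap.adjoint_adjoint] at this

theorem L2 (hg : IsG g) (hN : 2 ≤ Module.finrank ℂ V) (htr : Trs g) :
    ∃ x y : V, x ≠ 0 ∧ y ≠ 0 ∧ inner ℂ x y = (0:ℂ) ∧ ro x y ∈ g := by
  classical
  have : Nontrivial V := Module.nontrivial_of_finrank_pos (R := ℂ) (by omega)
  obtain ⟨t0, ht0, hs0, hns0⟩ := exists_nonscalar_symm hg hN htr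
  obtain ⟨Y0, hY0, hY00, hYY0⟩ := exists_nil hg htr ht0 hs0 hns0
  have hex : ∃ r, ∃ X ∈ g, X ≠ 0 ∧ X * X = 0 ∧ Module.finrank ℂ (LinearMap.range X) = r := ⟨_, Y0, hY0, hY00, hYY0, rfl⟩
  obtain ⟨X, hX, hX0, hXX, hr⟩ := Nat.find_spec hex
  have hmin : ∀ Y ∈ g, Y ≠ 0 → Y * Y = 0 → Module.finrank ℂ (LinearMap.range X) ≤ Module.finrank ℂ (LinearMap.range Y) := by
    intro Y h1 h2 h3
    rw [hr]
    exact Nat.find_min' hex ⟨Y, h1, h2, h3, rfl⟩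
  clear hr
  have hXX' : ∀ w, X (X w) = 0 := fun w => congrArg (fun f => f w) hXX
  have hXa := nil_adj hXX
  have hXa' : ∀ w, adjoint X (adjoint X w) = 0 := fun w => congrArg (fun f => f w) hXa
  -- the rank is one
  have hrank : Module.finrank ℂ (LinearMap.range X) ≤ 1 := by
    by_contra hlt
    push Not at hlt
    set t := X * adjoint X - adjoint X * X with htd
    have htg : t ∈ g := hg.br _ hX _ (hg.ad _ hX)
    have hs : t.IsSymmetric := comm_symm X
    obtain ⟨α, β, W⟩ := exists_W1 hg htg hs
    obtain ⟨v, hv⟩ : ∃ v, X v ≠ 0 := by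
      by_contra h; push Not at h; exact hX0 (LinearMap.ext h)
    have hu : adjoint X (X v) ≠ 0 := fun h => hv (adj_self_inj h)
    have hXu : X (adjoint X (X v)) ≠ 0 := fun h => hu (adj_self_inj' h)
    have hα : 0 < α := by
      have h1 := W.ub (X v)
      have h2 : (inner ℂ (X v) (t (X v))).re = ‖adjoint X (X v)‖^2 := by
        rw [htd]
        simp only [LinearMap.sub_apply, Module.End.mul_apply, hXX', map_zero, sub_zero]
        rw [← LinearMap.adjoint_inner_left, inner_self_eq_norm_sq_to_K]
        norm_cast
      rw [h2] at h1
      have h3 : 0 < ‖adjoint X (X v)‖^2 := by positivity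
      by_contra h4
      nlinarith [sq_nonneg ‖X v‖]
    have hβ : β < 0 := by
      have h1 := W.lb (adjoint X (X v))
      have h2 : (inner ℂ (adjoint X (X v)) (t (adjoint X (X v)))).re = - ‖X (adjoint X (X v))‖^2 := by
        rw [htd]
        simp only [LinearMap.sub_apply, Module.End.mul_apply, hXa', map_zero, zero_sub, inner_neg_right]
        rw [LinearMap.adjoint_inner_right, inner_self_eq_norm_sq_to_K]
        norm_cast
      rw [h2] at h1
      have h3 : 0 < ‖X (adjoint X (X v))‖^2 := by positivity
      by_contra h4
      nlinarith [sq_nonneg ‖adjoint X (X v)‖]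
    have hA : eigS t α ≤ LinearMap.range X := fun v hv => eig_pos hXX hα (mem_eigS.1 hv)
    have hB : eigS t β ≤ LinearMap.range (adjoint X) := by
      intro v hv
      refine eig_pos hXa (α := -β) (by linarith) ?_
      have := mem_eigS.1 hv
      rw [LinearMap.adjoint_adjoint]
      rw [htd] at this
      rw [← neg_sub, LinearMap.neg_apply, this]
      simp
    have hA' := Submodule.finrank_mono hA
    have hB' := Submodule.finrank_mono hB
    rw [finrank_range_adj] at hB'
    have ext : ∀ Y ∈ g, Y ≠ 0 → t * Y = (α:ℂ) • Y → Y * t = (β:ℂ) • Y →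
        (∀ y ∈ eigS t β, Y y = 0 → y = 0) ∧ Module.finrank ℂ (eigS t α) = Module.finrank ℂ (LinearMap.range X) ∧
         Module.finrank ℂ (eigS t β) = Module.finrank ℂ (LinearMap.range X) := by
      intro Y hY hY0 h1 h2
      have hYY : Y * Y = 0 := by
        have h4 : (Y * t) * Y = Y * (t * Y) := mul_assoc _ _ _
        rw [h1, h2, smul_mul_assoc, mul_smul_comm] at h4
        have h5 : ((β:ℂ) - α) • (Y * Y) = 0 := by rw [sub_smul, h4, sub_self]
        rcases smul_eq_zero.1 h5 with h6 | h6
        · have : β - α = 0 := by exact_mod_cast h6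
          linarith
        · exact h6
      have hm := hmin Y hY hY0 hYY
      have r1 : LinearMap.range Y ≤ eigS t α := by
        rintro _ ⟨v, rfl⟩
        exact mem_eigS.2 (congrArg (fun f => f v) h1)
      have r2 : LinearMap.range (adjoint Y) ≤ eigS t β := by
        rintro _ ⟨v, rfl⟩
        exact mem_eigS.2 (adj_sym_of_right hs h2 v)
      have f1 := Submodule.finrank_mono r1
      have f2 := Submodule.finrank_mono r2
      rw [finrank_range_adj] at f2
      refine ⟨?_, by omega, by omega⟩
      have r3 : LinearMap.range (adjoint Y) = eigS t β := Submodule.eq_of_le_of_finrank_eq r2 (by rw [finrank_range_adj]; omega)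
      intro y hy hy0
      rw [← r3] at hy
      obtain ⟨v, rfl⟩ := hy
      exact adj_self_inj' hy0
    obtain ⟨c, hc, hp⟩ := W.pr
    obtain ⟨b, hb0, hb⟩ := W.exb
    obtain ⟨a1, ha10, ha1⟩ := W.exa
    have lift : ∀ a ∈ eigS t α, ∃ Y ∈ g, t * Y = (α:ℂ) • Y ∧ Y * t = (β:ℂ) • Y ∧ Y b = c • a := by
      intro a ha
      obtain ⟨Z, hZ, hZb⟩ := htr b hb0 a
      obtain ⟨Y, hY, h1, h2, h3⟩ := hp Z hZ
      refine ⟨Y, hY, h1, h2, ?_⟩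
      have hm : Y b - c • a ∈ eigS t α := Submodule.sub_mem _ (mem_eigS.2 (congrArg (fun f => f b) h1)) (Submodule.smul_mem _ _ ha)
      have := h3 _ b (mem_eigS.1 hm) hb
      rw [hZb, ← inner_smul_right, ← sub_eq_zero, ← inner_sub_right] at this
      exact sub_eq_zero.1 (inner_self_eq_zero.1 this)
    have ne : ∀ {Y : V →ₗ[ℂ] V} {a : V}, a ≠ 0 → Y b = c • a → Y ≠ 0 := by
      rintro Y a ha h rfl
      exact smul_ne_zero hc ha h.symm
    obtain ⟨Y1, hY1, hl1, hr1, hb1⟩ := lift a1 (mem_eigS.2 ha1)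
    obtain ⟨inj1, fA, fB⟩ := ext Y1 hY1 (ne ha10 hb1) hl1 hr1
    obtain ⟨a2, ha2, ha2n⟩ : ∃ a2 ∈ eigS t α, a2 ∉ Submodule.span ℂ {a1} := by
      by_contra h
      push Not at h
      have h1 := Submodule.finrank_mono (show eigS t α ≤ _ from h)
      have h2 := finrank_span_singleton (K := ℂ) ha10
      omega
    obtain ⟨Y2, hY2, hl2, hr2, hb2⟩ := lift a2 ha2
    -- restricted maps
    have mp : ∀ {Y : V →ₗ[ℂ] V}, t * Y = (α:ℂ) • Y → ∀ y ∈ eigS t β, Y y ∈ eigS t α := by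
      intro Y h y _
      exact mem_eigS.2 (congrArg (fun f => f y) h)
    let R1 : eigS t β →ₗ[ℂ] eigS t α := Y1.restrict (mp hl1)
    let R2 : eigS t β →ₗ[ℂ] eigS t α := Y2.restrict (mp hl2)
    have hR1 : Function.Injective R1 := by
      rw [← LinearMap.ker_eq_bot, LinearMap.ker_eq_bot']
      rintro ⟨y, hy⟩ h
      exact Subtype.ext (inj1 y hy (congrArg Subtype.val h))
    let e := LinearEquiv.ofInjectiveOfFinrankEq R1 hR1 (fB.trans fA.symm)
    haveI : Nontrivial (eigS t β) := ⟨⟨⟨b, mem_eigS.2 hb⟩, 0, fun h => hb0 (congrArg Subtype.val h)⟩⟩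
    obtain ⟨μ, hμ⟩ := Module.End.exists_eigenvalue (e.symm.toLinearMap ∘ₗ R2)
    obtain ⟨y, hy⟩ := hμ.exists_hasEigenvector
    have hy1 := hy.apply_eq_smul
    have hy2 : R2 y = μ • R1 y := by
      have := congrArg e hy1
      rw [map_smul] at this
      rw [LinearMap.comp_apply, LinearEquiv.coe_coe, LinearEquiv.apply_symm_apply] at this
      exact this
    have hy3 : Y2 (y:V) = μ • Y1 (y:V) := congrArg Subtype.val hy2
    have hY3 : Y2 - μ • Y1 = 0 := by
      by_contra hne
      have := (ext (Y2 - μ • Y1) (g.sub_mem hY2 (g.smul_mem _ hY1)) hne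
        (by rw [mul_sub, mul_smul_comm, hl1, hl2, smul_sub, smul_comm])
        (by rw [sub_mul, smul_mul_assoc, hr1, hr2, smul_sub, smul_comm])).1 y y.2
        (by rw [LinearMap.sub_apply, LinearMap.smul_apply, hy3, sub_self])
      exact hy.2 (Subtype.ext this)
    have h9 := congrArg (fun f => f b) hY3
    simp only [LinearMap.sub_apply, LinearMap.smul_apply, hb1, hb2, LinearMap.zero_apply] at h9
    rw [smul_comm, ← smul_sub] at h9
    have h10 := (smul_eq_zero.1 h9).resolve_left hc
    apply ha2n
    rw [Submodule.mem_span_singleton]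
    exact ⟨μ, (sub_eq_zero.1 h10).symm⟩
  -- conclusion
  obtain ⟨v, hv⟩ : ∃ v, X v ≠ 0 := by
    by_contra h; push Not at h; exact hX0 (LinearMap.ext h)
  set x := X v with hx
  have hspan : Submodule.span ℂ {x} = LinearMap.range X := by
    apply Submodule.eq_of_le_of_finrank_le
    · rw [Submodule.span_singleton_le_iff_mem]; exact ⟨v, rfl⟩
    · rw [finrank_span_singleton hv]; exact hrank
  have hxx : (inner ℂ x x : ℂ) ≠ 0 := by simpa using hv
  have hform : X = ro x ((starRingEnd ℂ (inner ℂ x x)⁻¹) • adjoint X x) := by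
    ext w
    rw [ro_apply, inner_smul_left, LinearMap.adjoint_inner_left]
    have : X w ∈ Submodule.span ℂ {x} := by rw [hspan]; exact ⟨w, rfl⟩
    obtain ⟨k, hk⟩ := Submodule.mem_span_singleton.1 this
    rw [← hk, inner_smul_right, Complex.conj_conj]
    congr 1
    field_simp
  set y := (starRingEnd ℂ (inner ℂ x x)⁻¹) • adjoint X x
  have hy : y ≠ 0 := by
    intro h; rw [h] at hform; simp at hform; exact hX0 hform
  refine ⟨x, y, hv, hy, ?_, hform ▸ hX⟩
  have h1 := hXX
  rw [hform, ro_mul_ro] at h1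
  have := (smul_eq_zero.1 h1).resolve_right (ro_ne_zero hv hy)
  exact inner_eq_zero_symm.1 this

end L2b

end PartB6

section PartB7
section Red
variable {V : Type*} [NormedAddCommGroup V] [InnerProductSpace ℂ V] [FiniteDimensional ℂ V]
  {g : Submodule ℂ (V →ₗ[ℂ] V)}
open LinearMap (adjoint)

theorem codim_one {E : Type*} [AddCommGroup E] [Module ℂ E] [FiniteDimensional ℂ E] {p q : Submodule ℂ E} (hpq : p ≤ q)
    (h : Module.finrank ℂ q ≤ Module.finrank ℂ p + 1) : ∃ f : E →ₗ[ℂ] ℂ, ∀ x ∈ q, f x = 0 → x ∈ p := by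
  by_cases hq : q ≤ p
  · exact ⟨0, fun x hx _ => hq hx⟩
  · obtain ⟨x0, hx0, hx0p⟩ := SetLike.not_le_iff_exists.1 hq
    obtain ⟨f, hf, hfp⟩ := Submodule.exists_le_ker_of_notMem hx0p
    refine ⟨f, ?_⟩
    have hlt : p < p ⊔ Submodule.span ℂ {x0} := by
      rw [left_lt_sup, Submodule.span_singleton_le_iff_mem]; exact hx0p
    have hle : p ⊔ Submodule.span ℂ {x0} ≤ q := sup_le hpq (by rwa [Submodule.span_singleton_le_iff_mem])
    have h1 := Submodule.finrank_lt_finrank_of_lt hlt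
    have heq := Submodule.eq_of_le_of_finrank_le hle (by omega)
    intro x hx hfx
    rw [← heq] at hx
    obtain ⟨y, hy, z, hz, rfl⟩ := Submodule.mem_sup.1 hx
    obtain ⟨c, rfl⟩ := Submodule.mem_span_singleton.1 hz
    have hfy : f y = 0 := hfp hy
    rw [map_add, hfy, map_smul, zero_add, smul_eq_mul] at hfx
    have hc := (mul_eq_zero.1 hfx).resolve_right hf
    simpa [hc] using hy

theorem unit_of_ne {x : V} (hx : x ≠ 0) : inner ℂ ((‖x‖⁻¹ : ℂ) • x) ((‖x‖⁻¹ : ℂ) • x) = (1:ℂ) := by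
  rw [inner_self_eq_norm_sq_to_K, norm_smul]
  simp [hx]

theorem lemmaF (f : (V →ₗ[ℂ] V) →ₗ[ℂ] ℂ) (T : Submodule ℂ V) (hT : T ≠ ⊥) :
    ∃ x ∈ T, inner ℂ x x = (1:ℂ) ∧ ∀ y ∈ T, inner ℂ x y = (0:ℂ) → f (ro x y) = 0 := by
  let b := stdOrthonormalBasis ℂ T
  let Z : T →ₗ[ℂ] T :=
    { toFun := fun x => ∑ i, f (ro (x:V) (b i)) • b i
      map_add' := by intro x y; simp [ro_add_left, add_smul, Finset.sum_add_distrib]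
      map_smul' := by intro c x; simp [ro_smul_left, mul_smul, Finset.smul_sum] }
  haveI : Nontrivial T := Submodule.nontrivial_iff_ne_bot.2 hT
  obtain ⟨μ, hμ⟩ := Module.End.exists_eigenvalue Z
  obtain ⟨x, hx⟩ := hμ.exists_hasEigenvector
  have hx1 := hx.apply_eq_smul
  have hx0 : (x:V) ≠ 0 := fun h => hx.2 (Subtype.ext h)
  refine ⟨(‖(x:V)‖⁻¹ : ℂ) • (x:V), T.smul_mem _ x.2, unit_of_ne hx0, ?_⟩
  intro y hy hxy
  have hxy' : inner ℂ (x:V) y = (0:ℂ) := by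
    rw [inner_smul_left] at hxy
    refine (mul_eq_zero.1 hxy).resolve_left ?_
    simpa using hx0
  rw [ro_smul_left, map_smul, smul_eq_mul]
  have key : f (ro (x:V) y) = inner ℂ (⟨y, hy⟩ : T) (Z x) := by
    have h1 : y = ∑ i, (inner ℂ (b i) (⟨y, hy⟩ : T)) • (b i : V) := by
      have := congrArg Subtype.val (b.sum_repr' (⟨y, hy⟩ : T))
      simpa using this.symm
    have h2 : ∀ s : Finset (Fin (Module.finrank ℂ T)), ∀ c : Fin (Module.finrank ℂ T) → ℂ, ro (x:V) (∑ i ∈ s, c i • (b i : V)) = ∑ i ∈ s, (starRingEnd ℂ (c i)) • ro (x:V) (b i) := by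
      intro s c
      classical
      induction s using Finset.induction_on with
      | empty => simp
      | insert a s ha ih => rw [Finset.sum_insert ha, Finset.sum_insert ha, ro_add_right, ih, ro_smul_right]
    conv_lhs => rw [h1]
    rw [h2, map_sum]
    show _ = inner ℂ (⟨y, hy⟩ : T) (∑ i, f (ro (x:V) (b i)) • b i)
    rw [inner_sum]
    refine Finset.sum_congr rfl fun i _ => ?_
    rw [map_smul, inner_smul_right, inner_conj_symm, smul_eq_mul, mul_comm]
  rw [key, hx1, inner_smul_right]
  have : inner ℂ (⟨y, hy⟩ : T) x = (0:ℂ) := inner_eq_zero_symm.1 hxy'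
  rw [this]; simp

/-- block-diagonal operators -/
def Blk {ι : Type*} (S : ι → Submodule ℂ V) : Submodule ℂ (V →ₗ[ℂ] V) where
  carrier := {X | ∀ i, ∀ w ∈ S i, X w ∈ S i}
  add_mem' := fun h h' i w hw => (S i).add_mem (h i w hw) (h' i w hw)
  zero_mem' := fun i w hw => (S i).zero_mem
  smul_mem' := fun c _ h i w hw => (S i).smul_mem c (h i w hw)

theorem finrank_Blk {ι : Type*} [Fintype ι] (S : ι → Submodule ℂ V) (hS : ⨆ i, S i = ⊤) :
    Module.finrank ℂ (Blk S) ≤ ∑ i, Module.finrank ℂ (S i) ^ 2 := by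
  let Φ : Blk S →ₗ[ℂ] (∀ i, S i →ₗ[ℂ] S i) :=
    { toFun := fun X i => X.1.restrict (X.2 i)
      map_add' := by intro X Y; rfl
      map_smul' := by intro c X; rfl }
  have hΦ : Function.Injective Φ := by
    rw [← LinearMap.ker_eq_bot, LinearMap.ker_eq_bot']
    intro X hX
    have h1 : ∀ i, S i ≤ LinearMap.ker X.1 := by
      intro i w hw
      have := congrArg (fun f => f i ⟨w, hw⟩) hX
      exact congrArg Subtype.val this
    have h2 := iSup_le h1
    rw [hS] at h2
    ext w
    exact h2 (Submodule.mem_top (x := w))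
  have := LinearMap.finrank_le_finrank_of_injective hΦ
  rw [Module.finrank_pi_fintype] at this
  refine this.trans (le_of_eq (Finset.sum_congr rfl fun i _ => ?_))
  rw [Module.finrank_linearMap, sq]

theorem perp_inv (hg : IsG g) {W : Submodule ℂ V} (hW : ∀ X ∈ g, ∀ w ∈ W, X w ∈ W) : ∀ X ∈ g, ∀ w ∈ Wᗮ, X w ∈ Wᗮ := by
  intro X hX w hw
  rw [Submodule.mem_orthogonal] at hw ⊢
  intro u hu
  rw [← LinearMap.adjoint_inner_left]
  exact hw _ (hW _ (hg.ad _ hX) _ hu)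

theorem unit_of_finrank_one {W : Submodule ℂ V} (h : Module.finrank ℂ W = 1) : ∃ e, inner ℂ e e = (1:ℂ) ∧ W = Submodule.span ℂ {e} := by
  have : W ≠ ⊥ := by rintro rfl; simp at h
  obtain ⟨w, hw, hw0⟩ := Submodule.exists_mem_ne_zero_of_ne_bot this
  refine ⟨(‖w‖⁻¹ : ℂ) • w, unit_of_ne hw0, ?_⟩
  symm
  apply Submodule.eq_of_le_of_finrank_le
  · rw [Submodule.span_singleton_le_iff_mem]; exact W.smul_mem _ hw
  · rw [h, finrank_span_singleton]
    intro h0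
    have := unit_of_ne hw0
    rw [h0] at this; simp at this

theorem exists_line (hg : IsG g) (hirr : ¬ Irr g) (hd : (Module.finrank ℂ V - 1)^2 ≤ Module.finrank ℂ g) :
    ∃ e : V, inner ℂ e e = (1:ℂ) ∧ (∀ X ∈ g, ∀ w ∈ Submodule.span ℂ {e}, X w ∈ Submodule.span ℂ {e}) := by
  rw [Irr] at hirr
  push Not at hirr
  obtain ⟨W, hW, h0, h1⟩ := hirr
  have hW' := perp_inv hg hW
  have hf := Submodule.finrank_add_finrank_orthogonal W
  have hp : 0 < Module.finrank ℂ W := Nat.pos_of_ne_zero fun h => h0 (Submodule.finrank_eq_zero.1 h)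
  have hq : 0 < Module.finrank ℂ Wᗮ := Nat.pos_of_ne_zero fun h => h1 (by
    have := Submodule.finrank_eq_zero.1 h
    exact (Submodule.orthogonal_eq_bot_iff).1 this)
  have hle : g ≤ Blk ![W, Wᗮ] := by
    intro X hX i
    fin_cases i
    · exact hW X hX
    · exact hW' X hX
  have hb := finrank_Blk ![W, Wᗮ] (by
    rw [eq_top_iff, ← Submodule.sup_orthogonal_of_hasOrthogonalProjection (K := W)]
    exact sup_le (le_iSup ![W, Wᗮ] 0) (le_iSup ![W, Wᗮ] 1))
  have hm := Submodule.finrank_mono hle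
  rw [Fin.sum_univ_two] at hb
  change _ ≤ Module.finrank ℂ W ^ 2 + Module.finrank ℂ Wᗮ ^ 2 at hb
  have hb2 := hd.trans (hm.trans hb)
  clear hb hm hle
  have hor : Module.finrank ℂ W = 1 ∨ Module.finrank ℂ Wᗮ = 1 := by
    rw [← hf] at hb2
    generalize Module.finrank ℂ W = p at hb2 hp hq ⊢
    generalize Module.finrank ℂ Wᗮ = q at hb2 hp hq ⊢
    by_contra hcon
    push Not at hcon
    obtain ⟨p, rfl⟩ : ∃ p', p = p' + 2 := ⟨p - 2, by omega⟩
    obtain ⟨q, rfl⟩ : ∃ q', q = q' + 2 := ⟨q - 2, by omega⟩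
    have : p + 2 + (q + 2) - 1 = p + q + 3 := by omega
    rw [this] at hb2
    nlinarith
  rcases hor with h | h
  · obtain ⟨e, he, rfl⟩ := unit_of_finrank_one h
    exact ⟨e, he, hW⟩
  · obtain ⟨e, he, h'⟩ := unit_of_finrank_one h
    exact ⟨e, he, h' ▸ hW'⟩

/-- block-diagonality with respect to a unit vector -/
def Bk (e : V) (X : V →ₗ[ℂ] V) : Prop := ∀ u, inner ℂ e u = (0:ℂ) → inner ℂ u (X e) = (0:ℂ) ∧ inner ℂ e (X u) = (0:ℂ)

theorem exists_onb_last {n : ℕ} (hn : Module.finrank ℂ V = n + 1) {e : V} (he : inner ℂ e e = (1:ℂ)) :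
    ∃ b : OrthonormalBasis (Fin (n+1)) ℂ V, b (Fin.last n) = e := by
  have ho : Orthonormal ℂ (({Fin.last n} : Set (Fin (n+1))).domRestrict (fun _ => e)) := by
    constructor
    · rintro ⟨i, hi⟩
      have h2 := inner_self_eq_norm_sq (𝕜 := ℂ) e
      rw [he, RCLike.one_re] at h2
      have : ‖e‖ = 1 := by nlinarith [norm_nonneg e]
      exact this
    · rintro ⟨i, hi⟩ ⟨j, hj⟩ hij
      exact absurd (Subtype.ext (hi.trans hj.symm)) hij
  obtain ⟨b, hb⟩ := ho.exists_orthonormalBasis_extension_of_card_eq (by simpa using hn)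
  exact ⟨b, hb _ rfl⟩

theorem Red (hg : IsG g) (hirr : ¬ Irr g) {n : ℕ} (hn1 : 1 ≤ n) (hn : Module.finrank ℂ V = n + 1) (hd : Module.finrank ℂ g = n^2) :
    ∃ e : V, inner ℂ e e = (1:ℂ) ∧ ((∀ X, X ∈ g ↔ Bk e X ∧ LinearMap.trace ℂ V X = inner ℂ e (X e)) ∨
      ∃ q : ℝ, ∀ X, X ∈ g ↔ Bk e X ∧ inner ℂ e (X e) = q * (LinearMap.trace ℂ V X - inner ℂ e (X e))) := by
  obtain ⟨e, he, hline⟩ := exists_line hg hirr (by rw [hn, hd]; simp)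
  have he0 : e ≠ 0 := by rintro rfl; simp at he
  refine ⟨e, he, ?_⟩
  set T : Submodule ℂ V := (Submodule.span ℂ {e})ᗮ with hT
  have memT : ∀ u, u ∈ T ↔ inner ℂ e u = (0:ℂ) := fun u => Submodule.mem_orthogonal_singleton_iff_inner_right
  have hfT : Module.finrank ℂ T = n := by
    have := Submodule.finrank_add_finrank_orthogonal (Submodule.span ℂ {e})
    rw [finrank_span_singleton he0, hn, ← hT] at this
    omega
  have hTb : T ≠ ⊥ := by intro h; rw [h] at hfT; simp at hfT; omega
  obtain ⟨b, hb⟩ := exists_onb_last hn he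
  have hbT : ∀ i : Fin n, b i.castSucc ∈ T := by
    intro i
    rw [memT, ← hb]
    exact b.orthonormal.2 (Fin.castSucc_lt_last i).ne'
  set B := Blk ![Submodule.span ℂ {e}, T] with hB
  have memB : ∀ X, X ∈ B ↔ Bk e X := by
    intro X
    constructor
    · intro hX u hu
      have h1 := hX 0 e (Submodule.mem_span_singleton_self e)
      obtain ⟨c, hc⟩ := Submodule.mem_span_singleton.1 h1
      have h2 := hX 1 u ((memT u).2 hu)
      refine ⟨?_, (memT _).1 h2⟩
      rw [← hc, inner_smul_right, inner_eq_zero_symm.1 hu, mul_zero]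
    · intro hX i w hw
      fin_cases i
      · obtain ⟨c, rfl⟩ := Submodule.mem_span_singleton.1 hw
        refine Submodule.mem_span_singleton.2 ⟨c * inner ℂ e (X e), ?_⟩
        rw [map_smul, mul_smul]
        congr 1
        have h3 := (hX (X e - inner ℂ e (X e) • e) (by rw [inner_sub_right, inner_smul_right, he]; ring)).1
        have h4 : inner ℂ (X e - inner ℂ e (X e) • e) (X e - inner ℂ e (X e) • e) = (0:ℂ) := by
          rw [inner_sub_right, h3, inner_smul_right, inner_sub_left, inner_smul_left, he, mul_one, inner_conj_symm, sub_self, mul_zero, sub_zero]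
        exact (sub_eq_zero.1 (inner_self_eq_zero.1 h4)).symm
      · exact (memT _).2 ((hX w ((memT _).1 hw)).2)
  have hgB : g ≤ B := by
    intro X hX i
    fin_cases i
    · exact hline X hX
    · exact perp_inv hg hline X hX
  have hfB : Module.finrank ℂ B ≤ n^2 + 1 := by
    have := finrank_Blk ![Submodule.span ℂ {e}, T] (by
      rw [eq_top_iff, ← Submodule.sup_orthogonal_of_hasOrthogonalProjection (K := Submodule.span ℂ {e})]
      exact sup_le (le_iSup ![Submodule.span ℂ {e}, T] 0) (le_iSup ![Submodule.span ℂ {e}, T] 1))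
    rw [Fin.sum_univ_two] at this
    change _ ≤ Module.finrank ℂ (Submodule.span ℂ {e}) ^ 2 + Module.finrank ℂ T ^ 2 at this
    rw [hfT, finrank_span_singleton he0] at this
    rw [hB]; omega
  have hfB' : n^2 + 1 ≤ Module.finrank ℂ B := by
    let Φ : (V →ₗ[ℂ] V) →ₗ[ℂ] ((Fin n → ℂ) × (Fin n → ℂ)) :=
      { toFun := fun X => (fun i => inner ℂ (b i.castSucc) (X e), fun i => inner ℂ e (X (b i.castSucc)))
        map_add' := by intro X Y; ext i <;> simp [inner_add_right]
        map_smul' := by intro c X; ext i <;> simp [inner_smul_right] }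
    have h1 := finrank_map_inf_ker ⊤ Φ
    have h2 := Submodule.finrank_le ((⊤ : Submodule ℂ (V →ₗ[ℂ] V)).map Φ)
    have h3 : (⊤ ⊓ LinearMap.ker Φ : Submodule ℂ (V →ₗ[ℂ] V)) ≤ B := by
      rintro X ⟨-, hX⟩
      rw [memB]
      have h4 : Φ X = 0 := hX
      have h5 : ∀ i : Fin n, inner ℂ (b i.castSucc) (X e) = (0:ℂ) := fun i => congrFun (congrArg Prod.fst h4) i
      have h6 : ∀ i : Fin n, inner ℂ e (X (b i.castSucc)) = (0:ℂ) := fun i => congrFun (congrArg Prod.snd h4) i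
      intro u hu
      have h7 : u = ∑ i : Fin n, inner ℂ (b i.castSucc) u • b i.castSucc := by
        conv_lhs => rw [← b.sum_repr' u]
        rw [Fin.sum_univ_castSucc, hb, hu, zero_smul, add_zero]
      constructor
      · rw [h7, sum_inner]
        refine Finset.sum_eq_zero fun i _ => ?_
        rw [inner_smul_left, h5, mul_zero]
      · rw [h7, map_sum, inner_sum]
        refine Finset.sum_eq_zero fun i _ => ?_
        rw [map_smul, inner_smul_right, h6, mul_zero]
    have h8 := Submodule.finrank_mono h3
    rw [finrank_top, Module.finrank_linearMap, hn] at h1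
    rw [Module.finrank_prod, Module.finrank_fintype_fun_eq_card, Fintype.card_fin] at h2
    nlinarith
  obtain ⟨f, hf⟩ := codim_one hgB (by omega)
  obtain ⟨x, hxT, hx, hfx⟩ := lemmaF f T hTb
  have hex := (memT x).1 hxT
  have hroB : ∀ y ∈ T, ∀ z ∈ T, ro y z ∈ B := by
    intro y hy z hz
    rw [memB]
    intro u hu
    rw [memT] at hy hz
    simp only [ro_apply, inner_smul_right, hy, inner_eq_zero_symm.1 hz]
    simp
  have heB : ro e e ∈ B := by
    rw [memB]
    intro u hu
    simp only [ro_apply, inner_smul_right, hu, inner_eq_zero_symm.1 hu]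
    simp
  have hsl : ∀ {y z}, y ∈ T → z ∈ T → ro y z - inner ℂ z y • ro x x ∈ g := by
    intro y z hy hz
    refine hg.SLT T hxT hx ?_ hy hz
    intro u hu hxu
    exact hg.ro_symm (hf _ (hroB x hxT u hu) (hfx u hu hxu))
  -- reduction modulo sl(T)
  have hred : ∀ X ∈ B, X - (inner ℂ e (X e) • ro e e + (LinearMap.trace ℂ V X - inner ℂ e (X e)) • ro x x) ∈ g := by
    intro X hX
    have h1 : X = ∑ i, ro (X (b i)) (b i) := by
      ext w
      conv_lhs => rw [← b.sum_repr' w]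
      simp [LinearMap.sum_apply, ro_apply]
    have h2 : LinearMap.trace ℂ V X = ∑ i, inner ℂ (b i) (X (b i)) := LinearMap.trace_eq_sum_inner X b
    have h3 : X e = inner ℂ e (X e) • e := by
      obtain ⟨c, hc⟩ := Submodule.mem_span_singleton.1 (hX 0 e (Submodule.mem_span_singleton_self e))
      rw [← hc, inner_smul_right, he, mul_one]
    have h3' : ro (X e) e = inner ℂ e (X e) • ro e e := by
      conv_lhs => rw [h3]
      rw [ro_smul_left]
    rw [Fin.sum_univ_castSucc, hb] at h1 h2
    have h4 : X - (inner ℂ e (X e) • ro e e + (LinearMap.trace ℂ V X - inner ℂ e (X e)) • ro x x)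
      = ∑ i : Fin n, (ro (X (b i.castSucc)) (b i.castSucc) - inner ℂ (b i.castSucc) (X (b i.castSucc)) • ro x x) := by
      rw [h2, Finset.sum_sub_distrib, ← Finset.sum_smul, add_sub_cancel_right]
      nth_rewrite 1 [h1]
      rw [h3']; abel
    rw [h4]
    exact g.sum_mem fun i _ => hsl (hX 1 _ (hbT i)) (hbT i)
  have hiff : ∀ X, X ∈ g ↔ Bk e X ∧ inner ℂ e (X e) • ro e e + (LinearMap.trace ℂ V X - inner ℂ e (X e)) • ro x x ∈ g := by
    intro X
    constructor
    · intro h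
      refine ⟨(memB X).1 (hgB h), ?_⟩
      have := g.sub_mem h (hred X (hgB h))
      rwa [sub_sub_cancel] at this
    · rintro ⟨h1, h2⟩
      have := g.add_mem (hred X ((memB X).2 h1)) h2
      rwa [sub_add_cancel] at this
  have hnot : ¬ (ro e e ∈ g ∧ ro x x ∈ g) := by
    rintro ⟨h1, h2⟩
    have : B ≤ g := by
      intro X hX
      rw [hiff]
      exact ⟨(memB X).1 hX, g.add_mem (g.smul_mem _ h1) (g.smul_mem _ h2)⟩
    have := Submodule.finrank_mono this
    omega
  have hmem : f (ro x x) • ro e e - f (ro e e) • ro x x ∈ g := by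
    apply hf _ (B.sub_mem (B.smul_mem _ heB) (B.smul_mem _ (hroB x hxT x hxT)))
    rw [map_sub, map_smul, map_smul, smul_eq_mul, smul_eq_mul]; ring
  have hinv : ∀ {Z : V →ₗ[ℂ] V} {c : ℂ}, c ≠ 0 → c • Z ∈ g → Z ∈ g := by
    intro Z c hc h
    have := g.smul_mem c⁻¹ h
    rwa [smul_smul, inv_mul_cancel₀ hc, one_smul] at this
  by_cases hxx : ro x x ∈ g
  · -- last coordinate vanishes
    right
    refine ⟨0, fun X => ?_⟩
    rw [hiff]
    refine and_congr_right fun h => ?_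
    rw [g.add_mem_iff_left (g.smul_mem _ hxx)]
    simp only [Complex.ofReal_zero, zero_mul]
    constructor
    · intro h1
      by_contra h2
      exact hnot ⟨hinv h2 h1, hxx⟩
    · intro h1
      rw [h1]; simp
  · by_cases hee : ro e e ∈ g
    · left
      intro X
      rw [hiff]
      refine and_congr_right fun h => ?_
      rw [g.add_mem_iff_right (g.smul_mem _ hee)]
      constructor
      · intro h1
        by_contra h2
        exact hnot ⟨hee, hinv (sub_ne_zero.2 h2) h1⟩
      · intro h1
        rw [h1]; simp
    · right
      have hfx0 : f (ro x x) ≠ 0 := fun h => hxx (hf _ (hroB x hxT x hxT) h)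
      have hfe0 : f (ro e e) ≠ 0 := fun h => hee (hf _ heB h)
      -- ro e e - r • ro x x ∈ g
      obtain ⟨r, hr⟩ : ∃ r : ℂ, ro x x + r • ro e e ∈ g := by
        refine ⟨- (f (ro e e))⁻¹ * f (ro x x), hinv (c := - f (ro e e)) (neg_ne_zero.2 hfe0) ?_⟩
        convert hmem using 1
        rw [smul_add, smul_smul]
        have : -f (ro e e) * (-(f (ro e e))⁻¹ * f (ro x x)) = f (ro x x) := by field_simp
        rw [this]; module
      have hrr : (starRingEnd ℂ r) = r := by
        have h1 := hg.ad _ hr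
        rw [map_add, map_smulₛₗ, ro_adjoint, ro_adjoint] at h1
        have h2 := g.sub_mem h1 hr
        have h3 : (starRingEnd ℂ r - r) • ro e e ∈ g := by
          convert h2 using 1; module
        by_contra h4
        exact hee (hinv (sub_ne_zero.2 h4) h3)
      obtain ⟨q, rfl⟩ := Complex.conj_eq_iff_real.1 hrr
      refine ⟨q, fun X => ?_⟩
      rw [hiff]
      refine and_congr_right fun h => ?_
      set s := LinearMap.trace ℂ V X - inner ℂ e (X e)
      set u := (inner ℂ e (X e) : ℂ)
      have h5 : u • ro e e + s • ro x x = (u - q * s) • ro e e + s • (ro x x + (q:ℂ) • ro e e) := by module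
      rw [h5, g.add_mem_iff_left (g.smul_mem _ hr)]
      constructor
      · intro h1
        by_contra h2
        exact hee (hinv (sub_ne_zero.2 h2) h1)
      · intro h1
        rw [h1]; simp

end Red

end PartB7

section PartB8
section LThree
variable {V : Type*} [NormedAddCommGroup V] [InnerProductSpace ℂ V] [FiniteDimensional ℂ V]
  {g : Submodule ℂ (V →ₗ[ℂ] V)}
open LinearMap (adjoint)

theorem L3 (hg : IsG g) (h1 : 1 ∈ g) (hirr : Irr g) (hN : 2 ≤ Module.finrank ℂ V)
    (hd1 : (Module.finrank ℂ V - 1)^2 ≤ Module.finrank ℂ g)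
    (hd2 : Module.finrank ℂ g ≤ (Module.finrank ℂ V - 1)^2 + 1) :
    Module.finrank ℂ V = 3 ∧ ∃ v x r : V, inner ℂ v v = (1:ℂ) ∧ inner ℂ x x = (1:ℂ) ∧ inner ℂ r r = (1:ℂ) ∧
      inner ℂ v x = (0:ℂ) ∧ inner ℂ v r = (0:ℂ) ∧ inner ℂ x r = (0:ℂ) ∧ (∀ X ∈ g, inner ℂ r (X v) = (0:ℂ)) ∧
      ∃ E ∈ g, E v = x := by
  have htr : ¬ Trs g := by
    intro h
    obtain ⟨x, y, hx, hy, hxy, hro⟩ := L2 hg hN h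
    exact L1 hg h1 hirr hd1 hd2 hx hy hxy hro
  rw [Trs] at htr
  push Not at htr
  obtain ⟨v0, hv0, w, hw⟩ := htr
  obtain ⟨v, hv, hvw⟩ : ∃ v : V, inner ℂ v v = (1:ℂ) ∧ ∀ X ∈ g, X v ≠ (‖v0‖⁻¹ : ℂ) • w := by
    refine ⟨(‖v0‖⁻¹ : ℂ) • v0, unit_of_ne hv0, fun X hX h => hw X hX ?_⟩
    rw [map_smul] at h
    exact smul_right_injective V (by simpa using hv0) h
  have hv00 : v ≠ 0 := by rintro rfl; simp at hv
  set G : Submodule ℂ V := g.map (LinearMap.applyₗ v) with hG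
  have memG : ∀ u, u ∈ G ↔ ∃ X ∈ g, X v = u := fun u => by rw [hG, Submodule.mem_map]; rfl
  have hGt : G ≠ ⊤ := by
    intro h
    obtain ⟨X, hX, h2⟩ := (memG ((‖v0‖⁻¹ : ℂ) • w)).1 (h ▸ Submodule.mem_top)
    exact hvw X hX h2
  have hvG : v ∈ G := (memG v).2 ⟨1, h1, rfl⟩
  have hvG' : Submodule.span ℂ {v} ≤ G := by rwa [Submodule.span_singleton_le_iff_mem]
  set T : Submodule ℂ V := (Submodule.span ℂ {v})ᗮ ⊓ G with hT
  set R : Submodule ℂ V := Gᗮ with hR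
  have memT : ∀ u, u ∈ T ↔ inner ℂ v u = (0:ℂ) ∧ u ∈ G := fun u => by
    rw [hT, Submodule.mem_inf, Submodule.mem_orthogonal_singleton_iff_inner_right]
  have hfG := Submodule.finrank_add_finrank_orthogonal G
  have hfT := Submodule.finrank_add_inf_finrank_orthogonal hvG'
  rw [finrank_span_singleton hv00] at hfT
  rw [← hT] at hfT
  rw [← hR] at hfG
  have hsup1 : Submodule.span ℂ {v} ⊔ T = G := Submodule.sup_orthogonal_inf_of_hasOrthogonalProjection hvG'
  have hsup2 : G ⊔ R = ⊤ := Submodule.sup_orthogonal_of_hasOrthogonalProjection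
  have hTb : T ≠ ⊥ := by
    intro h
    rw [h, sup_bot_eq] at hsup1
    rcases hirr (Submodule.span ℂ {v}) (by
      intro X hX u hu
      obtain ⟨c, rfl⟩ := Submodule.mem_span_singleton.1 hu
      rw [map_smul, hsup1]
      exact G.smul_mem _ ((memG _).2 ⟨X, hX, rfl⟩)) with h2 | h2
    · exact hv00 (Submodule.span_singleton_eq_bot.1 h2)
    · exact hGt (hsup1 ▸ h2)
  have hk : 0 < Module.finrank ℂ T := Nat.pos_of_ne_zero fun h => hTb (Submodule.finrank_eq_zero.1 h)
  have hj : 0 < Module.finrank ℂ R := Nat.pos_of_ne_zero fun h => hGt (by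
    exact (Submodule.orthogonal_eq_bot_iff).1 (Submodule.finrank_eq_zero.1 h))
  let t := stdOrthonormalBasis ℂ T
  let Φ : (V →ₗ[ℂ] V) →ₗ[ℂ] ((Fin (Module.finrank ℂ T) → ℂ) × (Fin (Module.finrank ℂ T) → ℂ)) :=
      { toFun := fun X => (fun i => inner ℂ (t i : V) (X v), fun i => inner ℂ v (X (t i)))
        map_add' := by intro X Y; ext i <;> simp [inner_add_right]
        map_smul' := by intro c X; ext i <;> simp [inner_smul_right] }
  have hrk := finrank_map_inf_ker g Φ
  have hrk2 := Submodule.finrank_le (g.map Φ)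
  rw [Module.finrank_prod, Module.finrank_fintype_fun_eq_card, Fintype.card_fin] at hrk2
  set B := Blk ![Submodule.span ℂ {v}, T, R] with hB
  have hfB : Module.finrank ℂ B ≤ 1 + Module.finrank ℂ T ^ 2 + Module.finrank ℂ R ^ 2 := by
    have := finrank_Blk ![Submodule.span ℂ {v}, T, R] (by
      rw [eq_top_iff, ← hsup2, ← hsup1]
      exact sup_le (sup_le (le_iSup ![Submodule.span ℂ {v}, T, R] 0) (le_iSup ![Submodule.span ℂ {v}, T, R] 1)) (le_iSup ![Submodule.span ℂ {v}, T, R] 2))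
    rw [Fin.sum_univ_three] at this
    change _ ≤ Module.finrank ℂ (Submodule.span ℂ {v}) ^ 2 + Module.finrank ℂ T ^ 2 + Module.finrank ℂ R ^ 2 at this
    rw [finrank_span_singleton hv00] at this
    rw [hB]; omega
  -- elements of l
  have hlT : ∀ X, Φ X = 0 → (∀ u ∈ T, inner ℂ u (X v) = (0:ℂ)) ∧ (∀ u ∈ T, inner ℂ v (X u) = (0:ℂ)) := by
    intro X h4
    have h5 : ∀ i, inner ℂ (t i : V) (X v) = (0:ℂ) := fun i => congrFun (congrArg Prod.fst h4) i
    have h6 : ∀ i, inner ℂ v (X (t i)) = (0:ℂ) := fun i => congrFun (congrArg Prod.snd h4) i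
    have h7 : ∀ u ∈ T, ∃ c : Fin (Module.finrank ℂ T) → ℂ, u = ∑ i, c i • (t i : V) := by
      intro u hu
      refine ⟨fun i => inner ℂ (t i) (⟨u, hu⟩ : T), ?_⟩
      have := congrArg Subtype.val (t.sum_repr' (⟨u, hu⟩ : T))
      simpa using this.symm
    constructor
    · intro u hu
      obtain ⟨c, rfl⟩ := h7 u hu
      rw [sum_inner]
      refine Finset.sum_eq_zero fun i _ => ?_
      rw [inner_smul_left, h5, mul_zero]
    · intro u hu
      obtain ⟨c, rfl⟩ := h7 u hu
      rw [map_sum, inner_sum]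
      refine Finset.sum_eq_zero fun i _ => ?_
      rw [map_smul, inner_smul_right, h6, mul_zero]
  have hspan : ∀ u ∈ G, (∀ y ∈ T, inner ℂ y u = (0:ℂ)) → u ∈ Submodule.span ℂ {v} := by
    intro u hu h
    have h2 : u - inner ℂ v u • v ∈ T := by
      rw [memT]
      refine ⟨by rw [inner_sub_right, inner_smul_right, hv]; ring, G.sub_mem hu (G.smul_mem _ hvG)⟩
    have h3 := h _ h2
    have h4 : inner ℂ (u - inner ℂ v u • v) (u - inner ℂ v u • v) = (0:ℂ) := by
      rw [inner_sub_right, h3, inner_smul_right, inner_eq_zero_symm.1 ((memT _).1 h2).1]; ring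
    exact Submodule.mem_span_singleton.2 ⟨_, (sub_eq_zero.1 (inner_self_eq_zero.1 h4)).symm⟩
  have hXG : ∀ X ∈ g, X v ∈ Submodule.span ℂ {v} → ∀ u ∈ G, X u ∈ G := by
    intro X hX hXv u hu
    obtain ⟨Y, hY, rfl⟩ := (memG u).1 hu
    obtain ⟨c, hc⟩ := Submodule.mem_span_singleton.1 hXv
    have h2 : X (Y v) = (X * Y - Y * X) v + c • Y v := by
      rw [LinearMap.sub_apply, Module.End.mul_apply, Module.End.mul_apply, ← hc, map_smul]; abel
    rw [h2]
    exact G.add_mem ((memG _).2 ⟨_, hg.br _ hX _ hY, rfl⟩) (G.smul_mem _ ((memG _).2 ⟨_, hY, rfl⟩))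
  have hlB : g ⊓ LinearMap.ker Φ ≤ B := by
    rintro X ⟨hX, hXk⟩
    obtain ⟨ha, hb⟩ := hlT X hXk
    have hX' := hg.ad _ hX
    have e1 : X v ∈ Submodule.span ℂ {v} := hspan _ ((memG _).2 ⟨X, hX, rfl⟩) ha
    have e2 : adjoint X v ∈ Submodule.span ℂ {v} := by
      refine hspan _ ((memG _).2 ⟨_, hX', rfl⟩) fun u hu => ?_
      rw [LinearMap.adjoint_inner_right]
      exact inner_eq_zero_symm.1 (hb u hu)
    have e3 := hXG X hX e1
    have e4 := hXG _ hX' e2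
    intro i
    fin_cases i
    · intro u hu
      change u ∈ Submodule.span ℂ {v} at hu
      change X u ∈ Submodule.span ℂ {v}
      obtain ⟨c, rfl⟩ := Submodule.mem_span_singleton.1 hu
      rw [map_smul]
      exact Submodule.smul_mem _ _ e1
    · intro u hu
      exact (memT _).2 ⟨hb u hu, e3 _ ((memT u).1 hu).2⟩
    · intro u hu
      change u ∈ Gᗮ at hu
      change X u ∈ Gᗮ
      rw [Submodule.mem_orthogonal] at hu ⊢
      intro y hy
      rw [← LinearMap.adjoint_inner_left]
      exact hu _ (e4 y hy)
  have hm := Submodule.finrank_mono hlB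
  have hNkj : Module.finrank ℂ V - 1 = Module.finrank ℂ T + Module.finrank ℂ R := by omega
  have hj1 : Module.finrank ℂ R = 1 := by
    rw [hNkj] at hd1
    by_contra h
    obtain ⟨j, hj'⟩ : ∃ j, Module.finrank ℂ R = j + 2 := ⟨Module.finrank ℂ R - 2, by omega⟩
    rw [hj'] at hd1 hfB
    nlinarith
  have hcod : Module.finrank ℂ B ≤ Module.finrank ℂ (g ⊓ LinearMap.ker Φ : Submodule ℂ (V →ₗ[ℂ] V)) + 1 := by
    rw [hNkj, hj1] at hd1
    rw [hj1] at hfB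
    nlinarith
  obtain ⟨f, hf⟩ := codim_one hlB hcod
  obtain ⟨x, hxT, hx, hfx⟩ := lemmaF f T hTb
  have hx0 : x ≠ 0 := by rintro rfl; simp at hx
  have hroB : ∀ y ∈ T, ∀ z ∈ T, ro y z ∈ B := by
    intro y hy z hz i
    fin_cases i
    · intro u hu
      obtain ⟨c, rfl⟩ := Submodule.mem_span_singleton.1 hu
      change _ ∈ Submodule.span ℂ {v}
      rw [ro_apply, inner_smul_right, inner_eq_zero_symm.1 ((memT z).1 hz).1]
      simp
    · intro u hu
      rw [ro_apply]
      exact T.smul_mem _ hy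
    · intro u hu
      change u ∈ Gᗮ at hu
      change _ ∈ Gᗮ
      rw [ro_apply, (Submodule.mem_orthogonal _ _).1 hu z ((memT z).1 hz).2]
      simp
  have hTx : T ≤ Submodule.span ℂ {x} := by
    intro y hy
    by_contra hny
    have h2 : y - inner ℂ x y • x ≠ 0 := by
      intro h
      exact hny (Submodule.mem_span_singleton.2 ⟨_, (sub_eq_zero.1 h).symm⟩)
    have h3 : inner ℂ x (y - inner ℂ x y • x) = (0:ℂ) := by
      rw [inner_sub_right, inner_smul_right, hx]; ring
    have h4 : y - inner ℂ x y • x ∈ T := T.sub_mem hy (T.smul_mem _ hxT)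
    exact L1 hg h1 hirr hd1 hd2 hx0 h2 h3 (hf _ (hroB x hxT _ h4) (hfx _ h4 h3)).1
  have hk1 : Module.finrank ℂ T = 1 := by
    have := Submodule.finrank_mono hTx
    rw [finrank_span_singleton hx0] at this
    omega
  obtain ⟨r, hr, hRr⟩ := unit_of_finrank_one hj1
  have hrR : r ∈ R := hRr ▸ Submodule.mem_span_singleton_self r
  have hrG : ∀ u ∈ G, inner ℂ u r = (0:ℂ) := fun u hu => (Submodule.mem_orthogonal _ _).1 hrR u hu
  refine ⟨by omega, v, x, r, hv, hx, hr, ((memT x).1 hxT).1, hrG v hvG, hrG x ((memT x).1 hxT).2, ?_, ?_⟩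
  · intro X hX
    exact inner_eq_zero_symm.1 (hrG _ ((memG _).2 ⟨X, hX, rfl⟩))
  · exact (memG x).1 ((memT x).1 hxT).2
end LThree

end PartB8

section PartC1
section LFour
open Matrix

theorem L4m (g : Submodule ℂ (Matrix (Fin 3) (Fin 3) ℂ)) (br : ∀ X ∈ g, ∀ Y ∈ g, X * Y - Y * X ∈ g)
    (ct : ∀ X ∈ g, Xᴴ ∈ g) (h20 : ∀ X ∈ g, X 2 0 = 0) {E0 : Matrix (Fin 3) (Fin 3) ℂ} (hE0 : E0 ∈ g) (hE10 : E0 1 0 = 1)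
    (hirr : ∃ X ∈ g, X 1 2 ≠ 0) (hd : 4 ≤ Module.finrank ℂ g) :
    ∃ c : ℂ, c * starRingEnd ℂ c = 1 ∧ ∀ X ∈ g, X 2 0 = 0 ∧ X 0 2 = 0 ∧ X 2 1 = c * X 1 0 ∧ X 1 2 = starRingEnd ℂ c * X 0 1 ∧
      X 2 2 - 2 * X 1 1 + X 0 0 = 0 := by
  have hct : ∀ X : Matrix (Fin 3) (Fin 3) ℂ, ∀ i j, Xᴴ i j = starRingEnd ℂ (X j i) := fun X i j => rfl
  have hbr : ∀ X Y : Matrix (Fin 3) (Fin 3) ℂ, ∀ i j, (X * Y - Y * X) i j =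
    X i 0 * Y 0 j + X i 1 * Y 1 j + X i 2 * Y 2 j - (Y i 0 * X 0 j + Y i 1 * X 1 j + Y i 2 * X 2 j) := by
    intro X Y i j
    rw [Matrix.sub_apply, Matrix.mul_apply, Matrix.mul_apply, Fin.sum_univ_three, Fin.sum_univ_three]
  have h02 : ∀ X ∈ g, X 0 2 = 0 := by
    intro X hX
    have := h20 _ (ct X hX)
    rw [hct] at this
    simpa using this
  obtain ⟨c, hc⟩ : ∃ c, c = E0 2 1 := ⟨_, rfl⟩
  have h21 : ∀ X ∈ g, X 2 1 = c * X 1 0 := by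
    intro X hX
    have := h20 _ (br X hX E0 hE0)
    rw [hbr, h20 X hX, h20 E0 hE0, hE10, ← hc] at this
    linear_combination this
  have h12 : ∀ X ∈ g, X 1 2 = starRingEnd ℂ c * X 0 1 := by
    intro X hX
    have := h21 _ (ct X hX)
    rw [hct, hct] at this
    have := congrArg (starRingEnd ℂ) this
    simpa using this
  have hc0 : c ≠ 0 := by
    rintro h
    obtain ⟨X, hX, hX2⟩ := hirr
    rw [h12 X hX, h] at hX2
    simp at hX2
  have hm : ∀ X ∈ g, ∀ Y ∈ g, Y 1 0 * (X 2 2 - 2 * X 1 1 + X 0 0) = X 1 0 * (Y 2 2 - 2 * Y 1 1 + Y 0 0) := by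
    intro X hX Y hY
    have := h21 _ (br X hX Y hY)
    rw [hbr, hbr, h20 X hX, h20 Y hY, h21 X hX, h21 Y hY] at this
    apply mul_left_cancel₀ hc0
    linear_combination this
  have hm1 : ∀ X ∈ g, X 2 2 - 2 * X 1 1 + X 0 0 = X 1 0 * (E0 2 2 - 2 * E0 1 1 + E0 0 0) := by
    intro X hX
    have := hm X hX E0 hE0
    rwa [hE10, one_mul] at this
  -- injectivity
  let ψ : g →ₗ[ℂ] (Fin 4 → ℂ) :=
    { toFun := fun X => ![X.1 1 0, X.1 0 1, X.1 0 0, X.1 1 1]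
      map_add' := by intro X Y; ext i; fin_cases i <;> simp
      map_smul' := by intro a X; ext i; fin_cases i <;> simp }
  have hψ : Function.Injective ψ := by
    rw [← LinearMap.ker_eq_bot, LinearMap.ker_eq_bot']
    rintro ⟨X, hX⟩ h
    have e0 : X 1 0 = 0 := congrFun h 0
    have e1 : X 0 1 = 0 := congrFun h 1
    have e2 : X 0 0 = 0 := congrFun h 2
    have e3 : X 1 1 = 0 := congrFun h 3
    have e4 := h20 X hX
    have e5 := h02 X hX
    have e6 := h21 X hX
    have e7 := h12 X hX
    have e8 := hm1 X hX
    rw [e0, mul_zero] at e6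
    rw [e1, mul_zero] at e7
    rw [e0, e2, e3] at e8
    have e9 : X 2 2 = 0 := by linear_combination e8
    apply Subtype.ext
    ext i j
    fin_cases i <;> fin_cases j <;> simpa
  have hsurj : Function.Surjective ψ := by
    have h1 := LinearMap.finrank_range_of_inj hψ
    rw [← LinearMap.range_eq_top]
    apply Submodule.eq_top_of_finrank_eq
    have := Submodule.finrank_le (LinearMap.range ψ)
    simp only [Module.finrank_fintype_fun_eq_card, Fintype.card_fin] at this ⊢
    omega
  obtain ⟨⟨E, hE⟩, hEψ⟩ := hsurj ![1, 0, 0, 0]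
  have e0 : E 1 0 = 1 := congrFun hEψ 0
  have e1 : E 0 1 = 0 := congrFun hEψ 1
  have e2 : E 0 0 = 0 := congrFun hEψ 2
  have e3 : E 1 1 = 0 := congrFun hEψ 3
  have hmm : ∀ X ∈ g, X 2 2 - 2 * X 1 1 + X 0 0 = X 1 0 * (E 2 2 - 2 * E 1 1 + E 0 0) := by
    intro X hX
    have := hm X hX E hE
    rwa [e0, one_mul] at this
  have hμ : E 2 2 = 0 := by
    have := hmm _ (ct E hE)
    simp only [hct, e0, e1, e2, e3] at this
    simpa using this
  have hm0 : ∀ X ∈ g, X 2 2 - 2 * X 1 1 + X 0 0 = 0 := by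
    intro X hX
    rw [hmm X hX, e2, e3, hμ]; ring
  refine ⟨c, ?_, fun X hX => ⟨h20 X hX, h02 X hX, h21 X hX, h12 X hX, hm0 X hX⟩⟩
  have := hm0 _ (br E hE _ (ct E hE))
  simp only [hbr, hct, e0, e1, e2, e3, hμ, h20 E hE, h02 E hE, h21 E hE, h12 E hE] at this
  simp at this
  linear_combination this / 3

theorem L4P {c : ℂ} (hc : c * starRingEnd ℂ c = 1) : ∃ P ∈ Matrix.unitaryGroup (Fin 3) ℂ,
    ∀ X : Matrix (Fin 3) (Fin 3) ℂ, X 2 0 = 0 ∧ X 0 2 = 0 ∧ X 2 1 = c * X 1 0 ∧ X 1 2 = starRingEnd ℂ c * X 0 1 ∧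
      X 2 2 - 2 * X 1 1 + X 0 0 = 0 → ∃ a : ℂ, P * X * Pᴴ + (P * X * Pᴴ)ᵀ = a • 1 := by
  obtain ⟨s, hs, hss⟩ : ∃ s : ℂ, starRingEnd ℂ s = s ∧ s * s = 1 / 2 := by
    refine ⟨((Real.sqrt (1/2) : ℝ) : ℂ), Complex.conj_ofReal _, ?_⟩
    rw [← Complex.ofReal_mul, Real.mul_self_sqrt (by norm_num)]; norm_num
  have hI := Complex.I_mul_I
  let P : Matrix (Fin 3) (Fin 3) ℂ := !![s, 0, - starRingEnd ℂ c * s; Complex.I * s, 0, Complex.I * starRingEnd ℂ c * s; 0, 1, 0]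
  have hPct : Pᴴ = !![s, - Complex.I * s, 0; 0, 0, 1; - c * s, - Complex.I * c * s, 0] := by
    ext i j
    fin_cases i <;> fin_cases j <;> simp [P, Matrix.conjTranspose_apply, hs]
  refine ⟨P, ?_, ?_⟩
  · rw [Matrix.mem_unitaryGroup_iff, Matrix.star_eq_conjTranspose, hPct]
    ext i j
    fin_cases i <;> fin_cases j <;> simp [P, Matrix.mul_apply, Fin.sum_univ_three]
    · linear_combination (1 + c * starRingEnd ℂ c) * hss + (1/2) * hc
    · linear_combination (-s*s*Complex.I) * hc.symm
    · linear_combination (-s*s*Complex.I) * hc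
    · linear_combination (-s*s*(1 + c * starRingEnd ℂ c)) * hI + (1 + c * starRingEnd ℂ c) * hss + (1/2) * hc
  · rintro X ⟨h1, h2, h3, h4, h5⟩
    refine ⟨2 * X 1 1, ?_⟩
    have h6 : X 2 2 = 2 * X 1 1 - X 0 0 := by linear_combination h5
    rw [hPct]
    ext i j
    rw [Matrix.add_apply, Matrix.transpose_apply]
    simp only [Matrix.mul_apply, Fin.sum_univ_three, h1, h2, h3, h4, h6]
    fin_cases i <;> fin_cases j <;> simp [P]
    · linear_combination (2 * s * s * (2 * X 1 1 - X 0 0)) * hc + (4 * X 1 1) * hss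
    · ring
    · linear_combination (-s * (X 0 1 + X 1 0)) * hc
    · ring
    · linear_combination (-2 * s * s * X 0 0 - 2 * s * s * (2 * X 1 1 - X 0 0) * (c * starRingEnd ℂ c)) * hI + (2 * s * s * (2 * X 1 1 - X 0 0)) * hc + (4 * X 1 1) * hss
    · linear_combination (Complex.I * s * (X 1 0 - X 0 1)) * hc
    · linear_combination (-s * (X 0 1 + X 1 0)) * hc
    · linear_combination (Complex.I * s * (X 1 0 - X 0 1)) * hc
    · ring
end LFour

end PartC1

section PartC2
section Cplx
open Matrix

theorem exists_U_of_onb {N : ℕ} (b : OrthonormalBasis (Fin N) ℂ (EuclideanSpace ℂ (Fin N))) :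
    ∃ U ∈ Matrix.unitaryGroup (Fin N) ℂ, ∀ M : Matrix (Fin N) (Fin N) ℂ, ∀ i j,
      (U * M * Uᴴ) i j = inner ℂ (b i) (Matrix.toEuclideanLin M (b j)) := by
  let U : Matrix (Fin N) (Fin N) ℂ := Matrix.of fun i j => starRingEnd ℂ (b i j)
  have hU : ∀ M : Matrix (Fin N) (Fin N) ℂ, ∀ i j,
      (U * M * Uᴴ) i j = inner ℂ (b i) (Matrix.toEuclideanLin M (b j)) := by
    intro M i j
    rw [Matrix.mul_assoc, Matrix.mul_apply, PiLp.inner_apply]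
    refine Finset.sum_congr rfl fun k _ => ?_
    rw [RCLike.inner_apply, mul_comm]
    congr 1
    rw [Matrix.mul_apply]
    simp [U, Matrix.toLpLin_apply, Matrix.mulVec, dotProduct]
  refine ⟨U, ?_, hU⟩
  rw [Matrix.mem_unitaryGroup_iff, Matrix.star_eq_conjTranspose]
  ext i j
  have := hU 1 i j
  rw [Matrix.mul_one] at this
  rw [this, Matrix.toLpLin_one, LinearMap.id_apply, Matrix.one_apply]
  exact orthonormal_iff_ite.1 b.orthonormal i j

/-- complexification -/
noncomputable def Cx {N : ℕ} (h : Submodule ℝ (Matrix (Fin N) (Fin N) ℂ)) : Submodule ℂ (Matrix (Fin N) (Fin N) ℂ) where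
  carrier := {Z | ∃ X ∈ h, ∃ Y ∈ h, Z = X + Complex.I • Y}
  add_mem' := by
    rintro _ _ ⟨X, hX, Y, hY, rfl⟩ ⟨X', hX', Y', hY', rfl⟩
    exact ⟨_, h.add_mem hX hX', _, h.add_mem hY hY', by module⟩
  zero_mem' := ⟨0, h.zero_mem, 0, h.zero_mem, by simp⟩
  smul_mem' := by
    rintro c _ ⟨X, hX, Y, hY, rfl⟩
    refine ⟨c.re • X - c.im • Y, h.sub_mem (h.smul_mem _ hX) (h.smul_mem _ hY), c.im • X + c.re • Y, h.add_mem (h.smul_mem _ hX) (h.smul_mem _ hY), ?_⟩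
    ext i j
    simp only [Matrix.smul_apply, Matrix.add_apply, Matrix.sub_apply, Complex.real_smul, smul_eq_mul]
    conv_lhs => rw [← Complex.re_add_im c]
    linear_combination ((c.im : ℂ) * Y i j) * Complex.I_mul_I

variable {N : ℕ} {h : Submodule ℝ (Matrix (Fin N) (Fin N) ℂ)}

theorem le_Cx {X : Matrix (Fin N) (Fin N) ℂ} (hX : X ∈ h) : X ∈ Cx h := ⟨X, hX, 0, h.zero_mem, by simp⟩

theorem Cx_skew (hs : ∀ X ∈ h, Xᴴ = -X) (X : Matrix (Fin N) (Fin N) ℂ) : X ∈ h ↔ Xᴴ = -X ∧ X ∈ Cx h := by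
  constructor
  · intro hX; exact ⟨hs X hX, le_Cx hX⟩
  · rintro ⟨h1, X, hX, Y, hY, rfl⟩
    have h2 : Y = 0 := by
      rw [Matrix.conjTranspose_add, Matrix.conjTranspose_smul, hs X hX, hs Y hY] at h1
      have h3 : (2 * Complex.I) • Y = 0 := by
        have h4 : star Complex.I = - Complex.I := by simp
        rw [h4] at h1
        have := congrArg (fun Z => Z + X + Complex.I • Y) h1
        calc (2 * Complex.I) • Y = -X + -Complex.I • -Y + X + Complex.I • Y := by module
          _ = _ := by rw [this]; module
      exact (smul_eq_zero.1 h3).resolve_left (by simp)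
    rw [h2]; simpa using hX

theorem Cx_br (hb : ∀ X ∈ h, ∀ Y ∈ h, X * Y - Y * X ∈ h) : ∀ X ∈ Cx h, ∀ Y ∈ Cx h, X * Y - Y * X ∈ Cx h := by
  rintro _ ⟨X, hX, Y, hY, rfl⟩ _ ⟨X', hX', Y', hY', rfl⟩
  refine ⟨_, h.sub_mem (hb X hX X' hX') (hb Y hY Y' hY'), _, h.add_mem (hb X hX Y' hY') (hb Y hY X' hX'), ?_⟩
  simp only [mul_add, add_mul, smul_mul_assoc, mul_smul_comm, smul_smul, Complex.I_mul_I]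
  match_scalars <;> simp

theorem Cx_ct (hs : ∀ X ∈ h, Xᴴ = -X) : ∀ X ∈ Cx h, Xᴴ ∈ Cx h := by
  rintro _ ⟨X, hX, Y, hY, rfl⟩
  refine ⟨-X, h.neg_mem hX, Y, hY, ?_⟩
  rw [Matrix.conjTranspose_add, Matrix.conjTranspose_smul, hs X hX, hs Y hY]
  have h4 : star Complex.I = - Complex.I := by simp
  rw [h4]; module

theorem Cx_finrank (hs : ∀ X ∈ h, Xᴴ = -X) : Module.finrank ℂ (Cx h) = Module.finrank ℝ h := by
  let Φ : (h × h) →ₗ[ℝ] Cx h :=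
    { toFun := fun p => ⟨p.1.1 + Complex.I • p.2.1, p.1.1, p.1.2, p.2.1, p.2.2, rfl⟩
      map_add' := by
        intro p q; apply Subtype.ext
        simp only [Prod.fst_add, Prod.snd_add, Submodule.coe_add]; module
      map_smul' := by
        intro r p; apply Subtype.ext
        simp only [Prod.smul_fst, Prod.smul_snd, Submodule.coe_smul, RingHom.id_apply]
        rw [smul_comm Complex.I r, ← smul_add]; rfl }
  have hΦ : Function.Bijective Φ := by
    constructor
    · rw [← LinearMap.ker_eq_bot, LinearMap.ker_eq_bot']
      rintro ⟨X, Y⟩ h0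
      have h1 : X.1 + Complex.I • Y.1 = 0 := congrArg Subtype.val h0
      have h2 : (-Complex.I • Y.1) ∈ h := by
        have : -Complex.I • Y.1 = X.1 := by rw [← sub_eq_zero, ← neg_eq_zero, ← h1]; module
        rw [this]; exact X.2
      have h3 := hs _ h2
      rw [Matrix.conjTranspose_smul, hs _ Y.2] at h3
      have h4 : star (-Complex.I) = Complex.I := by simp
      rw [h4] at h3
      have h5 : (2 * Complex.I) • Y.1 = 0 := by
        calc (2 * Complex.I) • Y.1 = -(Complex.I • -Y.1) + Complex.I • Y.1 := by module
          _ = 0 := by rw [h3]; module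
      have h6 : Y.1 = 0 := (smul_eq_zero.1 h5).resolve_left (by simp)
      rw [h6] at h1
      ext1
      · exact Subtype.ext (by simpa using h1)
      · exact Subtype.ext h6
    · rintro ⟨_, X, hX, Y, hY, rfl⟩
      exact ⟨(⟨X, hX⟩, ⟨Y, hY⟩), rfl⟩
  have h1 := (LinearEquiv.ofBijective Φ hΦ).finrank_eq
  rw [Module.finrank_prod, finrank_real_of_complex] at h1
  omega
end Cplx

end PartC2

section PartC3
section LieClass
open Matrix

def BDm {n : ℕ} (Y : Matrix (Fin (n+1)) (Fin (n+1)) ℂ) : Prop :=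
  ∀ i : Fin n, Y i.castSucc (Fin.last n) = 0 ∧ Y (Fin.last n) i.castSucc = 0

theorem exists_onb3 {V : Type*} [NormedAddCommGroup V] [InnerProductSpace ℂ V] [FiniteDimensional ℂ V]
    (hV : Module.finrank ℂ V = 3) {v x r : V} (hv : inner ℂ v v = (1:ℂ)) (hx : inner ℂ x x = (1:ℂ)) (hr : inner ℂ r r = (1:ℂ))
    (hvx : inner ℂ v x = (0:ℂ)) (hvr : inner ℂ v r = (0:ℂ)) (hxr : inner ℂ x r = (0:ℂ)) :
    ∃ b : OrthonormalBasis (Fin 3) ℂ V, b 0 = v ∧ b 1 = x ∧ b 2 = r := by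
  have ho : Orthonormal ℂ ![v, x, r] := by
    rw [orthonormal_iff_ite]
    intro i j
    fin_cases i <;> fin_cases j <;>
      simp [-inner_self_eq_norm_sq_to_K, hv, hx, hr, hvx, hvr, hxr, inner_eq_zero_symm.1 hvx, inner_eq_zero_symm.1 hvr, inner_eq_zero_symm.1 hxr]
  let b0 := basisOfOrthonormalOfCardEqFinrank ho (by simp [hV])
  have hb0 : ⇑b0 = ![v, x, r] := coe_basisOfOrthonormalOfCardEqFinrank ho _
  refine ⟨b0.toOrthonormalBasis (by rw [hb0]; exact ho), ?_, ?_, ?_⟩ <;> rw [Module.Basis.coe_toOrthonormalBasis, hb0] <;> rfl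

section
variable {N : ℕ} {h : Submodule ℝ (Matrix (Fin N) (Fin N) ℂ)}

theorem toE_mul (X Y : Matrix (Fin N) (Fin N) ℂ) : Matrix.toEuclideanLin (X * Y) = Matrix.toEuclideanLin X * Matrix.toEuclideanLin Y :=
  Matrix.toLpLin_mul_same _ _ _

theorem isG_map (hs : ∀ X ∈ h, Xᴴ = -X) (hb : ∀ X ∈ h, ∀ Y ∈ h, X * Y - Y * X ∈ h) :
    IsG ((Cx h).map (Matrix.toEuclideanLin : Matrix (Fin N) (Fin N) ℂ ≃ₗ[ℂ] _).toLinearMap) := by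
  constructor
  · rintro _ ⟨X, hX, rfl⟩ _ ⟨Y, hY, rfl⟩
    refine ⟨_, Cx_br hb X hX Y hY, ?_⟩
    simp only [LinearEquiv.coe_coe]
    rw [map_sub, toE_mul, toE_mul]
  · rintro _ ⟨X, hX, rfl⟩
    refine ⟨_, Cx_ct hs X hX, ?_⟩
    simp only [LinearEquiv.coe_coe]
    rw [Matrix.toEuclideanLin_conjTranspose_eq_adjoint]
end

theorem isG_sup_one {V : Type*} [NormedAddCommGroup V] [InnerProductSpace ℂ V] [FiniteDimensional ℂ V]
    {g : Submodule ℂ (V →ₗ[ℂ] V)} (hg : IsG g) : IsG (g ⊔ Submodule.span ℂ {1}) := by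
  have hm : ∀ X, X ∈ g ⊔ Submodule.span ℂ {1} → ∃ Y ∈ g, ∃ c : ℂ, X = Y + c • 1 := by
    intro X hX
    obtain ⟨Y, hY, Z, hZ, rfl⟩ := Submodule.mem_sup.1 hX
    obtain ⟨c, rfl⟩ := Submodule.mem_span_singleton.1 hZ
    exact ⟨Y, hY, c, rfl⟩
  constructor
  · intro X hX Y hY
    obtain ⟨X, hX1, c, rfl⟩ := hm X hX
    obtain ⟨Y, hY1, d, rfl⟩ := hm Y hY
    have : (X + c • 1) * (Y + d • 1) - (Y + d • 1) * (X + c • 1) = X * Y - Y * X := by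
      simp only [mul_add, add_mul, smul_mul_assoc, mul_smul_comm, one_mul, mul_one]
      module
    rw [this]
    exact Submodule.mem_sup_left (hg.br X hX1 Y hY1)
  · intro X hX
    obtain ⟨X, hX1, c, rfl⟩ := hm X hX
    rw [map_add, map_smulₛₗ]
    have : LinearMap.adjoint (1 : V →ₗ[ℂ] V) = 1 := LinearMap.adjoint_id
    rw [this]
    exact Submodule.add_mem_sup (hg.ad X hX1) (Submodule.smul_mem _ _ (Submodule.mem_span_singleton_self _))

theorem lie_irr {V : Type*} [NormedAddCommGroup V] [InnerProductSpace ℂ V] [FiniteDimensional ℂ V]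
    {g : Submodule ℂ (V →ₗ[ℂ] V)} (hg : IsG g) (h1 : 1 ∈ g) (hirr : Irr g) (hN : 2 ≤ Module.finrank ℂ V)
    (hd1 : (Module.finrank ℂ V - 1)^2 ≤ Module.finrank ℂ g)
    (hd2 : Module.finrank ℂ g ≤ (Module.finrank ℂ V - 1)^2 + 1) :
    Module.finrank ℂ V = 3 ∧ ∃ b : OrthonormalBasis (Fin 3) ℂ V, ∃ P ∈ Matrix.unitaryGroup (Fin 3) ℂ,
     ∀ X ∈ g, ∃ a : ℂ, P * (LinearMap.toMatrixOrthonormal b X) * Pᴴ + (P * (LinearMap.toMatrixOrthonormal b X) * Pᴴ)ᵀ = a • 1 := by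
  obtain ⟨hV, v, x, r, hv, hx, hr, hvx, hvr, hxr, h20, E, hE, hEv⟩ := L3 hg h1 hirr hN hd1 hd2
  refine ⟨hV, ?_⟩
  obtain ⟨b, hb0, hb1, hb2⟩ := exists_onb3 hV hv hx hr hvx hvr hxr
  refine ⟨b, ?_⟩
  let ψ : (V →ₗ[ℂ] V) ≃ₗ[ℂ] Matrix (Fin 3) (Fin 3) ℂ := (LinearMap.toMatrixOrthonormal b).toAlgEquiv.toLinearEquiv
  have hψ : ∀ X, ψ X = LinearMap.toMatrixOrthonormal b X := fun X => rfl
  have hψa : ∀ X i j, ψ X i j = inner ℂ (b i) (X (b j)) := fun X i j => LinearMap.toMatrixOrthonormal_apply_apply _ _ _ _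
  obtain ⟨c, hc, hcX⟩ := L4m (g.map ψ.toLinearMap) (by
      rintro _ ⟨X, hX, rfl⟩ _ ⟨Y, hY, rfl⟩
      refine ⟨_, hg.br X hX Y hY, ?_⟩
      simp only [LinearEquiv.coe_coe, hψ, map_sub, map_mul]) (by
      rintro _ ⟨X, hX, rfl⟩
      refine ⟨_, hg.ad X hX, ?_⟩
      simp only [LinearEquiv.coe_coe, hψ]
      rw [← LinearMap.star_eq_adjoint, map_star]; rfl) (by
      rintro _ ⟨X, hX, rfl⟩
      rw [LinearEquiv.coe_coe, hψa, hb2, hb0]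
      exact h20 X hX) (E0 := ψ E) ⟨E, hE, rfl⟩ (by
      rw [hψa, hb1, hb0, hEv, hx]) (by
      by_contra hcon
      push Not at hcon
      have hr0 : r ≠ 0 := by rintro rfl; simp at hr
      have h3 : ∀ X ∈ g, X r = inner ℂ r (X r) • r := by
        intro X hX
        have e1 := hcon _ ⟨X, hX, rfl⟩
        rw [LinearEquiv.coe_coe, hψa, hb1, hb2] at e1
        have e0 := h20 _ (hg.ad X hX)
        rw [LinearMap.adjoint_inner_right] at e0
        rw [inner_eq_zero_symm] at e0
        have := b.sum_repr' (X r)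
        rw [Fin.sum_univ_three, hb0, hb1, hb2, e0, e1] at this
        simpa using this.symm
      rcases hirr (Submodule.span ℂ {r}) (by
        intro X hX u hu
        obtain ⟨c, rfl⟩ := Submodule.mem_span_singleton.1 hu
        rw [map_smul, h3 X hX]
        exact Submodule.smul_mem _ _ (Submodule.smul_mem _ _ (Submodule.mem_span_singleton_self r))) with h4 | h4
      · exact hr0 (Submodule.span_singleton_eq_bot.1 h4)
      · have h5 := finrank_span_singleton (K := ℂ) hr0
        rw [h4, finrank_top, hV] at h5
        omega) (by
      rw [LinearEquiv.finrank_map_eq]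
      rw [hV] at hd1
      omega)
  obtain ⟨P, hP, hPX⟩ := L4P hc
  exact ⟨P, hP, fun X hX => hPX _ (hcX _ ⟨X, hX, rfl⟩)⟩

/-- the real forms that occur -/
theorem lie_class {n : ℕ} (hn : 1 ≤ n) (h : Submodule ℝ (Matrix (Fin (n+1)) (Fin (n+1)) ℂ))
    (hs : ∀ X ∈ h, Xᴴ = -X) (hb : ∀ X ∈ h, ∀ Y ∈ h, X * Y - Y * X ∈ h) (hd : Module.finrank ℝ h = n^2) :
    ∃ U ∈ Matrix.unitaryGroup (Fin (n+1)) ℂ,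
      (n = 2 ∧ ∀ X ∈ h, ∃ a : ℂ, (U * X * Uᴴ) + (U * X * Uᴴ)ᵀ = a • 1) ∨
      (∀ X, X ∈ h ↔ (U * X * Uᴴ)ᴴ = -(U * X * Uᴴ) ∧ BDm (U * X * Uᴴ) ∧ (U * X * Uᴴ).trace = (U * X * Uᴴ) (Fin.last n) (Fin.last n)) ∨
      (∃ q : ℝ, ∀ X, X ∈ h ↔ (U * X * Uᴴ)ᴴ = -(U * X * Uᴴ) ∧ BDm (U * X * Uᴴ) ∧
        (U * X * Uᴴ) (Fin.last n) (Fin.last n) = q * ((U * X * Uᴴ).trace - (U * X * Uᴴ) (Fin.last n) (Fin.last n))) := by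
  have hg0 := isG_map hs hb
  let φ : Matrix (Fin (n+1)) (Fin (n+1)) ℂ ≃ₗ[ℂ] (EuclideanSpace ℂ (Fin (n+1)) →ₗ[ℂ] EuclideanSpace ℂ (Fin (n+1))) := Matrix.toEuclideanLin
  obtain ⟨g0, hg0d⟩ : ∃ g0, g0 = (Cx h).map φ.toLinearMap := ⟨_, rfl⟩
  change IsG ((Cx h).map φ.toLinearMap) at hg0
  have memg0 : ∀ X, φ X ∈ g0 ↔ X ∈ Cx h := by
    intro X
    rw [hg0d]
    constructor
    · rintro ⟨Y, hY, hYX⟩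
      rwa [← φ.injective hYX]
    · intro hX; exact ⟨X, hX, rfl⟩
  rw [← hg0d] at hg0
  have hV : Module.finrank ℂ (EuclideanSpace ℂ (Fin (n+1))) = n + 1 := by simp
  have hf0 : Module.finrank ℂ g0 = n^2 := by
    rw [hg0d, LinearEquiv.finrank_map_eq, Cx_finrank hs, hd]
  by_cases hirr : Irr (g0 ⊔ Submodule.span ℂ {1})
  · have hd1 := Submodule.finrank_mono (le_sup_left : g0 ≤ g0 ⊔ Submodule.span ℂ {1})
    have hd2 := Submodule.finrank_add_le_finrank_add_finrank g0 (Submodule.span ℂ {1})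
    have hd3 := finrank_span_le_card (R := ℂ) ({1} : Set (EuclideanSpace ℂ (Fin (n+1)) →ₗ[ℂ] EuclideanSpace ℂ (Fin (n+1))))
    have hd4 : Module.finrank ℂ (Submodule.span ℂ ({1} : Set (EuclideanSpace ℂ (Fin (n+1)) →ₗ[ℂ] EuclideanSpace ℂ (Fin (n+1))))) ≤ 1 := by simpa using hd3
    obtain ⟨h3, b, P, hP, hPX⟩ := lie_irr (isG_sup_one hg0) (Submodule.mem_sup_right (Submodule.mem_span_singleton_self _)) hirr
      (by rw [hV]; omega) (by rw [hV, Nat.add_sub_cancel]; omega) (by rw [hV, Nat.add_sub_cancel]; omega)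
    rw [hV] at h3
    obtain rfl : n = 2 := by omega
    obtain ⟨U, hU, hUb⟩ := exists_U_of_onb b
    refine ⟨P * U, mul_mem hP hU, Or.inl ⟨rfl, fun X hX => ?_⟩⟩
    obtain ⟨a, ha⟩ := hPX (φ X) (Submodule.mem_sup_left ((memg0 X).2 (le_Cx hX)))
    refine ⟨a, ?_⟩
    have h5 : LinearMap.toMatrixOrthonormal b (φ X) = U * X * Uᴴ := by
      ext i j
      rw [hUb, LinearMap.toMatrixOrthonormal_apply_apply]
    rw [h5] at ha
    rw [Matrix.conjTranspose_mul]
    simp only [Matrix.mul_assoc] at ha ⊢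
    exact ha
  · have hirr0 : ¬ Irr g0 := by
      intro hI
      apply hirr
      intro W hW
      exact hI W fun X hX => hW X (Submodule.mem_sup_left hX)
    obtain ⟨e, he, hcase⟩ := Red hg0 hirr0 hn hV hf0
    obtain ⟨b, hbe⟩ := exists_onb_last hV he
    obtain ⟨U, hU, hUb⟩ := exists_U_of_onb b
    have hUU : Uᴴ * U = 1 := by
      rw [← Matrix.star_eq_conjTranspose]; exact (Matrix.mem_unitaryGroup_iff').1 hU
    have hskew : ∀ X, Xᴴ = -X ↔ (U * X * Uᴴ)ᴴ = -(U * X * Uᴴ) := by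
      intro X
      constructor
      · intro hX
        rw [Matrix.conjTranspose_mul, Matrix.conjTranspose_mul, hX, Matrix.conjTranspose_conjTranspose]
        simp [Matrix.mul_assoc]
      · intro hX
        rw [Matrix.conjTranspose_mul, Matrix.conjTranspose_mul, Matrix.conjTranspose_conjTranspose] at hX
        have := congrArg (fun Z => Uᴴ * Z * U) hX
        calc Xᴴ = (Uᴴ * U) * Xᴴ * (Uᴴ * U) := by rw [hUU]; simp
          _ = Uᴴ * (U * (Xᴴ * Uᴴ)) * U := by simp only [Matrix.mul_assoc]
          _ = Uᴴ * (-(U * X * Uᴴ)) * U := this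
          _ = - ((Uᴴ * U) * X * (Uᴴ * U)) := by simp only [Matrix.mul_assoc, Matrix.mul_neg, Matrix.neg_mul]
          _ = _ := by rw [hUU]; simp
    have hBk : ∀ X, Bk e (φ X) ↔ BDm (U * X * Uᴴ) := by
      intro X
      constructor
      · intro hB i
        rw [hUb, hUb, hbe]
        exact hB (b i.castSucc) (by rw [← hbe]; exact b.orthonormal.2 (Fin.castSucc_lt_last i).ne')
      · intro hB u hu
        have h7 : u = ∑ i : Fin n, inner ℂ (b i.castSucc) u • b i.castSucc := by
          conv_lhs => rw [← b.sum_repr' u]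
          rw [Fin.sum_univ_castSucc, hbe, hu, zero_smul, add_zero]
        have h5 : ∀ i : Fin n, inner ℂ (b i.castSucc) (φ X e) = (0:ℂ) := by
          intro i
          have := (hB i).1
          rwa [hUb, hbe] at this
        have h6 : ∀ i : Fin n, inner ℂ e (φ X (b i.castSucc)) = (0:ℂ) := by
          intro i
          have := (hB i).2
          rwa [hUb, hbe] at this
        constructor
        · rw [h7, sum_inner]
          refine Finset.sum_eq_zero fun i _ => ?_
          rw [inner_smul_left, h5, mul_zero]
        · rw [h7, map_sum, inner_sum]
          refine Finset.sum_eq_zero fun i _ => ?_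
          rw [map_smul, inner_smul_right, h6, mul_zero]
    have htr : ∀ X, LinearMap.trace ℂ _ (φ X) = (U * X * Uᴴ).trace := by
      intro X
      rw [LinearMap.trace_eq_sum_inner (φ X) b, Matrix.trace]
      refine Finset.sum_congr rfl fun i _ => ?_
      rw [Matrix.diag_apply, hUb]
    have hll : ∀ X, inner ℂ e (φ X e) = (U * X * Uᴴ) (Fin.last n) (Fin.last n) := by
      intro X
      rw [hUb, hbe]
    refine ⟨U, hU, Or.inr ?_⟩
    rcases hcase with hcase | ⟨q, hcase⟩
    · left
      intro X
      rw [Cx_skew hs, ← memg0, hcase, hskew, hBk, htr, hll]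
    · right
      refine ⟨q, fun X => ?_⟩
      rw [Cx_skew hs, ← memg0, hcase, hskew, hBk, htr, hll]
end LieClass

end PartC3

section PartD1
section D1
open Matrix Complex

theorem herm_diag {n : ℕ} (S : Matrix (Fin n) (Fin n) ℂ) (hS : S.IsHermitian) :
    ∃ V ∈ unitaryGroup (Fin n) ℂ, ∃ θ : Fin n → ℝ, S = V * diagonal (fun i => ((θ i : ℝ) : ℂ)) * Vᴴ := by
  refine ⟨hS.eigenvectorUnitary, hS.eigenvectorUnitary.2, hS.eigenvalues, ?_⟩
  have := hS.spectral_theorem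
  rw [Unitary.conjStarAlgAut_apply] at this
  exact this

theorem skew_diag {n : ℕ} (X : Matrix (Fin n) (Fin n) ℂ) (hX : Xᴴ = -X) :
    ∃ V ∈ unitaryGroup (Fin n) ℂ, ∃ θ : Fin n → ℝ, X = V * diagonal (fun i => I * ((θ i : ℝ) : ℂ)) * Vᴴ := by
  obtain ⟨V, hV, θ, h⟩ := herm_diag ((-I) • X) (by
    rw [Matrix.IsHermitian, conjTranspose_smul, hX]; simp)
  refine ⟨V, hV, θ, ?_⟩
  have e : X = I • ((-I) • X) := by rw [smul_smul]; simp
  rw [e, h]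
  have : diagonal (fun i => I * ((θ i : ℝ) : ℂ)) = I • diagonal (fun i => ((θ i : ℝ) : ℂ)) := by
    rw [← diagonal_smul]; rfl
  rw [this]; simp

theorem exp_conj_diag {n : ℕ} (V : Matrix (Fin n) (Fin n) ℂ) (hV : V ∈ unitaryGroup (Fin n) ℂ) (d : Fin n → ℂ) :
    NormedSpace.exp (V * diagonal d * Vᴴ) = V * diagonal (fun i => Complex.exp (d i)) * Vᴴ := by
  have h1 : V * Vᴴ = 1 := mem_unitaryGroup_iff.1 hV
  have h2 : V⁻¹ = Vᴴ := inv_eq_right_inv h1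
  have h3 : IsUnit V := IsUnit.of_mul_eq_one _ h1
  rw [← h2, Matrix.exp_conj _ _ h3, Matrix.exp_diagonal]
  congr 3
  funext i
  rw [Pi.coe_exp, Complex.exp_eq_exp_ℂ]
  

open scoped Matrix.Norms.L2Operator in
theorem unitary_arg {n : ℕ} (B : Matrix (Fin n) (Fin n) ℂ) (hB : B ∈ unitaryGroup (Fin n) ℂ) :
    ∃ S : Matrix (Fin n) (Fin n) ℂ, S.IsHermitian ∧ NormedSpace.exp (I • S) = B := by
  have hfin : (spectrum ℂ B).Finite := Matrix.finite_spectrum B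
  have hn : IsStarNormal B := by
    constructor
    rw [commute_iff_eq]
    rw [(mem_unitaryGroup_iff.1 hB), (mem_unitaryGroup_iff'.1 hB)]
  refine ⟨cfc (fun z : ℂ => ((Complex.arg z : ℝ) : ℂ)) B, ?_, ?_⟩
  · have : IsSelfAdjoint (cfc (fun z : ℂ => ((Complex.arg z : ℝ) : ℂ)) B) := by
      rw [IsSelfAdjoint, ← cfc_star]; simp
    exact this
  · have hc : ∀ f : ℂ → ℂ, ContinuousOn f (spectrum ℂ B) := fun f => hfin.continuousOn f
    rw [← cfc_smul (hf := hc _)]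
    have h1 := CFC.complex_exp_eq_normedSpace_exp (a := cfc (fun z : ℂ => I • ((Complex.arg z : ℝ) : ℂ)) B) (cfc_predicate _ _)
    refine h1.symm.trans ?_
    rw [← cfc_comp' Complex.exp _ B (Complex.continuous_exp.continuousOn) (hc _)]
    conv_rhs => rw [← cfc_id' ℂ B]
    refine cfc_congr fun z hz => ?_
    have hz1 : ‖z‖ = 1 := by
      have := spectrum.subset_circle_of_unitary (𝕜 := ℂ) (E := Matrix (Fin n) (Fin n) ℂ) hB hz
      simpa using this
    have := Complex.norm_mul_exp_arg_mul_I z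
    rw [hz1] at this
    simpa [mul_comm] using this

theorem unitary_diag {n : ℕ} (B : Matrix (Fin n) (Fin n) ℂ) (hB : B ∈ unitaryGroup (Fin n) ℂ) :
    ∃ V ∈ unitaryGroup (Fin n) ℂ, ∃ θ : Fin n → ℝ, B = V * diagonal (fun i => Complex.exp (I * ((θ i : ℝ) : ℂ))) * Vᴴ := by
  obtain ⟨S, hS, h⟩ := unitary_arg B hB
  obtain ⟨V, hV, θ, h2⟩ := skew_diag (I • S) (by rw [conjTranspose_smul, hS.eq]; simp)
  refine ⟨V, hV, θ, ?_⟩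
  rw [← exp_conj_diag V hV, ← h2, h]

/-! block embedding -/
def JJ {n : ℕ} (B : Matrix (Fin n) (Fin n) ℂ) (a : ℂ) : Matrix (Fin (n+1)) (Fin (n+1)) ℂ :=
  fun i j => Fin.lastCases (Fin.lastCases a (fun _ => 0) j) (fun i' => Fin.lastCases 0 (fun j' => B i' j') j) i

section
variable {n : ℕ} (B C : Matrix (Fin n) (Fin n) ℂ) (a b : ℂ) (i j : Fin n)
@[simp] theorem JJ_cc : JJ B a i.castSucc j.castSucc = B i j := by simp [JJ]
@[simp] theorem JJ_cl : JJ B a i.castSucc (Fin.last n) = 0 := by simp [JJ]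
@[simp] theorem JJ_lc : JJ B a (Fin.last n) j.castSucc = 0 := by simp [JJ]
@[simp] theorem JJ_ll : JJ B a (Fin.last n) (Fin.last n) = a := by simp [JJ]
theorem JJ_mul : JJ B a * JJ C b = JJ (B * C) (a * b) := by
  ext i j
  induction i using Fin.lastCases <;> induction j using Fin.lastCases <;>
    simp [Matrix.mul_apply, Fin.sum_univ_castSucc]
theorem JJ_ct : (JJ B a)ᴴ = JJ Bᴴ (star a) := by
  ext i j
  induction i using Fin.lastCases <;> induction j using Fin.lastCases <;>
    simp [Matrix.conjTranspose_apply]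
theorem JJ_one : JJ (1 : Matrix (Fin n) (Fin n) ℂ) 1 = 1 := by
  ext i j
  induction i using Fin.lastCases <;> induction j using Fin.lastCases <;>
    simp [Matrix.one_apply, Fin.castSucc_ne_last, (Fin.castSucc_ne_last _).symm]
theorem JJ_diag (d : Fin n → ℂ) : JJ (diagonal d) a = diagonal (Fin.lastCases a d : Fin (n+1) → ℂ) := by
  ext i j
  induction i using Fin.lastCases <;> induction j using Fin.lastCases <;>
    simp [Matrix.diagonal_apply, Fin.castSucc_ne_last, (Fin.castSucc_ne_last _).symm]
theorem JJ_det : (JJ B a).det = B.det * a := by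
  rw [det_succ_row _ (Fin.last n), Fin.sum_univ_castSucc]
  have : (JJ B a).submatrix Fin.castSucc Fin.castSucc = B := by ext i j; simp
  simp [this, ← two_mul, mul_comm, Fin.succAbove_last]
theorem JJ_trace : (JJ B a).trace = B.trace + a := by
  simp [Matrix.trace, Fin.sum_univ_castSucc]
theorem BDm_JJ : BDm (JJ B a) := fun i => by simp
theorem JJ_of_BDm (Y : Matrix (Fin (n+1)) (Fin (n+1)) ℂ) (h : BDm Y) :
    Y = JJ (Y.submatrix Fin.castSucc Fin.castSucc) (Y (Fin.last n) (Fin.last n)) := by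
  ext i j
  induction i using Fin.lastCases <;> induction j using Fin.lastCases <;>
    simp [(h _).1, (h _).2]
theorem JJ_inj (h : JJ B a = JJ C b) : B = C ∧ a = b := by
  constructor
  · ext i j
    simpa using congrFun (congrFun h i.castSucc) j.castSucc
  · simpa using congrFun (congrFun h (Fin.last n)) (Fin.last n)
theorem JJ_unitary : JJ B a ∈ unitaryGroup (Fin (n+1)) ℂ ↔ B ∈ unitaryGroup (Fin n) ℂ ∧ a * star a = 1 := by
  rw [mem_unitaryGroup_iff, mem_unitaryGroup_iff, star_eq_conjTranspose, JJ_ct, JJ_mul, ← JJ_one]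
  exact ⟨fun h => JJ_inj _ _ _ _ h, fun h => by rw [star_eq_conjTranspose] at h; rw [h.1, h.2]⟩
end

theorem JJ_exp_skew {n : ℕ} (X : Matrix (Fin n) (Fin n) ℂ) (hX : Xᴴ = -X) (y : ℂ) :
    NormedSpace.exp (JJ X y) = JJ (NormedSpace.exp X) (Complex.exp y) := by
  obtain ⟨V, hV, θ, h⟩ := skew_diag X hX
  have hW : JJ V 1 ∈ unitaryGroup (Fin (n+1)) ℂ := (JJ_unitary _ _).2 ⟨hV, by simp⟩
  have e : JJ X y = JJ V 1 * diagonal (Fin.lastCases y (fun i => I * ((θ i : ℝ) : ℂ)) : Fin (n+1) → ℂ) * (JJ V 1)ᴴ := by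
    rw [← JJ_diag, JJ_ct, JJ_mul, JJ_mul, ← h]; simp
  rw [e, exp_conj_diag _ hW, h, exp_conj_diag _ hV]
  have : (fun i : Fin (n+1) => Complex.exp ((Fin.lastCases y (fun i => I * ((θ i : ℝ) : ℂ)) : Fin (n+1) → ℂ) i))
    = (Fin.lastCases (Complex.exp y) (fun i => Complex.exp (I * ((θ i : ℝ) : ℂ))) : Fin (n+1) → ℂ) := by
    funext i
    induction i using Fin.lastCases <;> simp
  rw [this, ← JJ_diag, JJ_ct, JJ_mul, JJ_mul]; simp

theorem det_conj_unitary {n : ℕ} (V : Matrix (Fin n) (Fin n) ℂ) (hV : V ∈ unitaryGroup (Fin n) ℂ) (D : Matrix (Fin n) (Fin n) ℂ) :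
    (V * D * Vᴴ).det = D.det := by
  have h : V * Vᴴ = 1 := mem_unitaryGroup_iff.1 hV
  rw [det_mul_right_comm, h, one_mul]
theorem trace_conj_unitary {n : ℕ} (V : Matrix (Fin n) (Fin n) ℂ) (hV : V ∈ unitaryGroup (Fin n) ℂ) (D : Matrix (Fin n) (Fin n) ℂ) :
    (V * D * Vᴴ).trace = D.trace := by
  have h : Vᴴ * V = 1 := mem_unitaryGroup_iff'.1 hV
  rw [trace_mul_comm, ← mul_assoc, h, one_mul]

theorem det_exp_skew {n : ℕ} (X : Matrix (Fin n) (Fin n) ℂ) (hX : Xᴴ = -X) :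
    (NormedSpace.exp X).det = Complex.exp X.trace := by
  obtain ⟨V, hV, θ, h⟩ := skew_diag X hX
  rw [h, exp_conj_diag _ hV, det_conj_unitary _ hV, trace_conj_unitary _ hV, det_diagonal, trace_diagonal, Complex.exp_sum]

theorem log_unitary {n : ℕ} (hn : 1 ≤ n) (B : Matrix (Fin n) (Fin n) ℂ) (hB : B ∈ unitaryGroup (Fin n) ℂ)
    (τ : ℝ) (hτ : Complex.exp (I * τ) = B.det) :
    ∃ X : Matrix (Fin n) (Fin n) ℂ, Xᴴ = -X ∧ NormedSpace.exp X = B ∧ X.trace = I * τ := by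
  obtain ⟨V, hV, θ, h⟩ := unitary_diag B hB
  have hdet : B.det = Complex.exp (I * ((∑ i, θ i : ℝ) : ℂ)) := by
    rw [h, det_conj_unitary _ hV, det_diagonal, ← Complex.exp_sum]; simp [Finset.mul_sum]
  rw [hdet, Complex.exp_eq_exp_iff_exists_int] at hτ
  obtain ⟨m, hm⟩ := hτ
  let i0 : Fin n := ⟨0, hn⟩
  let d : Fin n → ℂ := fun i => I * ((θ i + (if i = i0 then 2 * Real.pi * m else 0) : ℝ) : ℂ)
  refine ⟨V * diagonal d * Vᴴ, ?_, ?_, ?_⟩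
  · rw [conjTranspose_mul, conjTranspose_mul, conjTranspose_conjTranspose, diagonal_conjTranspose]
    have : star d = -d := by
      funext i; simp [d]
    have h4 : diagonal (-d) = - diagonal d := (diagonal_neg d).symm
    rw [this, h4, Matrix.neg_mul, Matrix.mul_neg, Matrix.mul_assoc]
  · rw [exp_conj_diag _ hV, h]
    congr 3
    funext i
    simp only [d]
    split_ifs
    · rw [Complex.exp_eq_exp_iff_exists_int]
      exact ⟨m, by push_cast; ring⟩
    · simp
  · rw [trace_conj_unitary _ hV, trace_diagonal, hm]
    simp only [d, ← Finset.mul_sum]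
    rw [← Complex.ofReal_sum, Finset.sum_add_distrib, Finset.sum_ite_eq' ]
    simp; ring
end D1

end PartD1

section PartD2
section D2
open Matrix Complex

structure LieOf {N : ℕ} (H : Subgroup ↥(unitaryGroup (Fin N) ℂ)) (P : Matrix (Fin N) (Fin N) ℂ → Prop) : Prop where
  mem : ∀ Y, P Y → ∃ g ∈ H, (g : Matrix (Fin N) (Fin N) ℂ) = NormedSpace.exp Y
  memt : ∀ Y, (∀ t : ℝ, ∃ g ∈ H, (g : Matrix (Fin N) (Fin N) ℂ) = NormedSpace.exp (t • Y)) → P Y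
  gen : ∀ K : Subgroup ↥(unitaryGroup (Fin N) ℂ), (∀ Y, P Y → ∃ g ∈ K, (g : Matrix (Fin N) (Fin N) ℂ) = NormedSpace.exp Y) → H ≤ K
  closed : IsClosed (H : Set ↥(unitaryGroup (Fin N) ℂ))

theorem exp_conj_unitary {N : ℕ} (U : Matrix (Fin N) (Fin N) ℂ) (hU : U ∈ unitaryGroup (Fin N) ℂ) (X : Matrix (Fin N) (Fin N) ℂ) :
    NormedSpace.exp (U * X * Uᴴ) = U * NormedSpace.exp X * Uᴴ := by
  have h1 : U * Uᴴ = 1 := mem_unitaryGroup_iff.1 hU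
  have h2 : U⁻¹ = Uᴴ := inv_eq_right_inv h1
  have h3 : IsUnit U := IsUnit.of_mul_eq_one _ h1
  rw [← h2, Matrix.exp_conj _ _ h3]

theorem lieOf_conj {N : ℕ} (H : Subgroup ↥(unitaryGroup (Fin N) ℂ))
    (hclosed : IsClosed (H : Set ↥(unitaryGroup (Fin N) ℂ)))
    (P : Matrix (Fin N) (Fin N) ℂ → Prop)
    (h1 : ∀ X, P X ↔ ∀ t : ℝ, ∃ g ∈ H, (g : Matrix (Fin N) (Fin N) ℂ) = NormedSpace.exp (t • X))
    (h2 : ∀ K : Subgroup ↥(unitaryGroup (Fin N) ℂ),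
        (∀ X, P X → ∃ g ∈ K, (g : Matrix (Fin N) (Fin N) ℂ) = NormedSpace.exp X) → H ≤ K)
    (u : ↥(unitaryGroup (Fin N) ℂ)) (Q : Matrix (Fin N) (Fin N) ℂ → Prop)
    (hQ : ∀ X, P X ↔ Q (u * X * (u : Matrix (Fin N) (Fin N) ℂ)ᴴ)) :
    ∃ H' : Subgroup ↥(unitaryGroup (Fin N) ℂ), (H' : Set ↥(unitaryGroup (Fin N) ℂ)) = (fun A => u * A * u⁻¹) '' (H : Set ↥(unitaryGroup (Fin N) ℂ))
     ∧ LieOf H' Q := by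
  have hu1 : (u : Matrix (Fin N) (Fin N) ℂ)ᴴ * u = 1 := mem_unitaryGroup_iff'.1 u.2
  have hu2 : (u : Matrix (Fin N) (Fin N) ℂ) * (u : Matrix (Fin N) (Fin N) ℂ)ᴴ = 1 := mem_unitaryGroup_iff.1 u.2
  have hui : ((u⁻¹ : ↥(unitaryGroup (Fin N) ℂ)) : Matrix (Fin N) (Fin N) ℂ) = (u : Matrix (Fin N) (Fin N) ℂ)ᴴ := rfl
  have hback : ∀ Y, Q Y ↔ P ((u : Matrix (Fin N) (Fin N) ℂ)ᴴ * Y * u) := by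
    intro Y
    rw [hQ]
    have : (u : Matrix (Fin N) (Fin N) ℂ) * ((u : Matrix (Fin N) (Fin N) ℂ)ᴴ * Y * u) * (u : Matrix (Fin N) (Fin N) ℂ)ᴴ
      = (u * (u : Matrix (Fin N) (Fin N) ℂ)ᴴ) * Y * (u * (u : Matrix (Fin N) (Fin N) ℂ)ᴴ) := by noncomm_ring
    rw [this, hu2]; simp
  have hexp : ∀ Y, NormedSpace.exp ((u : Matrix (Fin N) (Fin N) ℂ)ᴴ * Y * u) = (u : Matrix (Fin N) (Fin N) ℂ)ᴴ * NormedSpace.exp Y * u := by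
    intro Y
    have := exp_conj_unitary ((u : Matrix (Fin N) (Fin N) ℂ)ᴴ) (u⁻¹).2 Y
    rwa [conjTranspose_conjTranspose] at this
  have hcc : ∀ Z : Matrix (Fin N) (Fin N) ℂ, (u : Matrix (Fin N) (Fin N) ℂ) * ((u : Matrix (Fin N) (Fin N) ℂ)ᴴ * Z * u) * (u : Matrix (Fin N) (Fin N) ℂ)ᴴ = Z := by
    intro Z
    have : (u : Matrix (Fin N) (Fin N) ℂ) * ((u : Matrix (Fin N) (Fin N) ℂ)ᴴ * Z * u) * (u : Matrix (Fin N) (Fin N) ℂ)ᴴ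
      = (u * (u : Matrix (Fin N) (Fin N) ℂ)ᴴ) * Z * (u * (u : Matrix (Fin N) (Fin N) ℂ)ᴴ) := by noncomm_ring
    rw [this, hu2]; simp
  refine ⟨H.map (MulAut.conj u).toMonoidHom, by rfl, ?_, ?_, ?_, ?_⟩
  · intro Y hY
    obtain ⟨g, hg, he⟩ := (h1 _).1 ((hback Y).1 hY) 1
    refine ⟨u * g * u⁻¹, ⟨g, hg, rfl⟩, ?_⟩
    rw [one_smul, hexp] at he
    simp only [Submonoid.coe_mul, hui, he]
    exact hcc _
  · intro Y hY
    rw [hback, h1]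
    intro t
    obtain ⟨g', ⟨g, hg, rfl⟩, he⟩ := hY t
    refine ⟨g, hg, ?_⟩
    have e : t • ((u : Matrix (Fin N) (Fin N) ℂ)ᴴ * Y * u) = (u : Matrix (Fin N) (Fin N) ℂ)ᴴ * (t • Y) * u := by simp
    rw [e, hexp, ← he]
    have e2 : (((MulAut.conj u).toMonoidHom g : ↥(unitaryGroup (Fin N) ℂ)) : Matrix (Fin N) (Fin N) ℂ) = u * g * (u : Matrix (Fin N) (Fin N) ℂ)ᴴ := rfl
    rw [e2]
    have : (u : Matrix (Fin N) (Fin N) ℂ)ᴴ * (u * g * (u : Matrix (Fin N) (Fin N) ℂ)ᴴ) * u = ((u : Matrix (Fin N) (Fin N) ℂ)ᴴ * u) * g * ((u : Matrix (Fin N) (Fin N) ℂ)ᴴ * u) := by noncomm_ring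
    rw [this, hu1]; simp
  · intro K hK
    rw [Subgroup.map_le_iff_le_comap]
    apply h2
    intro X hX
    obtain ⟨g, hg, he⟩ := hK _ ((hQ X).1 hX)
    refine ⟨u⁻¹ * g * u, ?_, ?_⟩
    · rw [Subgroup.mem_comap]
      have : (MulAut.conj u).toMonoidHom (u⁻¹ * g * u) = g := by
        simp [MulAut.conj_apply, mul_assoc]
      rwa [this]
    · rw [exp_conj_unitary _ u.2] at he
      simp only [Submonoid.coe_mul, hui, he]
      have : (u : Matrix (Fin N) (Fin N) ℂ)ᴴ * (u * NormedSpace.exp X * (u : Matrix (Fin N) (Fin N) ℂ)ᴴ) * u = ((u : Matrix (Fin N) (Fin N) ℂ)ᴴ * u) * NormedSpace.exp X * ((u : Matrix (Fin N) (Fin N) ℂ)ᴴ * u) := by noncomm_ring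
      rw [this, hu1]; simp
  · have : ((H.map (MulAut.conj u).toMonoidHom : Subgroup _) : Set ↥(unitaryGroup (Fin N) ℂ)) = (fun A => u⁻¹ * A * u) ⁻¹' (H : Set ↥(unitaryGroup (Fin N) ℂ)) := by
      ext A
      constructor
      · rintro ⟨g, hg, rfl⟩
        simpa [MulAut.conj_apply, mul_assoc] using hg
      · intro h
        exact ⟨_, h, by simp [MulAut.conj_apply, mul_assoc]⟩
    rw [this]
    exact hclosed.preimage (by fun_prop)
end D2

end PartD2

section PartD3
section D3
open Matrix Complex

theorem mem_blockDiag {n : ℕ} (A : ↥(unitaryGroup (Fin (n+1)) ℂ)) : A ∈ blockDiagSet (n+1) ↔ BDm (A : Matrix (Fin (n+1)) (Fin (n+1)) ℂ) := by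
  constructor
  · intro h i
    have := i.2.ne
    exact ⟨h _ _ (by simp [this]), h _ _ (by simp [this])⟩
  · intro h i j hij
    induction i using Fin.lastCases <;> induction j using Fin.lastCases
    · simp at hij
    · exact (h _).2
    · exact (h _).1
    · rename_i i j
      have h1 := i.2.ne
      have h2 := j.2.ne
      simp [h1, h2] at hij

theorem unit_det {n : ℕ} (B : Matrix (Fin n) (Fin n) ℂ) (hB : B ∈ unitaryGroup (Fin n) ℂ) : B.det * star B.det = 1 := by
  have := congrArg det (mem_unitaryGroup_iff.1 hB)
  rwa [det_mul, star_eq_conjTranspose, det_conjTranspose, det_one] at this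

theorem ne_of_unit {a : ℂ} (h : a * star a = 1) : a ≠ 0 := by rintro rfl; simp at h

theorem mem_blockDiag' {n : ℕ} (A : ↥(unitaryGroup (Fin (n+1)) ℂ)) : A ∈ blockDiagSet (n+1) ↔
    ∃ B a, B ∈ unitaryGroup (Fin n) ℂ ∧ a * star a = 1 ∧ (A : Matrix (Fin (n+1)) (Fin (n+1)) ℂ) = JJ B a := by
  rw [mem_blockDiag]
  constructor
  · intro h
    have e := JJ_of_BDm _ h
    have := A.2
    rw [e, JJ_unitary] at this
    exact ⟨_, _, this.1, this.2, e⟩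
  · rintro ⟨B, a, -, -, h⟩
    rw [h]; exact BDm_JJ _ _

theorem last_val {n : ℕ} (i : Fin (n+1)) (h : (i : ℕ) = n + 1 - 1) : i = Fin.last n := by
  ext; simpa using h

theorem mem_su {n : ℕ} (A : ↥(unitaryGroup (Fin (n+1)) ℂ)) : A ∈ suTimesU1Set (n+1) ↔
    ∃ B a, (A : Matrix (Fin (n+1)) (Fin (n+1)) ℂ) = JJ B a ∧ B.det = 1 := by
  constructor
  · rintro ⟨h1, h2⟩
    obtain ⟨B, a, hB, ha, h⟩ := (mem_blockDiag' A).1 h1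
    refine ⟨B, a, h, ?_⟩
    have := h2 (Fin.last n) (Fin.last n) (by simp) (by simp)
    rw [h, JJ_det, JJ_ll] at this
    exact mul_right_cancel₀ (ne_of_unit ha) (this.trans (one_mul a).symm)
  · rintro ⟨B, a, h, hd⟩
    refine ⟨(mem_blockDiag A).2 (h ▸ BDm_JJ _ _), ?_⟩
    intro i j hi hj
    rw [last_val i hi, last_val j hj, h, JJ_det, JJ_ll, hd, one_mul]

theorem mem_Hk {n : ℕ} (k₁ k₂ : ℤ) (A : ↥(unitaryGroup (Fin (n+1)) ℂ)) : A ∈ HkSet (n+1) k₁ k₂ ↔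
    ∃ B a, (A : Matrix (Fin (n+1)) (Fin (n+1)) ℂ) = JJ B a ∧ a ^ k₁ = B.det ^ k₂ := by
  constructor
  · rintro ⟨h1, h2⟩
    obtain ⟨B, a, hB, ha, h⟩ := (mem_blockDiag' A).1 h1
    refine ⟨B, a, h, ?_⟩
    have := h2 (Fin.last n) (Fin.last n) (by simp) (by simp)
    rwa [h, JJ_det, JJ_ll, mul_assoc, mul_inv_cancel₀ (ne_of_unit ha), mul_one] at this
  · rintro ⟨B, a, h, hd⟩
    refine ⟨(mem_blockDiag A).2 (h ▸ BDm_JJ _ _), ?_⟩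
    have ha := A.2
    rw [h, JJ_unitary] at ha
    intro i j hi hj
    rw [last_val i hi, last_val j hj, h, JJ_det, JJ_ll, mul_assoc, mul_inv_cancel₀ (ne_of_unit ha.2), mul_one, hd]

theorem exists_KR {n : ℕ} (R : ℂ → ℂ → Prop) (h1 : R 1 1) (h2 : ∀ d a d' a', R d a → R d' a' → R (d * d') (a * a'))
    (h3 : ∀ d a, R d a → R d⁻¹ a⁻¹) :
    ∃ K : Subgroup ↥(unitaryGroup (Fin (n+1)) ℂ), ∀ g, g ∈ K ↔ ∃ B a, (g : Matrix (Fin (n+1)) (Fin (n+1)) ℂ) = JJ B a ∧ R B.det a := by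
  refine ⟨{ carrier := {g | ∃ B a, (g : Matrix (Fin (n+1)) (Fin (n+1)) ℂ) = JJ B a ∧ R B.det a}, one_mem' := ?_, mul_mem' := ?_, inv_mem' := ?_ }, fun g => Iff.rfl⟩
  · rintro g g' ⟨B, a, h, hR⟩ ⟨B', a', h', hR'⟩
    exact ⟨B * B', a * a', by rw [← JJ_mul, ← h, ← h']; rfl, by rw [det_mul]; exact h2 _ _ _ _ hR hR'⟩
  · exact ⟨1, 1, by rw [JJ_one]; rfl, by simpa using h1⟩
  · rintro g ⟨B, a, h, hR⟩
    have hg := g.2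
    rw [h, JJ_unitary] at hg
    refine ⟨Bᴴ, star a, ?_, ?_⟩
    · rw [← JJ_ct, ← h]; rfl
    · rw [det_conjTranspose, ← inv_eq_of_mul_eq_one_right (unit_det B hg.1), ← inv_eq_of_mul_eq_one_right hg.2]
      exact h3 _ _ hR

theorem JJ_skew {n : ℕ} (X : Matrix (Fin n) (Fin n) ℂ) (y : ℂ) : (JJ X y)ᴴ = -(JJ X y) ↔ Xᴴ = -X ∧ star y = -y := by
  have : -(JJ X y) = JJ (-X) (-y) := by
    ext i j
    induction i using Fin.lastCases <;> induction j using Fin.lastCases <;> simp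
  rw [this, JJ_ct]
  exact ⟨fun h => JJ_inj _ _ _ _ h, fun h => by rw [h.1, h.2]⟩

theorem exists_arg {a : ℂ} (h : a * star a = 1) : ∃ α : ℝ, a = Complex.exp (I * α) := by
  have hn : ‖a‖ = 1 := by
    have h' : ‖a‖ * ‖a‖ = 1 := by
      have := congrArg norm h
      simpa using this
    nlinarith [norm_nonneg a]
  refine ⟨a.arg, ?_⟩
  have := Complex.norm_mul_exp_arg_mul_I a
  rw [hn] at this
  simpa [mul_comm] using this.symm

/-- Case B -/
theorem caseB {n : ℕ} (hn : 1 ≤ n) (H : Subgroup ↥(unitaryGroup (Fin (n+1)) ℂ))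
    (hH : LieOf H (fun Y => Yᴴ = -Y ∧ BDm Y ∧ Y.trace = Y (Fin.last n) (Fin.last n))) :
    (H : Set ↥(unitaryGroup (Fin (n+1)) ℂ)) = suTimesU1Set (n+1) := by
  apply Set.Subset.antisymm
  · obtain ⟨K, hK⟩ := exists_KR (n := n) (fun d a => d = 1) rfl (by rintro d a d' a' rfl rfl; simp) (by rintro d a rfl; simp)
    have : H ≤ K := by
      apply hH.gen
      rintro Y ⟨h1, h2, h3⟩
      obtain ⟨g, hg, he⟩ := hH.mem Y ⟨h1, h2, h3⟩
      refine ⟨g, ?_, he⟩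
      rw [hK]
      have e := JJ_of_BDm Y h2
      set X := Y.submatrix Fin.castSucc Fin.castSucc
      set y := Y (Fin.last n) (Fin.last n)
      rw [e, JJ_skew] at h1
      rw [e, JJ_trace] at h3
      rw [e, JJ_exp_skew _ h1.1] at he
      refine ⟨_, _, he, ?_⟩
      rw [det_exp_skew _ h1.1]
      have : X.trace = 0 := by simpa using h3
      rw [this, Complex.exp_zero]
    intro g hg
    rw [mem_su, ← hK]
    exact this hg
  · intro g hg
    rw [mem_su] at hg
    obtain ⟨B, a, h, hd⟩ := hg
    have hu := g.2
    rw [h, JJ_unitary] at hu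
    obtain ⟨α, hα⟩ := exists_arg hu.2
    obtain ⟨X, hX, he, ht⟩ := log_unitary hn B hu.1 0 (by simp [hd])
    obtain ⟨g', hg', he'⟩ := hH.mem (JJ X (I * α)) ⟨(JJ_skew _ _).2 ⟨hX, by simp⟩, BDm_JJ _ _, by rw [JJ_trace, JJ_ll, ht]; simp⟩
    rw [JJ_exp_skew _ hX, he, ← hα, ← h] at he'
    have : g' = g := Subtype.ext he'
    rwa [← this]
end D3

end PartD3

section PartD4
section D4
open Matrix Complex

theorem skew_trace {n : ℕ} (X : Matrix (Fin n) (Fin n) ℂ) (hX : Xᴴ = -X) : star X.trace = -X.trace := by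
  rw [← trace_conjTranspose, hX, trace_neg]

theorem caseC_mem {n : ℕ} (q : ℝ) (H : Subgroup ↥(unitaryGroup (Fin (n+1)) ℂ))
    (hH : LieOf H (fun Y => Yᴴ = -Y ∧ BDm Y ∧ Y (Fin.last n) (Fin.last n) = q * (Y.trace - Y (Fin.last n) (Fin.last n))))
    (X : Matrix (Fin n) (Fin n) ℂ) (hX : Xᴴ = -X) :
    ∃ g ∈ H, (g : Matrix (Fin (n+1)) (Fin (n+1)) ℂ) = JJ (NormedSpace.exp X) (Complex.exp (q * X.trace)) := by
  obtain ⟨g', hg', he'⟩ := hH.mem (JJ X (q * X.trace)) ⟨(JJ_skew _ _).2 ⟨hX, by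
    have := skew_trace X hX
    rw [star_mul', this]; simp⟩, BDm_JJ _ _, by rw [JJ_trace, JJ_ll]; ring⟩
  exact ⟨g', hg', by rw [he', JJ_exp_skew _ hX]⟩

theorem wW_mem {n : ℕ} (s : ℝ) : JJ (1 : Matrix (Fin n) (Fin n) ℂ) (Complex.exp (2 * Real.pi * s * I)) ∈ unitaryGroup (Fin (n+1)) ℂ := by
  rw [JJ_unitary]
  refine ⟨one_mem _, ?_⟩
  rw [Complex.star_def, ← Complex.exp_conj, ← Complex.exp_add]
  simp [Complex.conj_ofNat]

noncomputable def wW (n : ℕ) (s : ℝ) : ↥(unitaryGroup (Fin (n+1)) ℂ) := ⟨_, wW_mem (n := n) s⟩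

theorem wW_add {n : ℕ} (s t : ℝ) : wW n (s + t) = wW n s * wW n t := by
  apply Subtype.ext
  simp only [wW, Submonoid.coe_mul, JJ_mul, one_mul, ← Complex.exp_add]
  congr 2
  push_cast; ring

theorem wW_zero {n : ℕ} : wW n 0 = 1 := by
  apply Subtype.ext
  simp [wW, JJ_one]

theorem wW_cont {n : ℕ} : Continuous (wW n) := by
  apply Continuous.subtype_mk
  apply continuous_matrix
  intro i j
  induction i using Fin.lastCases <;> induction j using Fin.lastCases <;> simp only [JJ_ll, JJ_lc, JJ_cl, JJ_cc] <;> fun_prop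

theorem caseC_rat {n : ℕ} (hn : 1 ≤ n) (q : ℝ) (H : Subgroup ↥(unitaryGroup (Fin (n+1)) ℂ))
    (hH : LieOf H (fun Y => Yᴴ = -Y ∧ BDm Y ∧ Y (Fin.last n) (Fin.last n) = q * (Y.trace - Y (Fin.last n) (Fin.last n)))) :
    ¬ Irrational q := by
  intro hq
  let T : AddSubgroup ℝ :=
    { carrier := {s | wW n s ∈ H}
      zero_mem' := by simp [wW_zero, H.one_mem]
      add_mem' := by
        intro a b ha hb
        simp only [Set.mem_setOf_eq] at *
        rw [wW_add]; exact H.mul_mem ha hb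
      neg_mem' := by
        intro a ha
        simp only [Set.mem_setOf_eq] at *
        have : wW n (-a) = (wW n a)⁻¹ := by
          rw [eq_inv_iff_mul_eq_one, ← wW_add, neg_add_cancel, wW_zero]
        rw [this]; exact H.inv_mem ha }
  have hT : ∀ s, s ∈ T ↔ wW n s ∈ H := fun s => Iff.rfl
  have hcl : IsClosed (T : Set ℝ) := hH.closed.preimage wW_cont
  have h1 : (1 : ℝ) ∈ T := by
    rw [hT]
    have : wW n 1 = 1 := by
      apply Subtype.ext
      simp [wW, JJ_one, Complex.exp_two_pi_mul_I]
    rw [this]; exact H.one_mem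
  have h2 : q ∈ T := by
    rw [hT]
    obtain ⟨X, hX, he, ht⟩ := log_unitary hn (1 : Matrix (Fin n) (Fin n) ℂ) (one_mem _) (2 * Real.pi) (by
      rw [det_one, ← Complex.exp_two_pi_mul_I]; congr 1; push_cast; ring)
    obtain ⟨g, hg, hge⟩ := caseC_mem q H hH X hX
    have : wW n q = g := by
      apply Subtype.ext
      rw [hge, he, ht]
      simp only [wW]
      congr 2
      push_cast; ring
    rwa [this]
  have hd : Dense ((AddSubgroup.closure {q, 1} : AddSubgroup ℝ) : Set ℝ) := by
    rw [dense_addSubgroupClosure_pair_iff]; simpa using hq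
  have hle : AddSubgroup.closure {q, 1} ≤ T := by
    rw [AddSubgroup.closure_le]
    rintro x (rfl | rfl)
    · exact h2
    · exact h1
  have hall : ∀ s, s ∈ T := by
    intro s
    have := (hd.mono hle).closure_eq
    rw [hcl.closure_eq] at this
    have h : s ∈ (T : Set ℝ) := by rw [this]; trivial
    exact h
  have := hH.memt (JJ 0 (2 * Real.pi * I)) (by
    intro t
    refine ⟨wW n t, (hT t).1 (hall t), ?_⟩
    have e : t • (JJ (0 : Matrix (Fin n) (Fin n) ℂ) (2 * Real.pi * I)) = JJ 0 (2 * Real.pi * t * I) := by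
      ext i j
      induction i using Fin.lastCases <;> induction j using Fin.lastCases <;> simp
      ring
    rw [e, JJ_exp_skew _ (by simp), NormedSpace.exp_zero]
    rfl)
  have h3 := this.2.2
  rw [JJ_trace, JJ_ll] at h3
  simp [Real.pi_ne_zero] at h3

theorem caseC {n : ℕ} (hn : 1 ≤ n) (q : ℝ) (H : Subgroup ↥(unitaryGroup (Fin (n+1)) ℂ))
    (hH : LieOf H (fun Y => Yᴴ = -Y ∧ BDm Y ∧ Y (Fin.last n) (Fin.last n) = q * (Y.trace - Y (Fin.last n) (Fin.last n)))) :
    ∃ k₁ k₂ : ℤ, 0 < k₁ ∧ IsCoprime k₁ k₂ ∧ (H : Set ↥(unitaryGroup (Fin (n+1)) ℂ)) = HkSet (n+1) k₁ k₂ := by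
  have hr := caseC_rat hn q H hH
  rw [Irrational, not_not] at hr
  obtain ⟨r, rfl⟩ := hr
  have hcop : IsCoprime (r.den : ℤ) r.num := by
    rw [Int.isCoprime_iff_gcd_eq_one, Int.gcd_comm]
    exact r.reduced
  have hden : (r.den : ℂ) ≠ 0 := by exact_mod_cast r.den_nz
  have hrq : (((r : ℚ) : ℝ) : ℂ) * r.den = r.num := by
    have : (r : ℚ) * r.den = r.num := Rat.mul_den_eq_num r
    exact_mod_cast congrArg (fun x : ℚ => (x : ℂ)) this
  refine ⟨r.den, r.num, by exact_mod_cast r.den_pos, hcop, ?_⟩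
  apply Set.Subset.antisymm
  · obtain ⟨K, hK⟩ := exists_KR (n := n) (fun d a => a ^ (r.den : ℤ) = d ^ r.num) (by simp)
      (by intro d a d' a' h h'; rw [mul_zpow, mul_zpow, h, h']) (by intro d a h; rw [_root_.inv_zpow, _root_.inv_zpow, h])
    have : H ≤ K := by
      apply hH.gen
      rintro Y ⟨h1, h2, h3⟩
      obtain ⟨g, hg, he⟩ := hH.mem Y ⟨h1, h2, h3⟩
      refine ⟨g, ?_, he⟩
      rw [hK]
      have e := JJ_of_BDm Y h2
      set X := Y.submatrix Fin.castSucc Fin.castSucc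
      set y := Y (Fin.last n) (Fin.last n)
      rw [e, JJ_skew] at h1
      rw [e, JJ_trace, add_sub_cancel_right] at h3
      rw [e, JJ_exp_skew _ h1.1] at he
      refine ⟨_, _, he, ?_⟩
      rw [det_exp_skew _ h1.1, ← Complex.exp_int_mul, ← Complex.exp_int_mul, h3]
      congr 1
      rw [← hrq]; push_cast; ring
    intro g hg
    rw [mem_Hk, ← hK]
    exact this hg
  · intro g hg
    rw [mem_Hk] at hg
    obtain ⟨B, a, h, hd⟩ := hg
    have hu := g.2
    rw [h, JJ_unitary] at hu
    obtain ⟨α, hα⟩ := exists_arg hu.2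
    obtain ⟨τ, hτ⟩ := exists_arg (unit_det _ hu.1)
    rw [hα, hτ, ← Complex.exp_int_mul, ← Complex.exp_int_mul, Complex.exp_eq_exp_iff_exists_int] at hd
    obtain ⟨p, hp⟩ := hd
    obtain ⟨u, v, huv⟩ := hcop
    obtain ⟨X, hX, he, ht⟩ := log_unitary hn B hu.1 (τ + 2 * Real.pi * (p * v)) (by
      rw [hτ, Complex.exp_eq_exp_iff_exists_int]
      exact ⟨p * v, by push_cast; ring⟩)
    obtain ⟨g', hg', he'⟩ := caseC_mem _ H hH X hX
    have : g' = g := by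
      apply Subtype.ext
      rw [he', h, he, ht, hα]
      congr 1
      rw [Complex.exp_eq_exp_iff_exists_int]
      refine ⟨-(p * u), ?_⟩
      have huv' : (u : ℂ) * r.den + v * r.num = 1 := by exact_mod_cast congrArg (fun x : ℤ => (x : ℂ)) huv
      apply mul_right_cancel₀ hden
      push_cast at hp ⊢
      linear_combination (-1 : ℂ) * hp + (I * (τ + 2 * Real.pi * (p * v))) * hrq + 2 * Real.pi * I * p * huv'
    rwa [← this]
end D4

end PartD4

section PartD5
section D5
open Matrix Complex
attribute [local instance] Matrix.linftyOpNormedRing Matrix.linftyOpNormedAlgebra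

abbrev toC (S : Matrix (Fin 3) (Fin 3) ℝ) : Matrix (Fin 3) (Fin 3) ℂ := S.map (fun r : ℝ => (r : ℂ))

theorem toC_mul (S T : Matrix (Fin 3) (Fin 3) ℝ) : toC (S * T) = toC S * toC T :=
  map_mul (RingHom.mapMatrix Complex.ofRealHom) S T

theorem toC_exp (S : Matrix (Fin 3) (Fin 3) ℝ) : NormedSpace.exp (toC S) = toC (NormedSpace.exp S) := by
  letI : NormedAlgebra ℚ (Matrix (Fin 3) (Fin 3) ℝ) := NormedAlgebra.restrictScalars ℚ ℝ _
  have hc : Continuous (RingHom.mapMatrix Complex.ofRealHom : Matrix (Fin 3) (Fin 3) ℝ →+* Matrix (Fin 3) (Fin 3) ℂ) := by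
    apply continuous_matrix
    intro i j
    simp only [RingHom.mapMatrix_apply, Matrix.map_apply]
    exact Complex.continuous_ofReal.comp (continuous_id.matrix_elem i j)
  exact (NormedSpace.map_exp _ hc S).symm

def fZ : ℂ × ℝ →+* Matrix (Fin 3) (Fin 3) ℝ where
  toFun p := !![p.1.re, -p.1.im, 0; p.1.im, p.1.re, 0; 0, 0, p.2]
  map_one' := by ext i j; fin_cases i <;> fin_cases j <;> simp
  map_zero' := by ext i j; fin_cases i <;> fin_cases j <;> simp
  map_add' p q := by ext i j; fin_cases i <;> fin_cases j <;> simp; ring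
  map_mul' p q := by ext i j; fin_cases i <;> fin_cases j <;> simp [Matrix.mul_apply, Fin.sum_univ_three] <;> ring

def fY : ℂ × ℝ →+* Matrix (Fin 3) (Fin 3) ℝ where
  toFun p := !![p.1.re, 0, -p.1.im; 0, p.2, 0; p.1.im, 0, p.1.re]
  map_one' := by ext i j; fin_cases i <;> fin_cases j <;> simp
  map_zero' := by ext i j; fin_cases i <;> fin_cases j <;> simp
  map_add' p q := by ext i j; fin_cases i <;> fin_cases j <;> simp; ring
  map_mul' p q := by ext i j; fin_cases i <;> fin_cases j <;> simp [Matrix.mul_apply, Fin.sum_univ_three] <;> ring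

theorem fZ_apply (p : ℂ × ℝ) : fZ p = !![p.1.re, -p.1.im, 0; p.1.im, p.1.re, 0; 0, 0, p.2] := rfl
theorem fY_apply (p : ℂ × ℝ) : fY p = !![p.1.re, 0, -p.1.im; 0, p.2, 0; p.1.im, 0, p.1.re] := rfl

theorem fexp (f : ℂ × ℝ →+* Matrix (Fin 3) (Fin 3) ℝ) (hf : Continuous f) (θ : ℝ) :
    NormedSpace.exp (f (I * θ, 0)) = f (Complex.exp (I * θ), 1) := by
  refine (NormedSpace.map_exp f hf (I * θ, 0)).symm.trans ?_
  congr 1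
  ext1
  · rw [Prod.fst_exp, Complex.exp_eq_exp_ℂ]
  · rw [Prod.snd_exp, NormedSpace.exp_zero]

theorem fZ_cont : Continuous fZ := by
  apply continuous_matrix
  intro i j
  fin_cases i <;> fin_cases j <;> simp [fZ_apply] <;> fun_prop
theorem fY_cont : Continuous fY := by
  apply continuous_matrix
  intro i j
  fin_cases i <;> fin_cases j <;> simp [fY_apply] <;> fun_prop

theorem fix_e3 (Q : Matrix (Fin 3) (Fin 3) ℝ) (h1 : Q ∈ orthogonalGroup (Fin 3) ℝ) (hd : Q.det = 1)
   (h0 : Q 0 2 = 0) (h1' : Q 1 2 = 0) (h2 : Q 2 2 = 1) : ∃ z : ℂ, z * star z = 1 ∧ Q = fZ (z, 1) := by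
  have e := (mem_orthogonalGroup_iff' (Fin 3) ℝ).1 h1
  have e' : ∀ i j, ∑ k, Q k i * Q k j = (1 : Matrix (Fin 3) (Fin 3) ℝ) i j := by
    intro i j
    rw [← e]; simp [Matrix.mul_apply]
  have a1 := e' 0 2
  have a2 := e' 1 2
  have a3 := e' 0 0
  have a4 := e' 1 1
  simp [Fin.sum_univ_three, h0, h1', h2] at a1 a2 a3 a4
  rw [det_fin_three] at hd
  simp [h0, h1', h2, a1, a2] at hd a3 a4
  have b1 : Q 0 0 - Q 1 1 = 0 := by
    nlinarith [sq_nonneg (Q 0 0 - Q 1 1), sq_nonneg (Q 0 1 + Q 1 0)]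
  have b2 : Q 0 1 + Q 1 0 = 0 := by
    nlinarith [sq_nonneg (Q 0 0 - Q 1 1), sq_nonneg (Q 0 1 + Q 1 0)]
  refine ⟨⟨Q 0 0, Q 1 0⟩, ?_, ?_⟩
  · apply Complex.ext
    · simp; linarith
    · simp; ring
  · rw [fZ_apply]
    ext i j
    fin_cases i <;> fin_cases j <;> simp [h0, h1', h2, a1, a2] <;> linarith

theorem rot_orth (z : ℂ) (hz : z * star z = 1) : (fZ (z, 1) ∈ orthogonalGroup (Fin 3) ℝ ∧ (fZ (z,1)).det = 1) ∧
   (fY (z, 1) ∈ orthogonalGroup (Fin 3) ℝ ∧ (fY (z,1)).det = 1) := by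
  have h : z.re * z.re + z.im * z.im = 1 := by
    have := congrArg Complex.re hz
    simpa using this
  refine ⟨⟨?_, ?_⟩, ⟨?_, ?_⟩⟩
  · rw [mem_orthogonalGroup_iff]
    ext i j; fin_cases i <;> fin_cases j <;> simp [fZ_apply, Matrix.mul_apply, Fin.sum_univ_three, star_eq_conjTranspose] <;> linarith
  · rw [det_fin_three]; simp [fZ_apply]; linarith
  · rw [mem_orthogonalGroup_iff]
    ext i j; fin_cases i <;> fin_cases j <;> simp [fY_apply, Matrix.mul_apply, Fin.sum_univ_three, star_eq_conjTranspose] <;> linarith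
  · rw [det_fin_three]; simp [fY_apply]; linarith

theorem euler (R : Matrix (Fin 3) (Fin 3) ℝ) (h1 : R ∈ orthogonalGroup (Fin 3) ℝ) (hd : R.det = 1) :
    ∃ z1 z2 z3 : ℂ, z1 * star z1 = 1 ∧ z2 * star z2 = 1 ∧ z3 * star z3 = 1 ∧ R = fZ (z1, 1) * fY (z2, 1) * fZ (z3, 1) := by
  have e := (mem_orthogonalGroup_iff' (Fin 3) ℝ).1 h1
  have e' : ∑ k, R k 2 * R k 2 = (1 : Matrix (Fin 3) (Fin 3) ℝ) 2 2 := by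
    rw [← e]; simp [Matrix.mul_apply]
  simp [Fin.sum_univ_three] at e'
  set v : ℂ := ⟨R 0 2, R 1 2⟩ with hv
  set ρ : ℝ := ‖v‖ with hρ
  have hρ2 : ρ * ρ = R 0 2 * R 0 2 + R 1 2 * R 1 2 := by
    rw [hρ, Complex.norm_mul_self_eq_normSq, Complex.normSq_apply]
  let z1 : ℂ := Complex.exp (v.arg * I)
  have hz1 : z1 * star z1 = 1 := by
    simp only [z1]
    rw [Complex.star_def, ← Complex.exp_conj, ← Complex.exp_add]
    simp
  have hvz : star z1 * v = ρ := by
    have h := Complex.norm_mul_exp_arg_mul_I v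
    calc star z1 * v = star z1 * (ρ * z1) := by rw [← h]
      _ = ρ * (z1 * star z1) := by ring
      _ = ρ := by rw [hz1, mul_one]
  -- z2 conj * (ρ + i v2) = i
  let z2 : ℂ := ⟨R 2 2, -ρ⟩
  have hz2 : z2 * star z2 = 1 := by
    apply Complex.ext
    · simp [z2]; linarith
    · simp [z2]; ring
  have hz1' : star z1 * star (star z1) = 1 := by rw [star_star, mul_comm]; exact hz1
  have hz2' : star z2 * star (star z2) = 1 := by rw [star_star, mul_comm]; exact hz2
  have o1 := (rot_orth _ hz1').1
  have o2 := (rot_orth _ hz2').2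
  have r1 : z1.re * R 0 2 + z1.im * R 1 2 = ρ := by
    have := congrArg Complex.re hvz
    simpa [hv] using this
  have r2 : z1.re * R 1 2 - z1.im * R 0 2 = 0 := by
    have := congrArg Complex.im hvz
    simp [hv] at this
    linarith
  obtain ⟨z3, hz3, h⟩ := fix_e3 (fY (star z2, 1) * (fZ (star z1, 1) * R)) (mul_mem o2.1 (mul_mem o1.1 h1)) (by
      rw [det_mul, det_mul, o2.2, o1.2, hd]; norm_num) 
    (by
      simp [fY_apply, fZ_apply, Matrix.mul_apply, Fin.sum_univ_three, Matrix.vecMul, dotProduct, z2]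
      linear_combination R 2 2 * r1)
    (by
      simp [fY_apply, fZ_apply, Matrix.mul_apply, Fin.sum_univ_three, Matrix.vecMul, dotProduct, z2]
      linear_combination r2)
    (by
      simp [fY_apply, fZ_apply, Matrix.mul_apply, Fin.sum_univ_three, Matrix.vecMul, dotProduct, z2]
      linear_combination ρ * r1 + hρ2 + e')
  refine ⟨z1, z2, z3, hz1, hz2, hz3, ?_⟩
  rw [← h]
  have c1 : fZ (z1, 1) * fZ (star z1, 1) = 1 := by
    rw [← map_mul, Prod.mk_mul_mk, hz1, mul_one]; exact map_one fZ
  have c2 : fY (z2, 1) * fY (star z2, 1) = 1 := by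
    rw [← map_mul, Prod.mk_mul_mk, hz2, mul_one]; exact map_one fY
  calc R = (fZ (z1, 1) * fZ (star z1, 1)) * R := by rw [c1, one_mul]
    _ = fZ (z1, 1) * (fY (z2, 1) * fY (star z2, 1)) * (fZ (star z1, 1) * R) := by rw [c2, mul_one, mul_assoc]
    _ = _ := by simp only [mul_assoc]
end D5

end PartD5

section PartD6
section D6
open Matrix Complex

theorem toC_ap (S : Matrix (Fin 3) (Fin 3) ℝ) (i j : Fin 3) : toC S i j = ((S i j : ℝ) : ℂ) := rfl

theorem toC_ct (S : Matrix (Fin 3) (Fin 3) ℝ) : (toC S)ᴴ = toC Sᵀ := by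
  ext i j; simp [toC]

theorem exp_smul_one (c : ℂ) : NormedSpace.exp (c • (1 : Matrix (Fin 3) (Fin 3) ℂ)) = Complex.exp c • 1 := by
  rw [smul_one_eq_diagonal, Matrix.exp_diagonal, smul_one_eq_diagonal]
  congr 1
  funext i
  rw [Pi.coe_exp, Complex.exp_eq_exp_ℂ]

theorem exp_shape (α : ℂ) (S : Matrix (Fin 3) (Fin 3) ℝ) :
    NormedSpace.exp (α • (1 : Matrix (Fin 3) (Fin 3) ℂ) + toC S) = Complex.exp α • toC (NormedSpace.exp S) := by
  rw [Matrix.exp_add_of_commute _ _ ((Commute.one_left _).smul_left _), exp_smul_one, toC_exp]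
  simp

theorem exp_anti_orth (S : Matrix (Fin 3) (Fin 3) ℝ) (hS : Sᵀ = -S) : NormedSpace.exp S ∈ orthogonalGroup (Fin 3) ℝ := by
  rw [mem_orthogonalGroup_iff, ← Matrix.exp_transpose, hS, Matrix.exp_neg]
  exact mul_nonsing_inv _ ((isUnit_iff_isUnit_det _).1 (Matrix.isUnit_exp S))

theorem exp_anti_det (S : Matrix (Fin 3) (Fin 3) ℝ) (hS : Sᵀ = -S) : (NormedSpace.exp S).det = 1 := by
  have h := exp_anti_orth ((2⁻¹ : ℝ) • S) (by rw [transpose_smul, hS]; simp)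
  have e : S = 2 • ((2⁻¹ : ℝ) • S) := by
    rw [← Nat.cast_smul_eq_nsmul ℝ, smul_smul]; norm_num
  rw [e, Matrix.exp_nsmul, det_pow]
  have := congrArg det ((mem_orthogonalGroup_iff (Fin 3) ℝ).1 h)
  rw [det_mul, det_transpose, det_one] at this
  rw [sq]; exact this

theorem shapeA (Y : Matrix (Fin 3) (Fin 3) ℂ) (h1 : Yᴴ = -Y) (h2 : ∃ a : ℂ, Y + Yᵀ = a • 1) :
    ∃ (α : ℝ) (S : Matrix (Fin 3) (Fin 3) ℝ), Sᵀ = -S ∧ Y = ((α : ℂ) * I) • (1 : Matrix (Fin 3) (Fin 3) ℂ) + toC S := by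
  obtain ⟨a, ha⟩ := h2
  have e1 : ∀ i j, star (Y j i) = - Y i j := fun i j => by
    have := congrFun (congrFun h1 i) j; simpa using this
  have e2 : ∀ i j, Y i j + Y j i = a * (1 : Matrix (Fin 3) (Fin 3) ℂ) i j := fun i j => by
    have := congrFun (congrFun ha i) j; simpa using this
  have him : ∀ i j, i ≠ j → (Y i j).im = 0 := by
    intro i j hij
    have h3 := e1 i j
    have h4 := e2 i j
    rw [one_apply_ne hij, mul_zero] at h4
    have h5 := congrArg Complex.im h3
    have h6 := congrArg Complex.im h4
    simp at h5 h6
    linarith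
  have hre : ∀ i, (Y i i).re = 0 := by
    intro i
    have h5 := congrArg Complex.re (e1 i i)
    simp at h5; linarith
  have hd : ∀ i, (Y i i).im = a.im / 2 := by
    intro i
    have h5 := congrArg Complex.im (e2 i i)
    simp at h5; linarith
  refine ⟨a.im / 2, Y.map Complex.re, ?_, ?_⟩
  · ext i j
    have h5 := congrArg Complex.re (e1 i j)
    simp at h5
    exact h5
  · ext i j
    by_cases hij : i = j
    · subst hij
      apply Complex.ext <;> simp [toC_ap, hre, hd]
    · apply Complex.ext <;> simp [toC_ap, hij, him i j hij]

theorem shapeA' (α : ℝ) (S : Matrix (Fin 3) (Fin 3) ℝ) (hS : Sᵀ = -S) :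
    (((α : ℂ) * I) • (1 : Matrix (Fin 3) (Fin 3) ℂ) + toC S)ᴴ = -(((α : ℂ) * I) • (1 : Matrix (Fin 3) (Fin 3) ℂ) + toC S) ∧
    ∃ a : ℂ, (((α : ℂ) * I) • (1 : Matrix (Fin 3) (Fin 3) ℂ) + toC S) + (((α : ℂ) * I) • (1 : Matrix (Fin 3) (Fin 3) ℂ) + toC S)ᵀ = a • 1 := by
  have hn : toC (-S) = - toC S := by ext i j; simp [toC]
  have ht : (toC S)ᵀ = toC Sᵀ := by ext i j; simp [toC]
  constructor
  · rw [conjTranspose_add, toC_ct, hS, conjTranspose_smul, hn]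
    simp; abel
  · refine ⟨2 * (α * I), ?_⟩
    rw [transpose_add, ht, hS, hn, transpose_smul, transpose_one, two_mul, add_smul]
    abel

theorem caseA (H : Subgroup ↥(unitaryGroup (Fin 3) ℂ))
    (hH : LieOf H (fun Y => Yᴴ = -Y ∧ ∃ a : ℂ, Y + Yᵀ = a • 1)) :
    (H : Set ↥(unitaryGroup (Fin 3) ℂ)) = eSO3Set 3 := by
  apply Set.Subset.antisymm
  · let K : Subgroup ↥(unitaryGroup (Fin 3) ℂ) :=
      { carrier := eSO3Set 3
        one_mem' := ⟨0, 1, one_mem _, by simp, by simp⟩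
        mul_mem' := by
          rintro g g' ⟨t, R, h1, h2, h3⟩ ⟨t', R', h1', h2', h3'⟩
          refine ⟨t + t', R * R', mul_mem h1 h1', by rw [det_mul, h2, h2', one_mul], ?_⟩
          have := toC_mul R R'
          simp only [toC] at this
          rw [this, Submonoid.coe_mul, h3, h3', smul_mul_smul_comm, ← Complex.exp_add]
          congr 2; push_cast; ring
        inv_mem' := by
          rintro g ⟨t, R, h1, h2, h3⟩
          refine ⟨-t, Rᵀ, ?_, by rw [det_transpose, h2], ?_⟩
          · rw [mem_orthogonalGroup_iff, transpose_transpose]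
            exact (mem_orthogonalGroup_iff' _ _).1 h1
          · have e : ((g⁻¹ : ↥(unitaryGroup (Fin 3) ℂ)) : Matrix (Fin 3) (Fin 3) ℂ) = (g : Matrix (Fin 3) (Fin 3) ℂ)ᴴ := rfl
            have := toC_ct R
            simp only [toC] at this
            rw [e, h3, conjTranspose_smul, this, Complex.star_def, ← Complex.exp_conj]
            congr 2; simp }
    have : H ≤ K := by
      apply hH.gen
      intro Y hY
      obtain ⟨g, hg, he⟩ := hH.mem Y hY
      refine ⟨g, ?_, he⟩
      obtain ⟨α, S, hS, hYe⟩ := shapeA Y hY.1 hY.2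
      exact ⟨α, NormedSpace.exp S, exp_anti_orth S hS, exp_anti_det S hS, by rw [he, hYe, exp_shape]⟩
    exact this
  · rintro g ⟨t, R, h1, h2, h3⟩
    have hmem : ∀ (t : ℝ) (S : Matrix (Fin 3) (Fin 3) ℝ), Sᵀ = -S → ∃ g ∈ H, (g : Matrix (Fin 3) (Fin 3) ℂ) = Complex.exp (t * I) • toC (NormedSpace.exp S) := by
      intro t S hS
      obtain ⟨g, hg, he⟩ := hH.mem _ (shapeA' t S hS)
      exact ⟨g, hg, by rw [he, exp_shape]⟩
    obtain ⟨z1, z2, z3, hz1, hz2, hz3, hR⟩ := euler R h1 h2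
    have hZ : ∀ (t : ℝ) (z : ℂ), z * star z = 1 → ∃ g ∈ H, (g : Matrix (Fin 3) (Fin 3) ℂ) = Complex.exp (t * I) • toC (fZ (z, 1)) := by
      intro t z hz
      obtain ⟨θ, rfl⟩ := exists_arg hz
      rw [← fexp fZ fZ_cont]
      apply hmem
      rw [fZ_apply]; ext i j; fin_cases i <;> fin_cases j <;> simp
    have hY : ∀ (t : ℝ) (z : ℂ), z * star z = 1 → ∃ g ∈ H, (g : Matrix (Fin 3) (Fin 3) ℂ) = Complex.exp (t * I) • toC (fY (z, 1)) := by
      intro t z hz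
      obtain ⟨θ, rfl⟩ := exists_arg hz
      rw [← fexp fY fY_cont]
      apply hmem
      rw [fY_apply]; ext i j; fin_cases i <;> fin_cases j <;> simp
    obtain ⟨g1, m1, e1⟩ := hZ t z1 hz1
    obtain ⟨g2, m2, e2⟩ := hY 0 z2 hz2
    obtain ⟨g3, m3, e3⟩ := hZ 0 z3 hz3
    have : g = g1 * g2 * g3 := by
      apply Subtype.ext
      rw [h3, hR, Submonoid.coe_mul, Submonoid.coe_mul, e1, e2, e3]
      change _ • toC _ = _
      rw [toC_mul, toC_mul]; simp
    rw [this]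
    exact H.mul_mem (H.mul_mem m1 m2) m3

/-- dimension count -/
theorem dimA (h : Submodule ℝ (Matrix (Fin 3) (Fin 3) ℂ)) (hs : ∀ X ∈ h, Xᴴ = -X) (hd : Module.finrank ℝ h = 4)
    (U : Matrix (Fin 3) (Fin 3) ℂ) (hU : U ∈ unitaryGroup (Fin 3) ℂ)
    (hA : ∀ X ∈ h, ∃ a : ℂ, (U*X*Uᴴ) + (U*X*Uᴴ)ᵀ = a • 1) (X : Matrix (Fin 3) (Fin 3) ℂ) :
    X ∈ h ↔ (U*X*Uᴴ)ᴴ = -(U*X*Uᴴ) ∧ ∃ a : ℂ, (U*X*Uᴴ) + (U*X*Uᴴ)ᵀ = a • 1 := by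
  have hu1 : U * Uᴴ = 1 := mem_unitaryGroup_iff.1 hU
  have hu2 : Uᴴ * U = 1 := mem_unitaryGroup_iff'.1 hU
  have hskew : ∀ X ∈ h, (U*X*Uᴴ)ᴴ = -(U*X*Uᴴ) := by
    intro X hX
    rw [conjTranspose_mul, conjTranspose_mul, conjTranspose_conjTranspose, hs X hX]
    simp [mul_assoc]
  let f : Matrix (Fin 3) (Fin 3) ℂ →ₗ[ℝ] (Fin 4 → ℝ) :=
    { toFun := fun X => ![((U*X*Uᴴ) 0 0).im, ((U*X*Uᴴ) 0 1).re, ((U*X*Uᴴ) 0 2).re, ((U*X*Uᴴ) 1 2).re]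
      map_add' := by
        intro X Y
        rw [Matrix.mul_add, Matrix.add_mul]
        ext i; fin_cases i <;> simp
      map_smul' := by
        intro c X
        rw [Matrix.mul_smul, Matrix.smul_mul]
        ext i; fin_cases i <;> simp }
  have hf : ∀ X, f X = ![((U*X*Uᴴ) 0 0).im, ((U*X*Uᴴ) 0 1).re, ((U*X*Uᴴ) 0 2).re, ((U*X*Uᴴ) 1 2).re] := fun X => rfl
  have hinj : ∀ X, (U*X*Uᴴ)ᴴ = -(U*X*Uᴴ) → (∃ a : ℂ, (U*X*Uᴴ) + (U*X*Uᴴ)ᵀ = a • 1) → f X = 0 → X = 0 := by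
    intro X h1 h2 h3
    obtain ⟨α, S, hS, e⟩ := shapeA _ h1 h2
    rw [hf, e] at h3
    have g0 := congrFun h3 0
    have g1 := congrFun h3 1
    have g2 := congrFun h3 2
    have g3 := congrFun h3 3
    have hS' : ∀ i j, S j i = - S i j := fun i j => congrFun (congrFun hS i) j
    have d0 := hS' 0 0
    have d1 := hS' 1 1
    have d2 := hS' 2 2
    simp at g0 g1 g2 g3
    have k1 := hS' 0 1
    have k2 := hS' 0 2
    have k3 := hS' 1 2
    rw [g1] at k1
    rw [g2] at k2
    rw [g3] at k3
    have hSz : S = 0 := by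
      ext i j
      fin_cases i <;> fin_cases j <;> simp <;> linarith
    rw [g0, hSz] at e
    have e0 : U * X * Uᴴ = 0 := by rw [e]; ext i j; simp [toC]
    calc X = (Uᴴ * U) * X * (Uᴴ * U) := by rw [hu2]; simp
      _ = Uᴴ * (U * X * Uᴴ) * U := by noncomm_ring
      _ = 0 := by rw [e0]; simp
  constructor
  · intro hX
    exact ⟨hskew X hX, hA X hX⟩
  · rintro ⟨h1, a, h2⟩
    have hi : Function.Injective (f.comp h.subtype) := by
      rw [← LinearMap.ker_eq_bot, LinearMap.ker_eq_bot']
      rintro ⟨Z, hZ⟩ hz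
      exact Subtype.ext (hinj Z (hskew Z hZ) (hA Z hZ) hz)
    have hsur : Function.Surjective (f.comp h.subtype) := by
      rw [← LinearMap.injective_iff_surjective_of_finrank_eq_finrank (by simp [hd])]
      exact hi
    obtain ⟨⟨Z, hZ⟩, hz⟩ := hsur (f X)
    obtain ⟨b, hb⟩ := hA Z hZ
    have : X - Z = 0 := by
      apply hinj
      · rw [Matrix.mul_sub, Matrix.sub_mul, conjTranspose_sub, h1, hskew Z hZ]; abel
      · refine ⟨a - b, ?_⟩
        rw [Matrix.mul_sub, Matrix.sub_mul, transpose_sub, sub_smul, ← h2, ← hb]; abel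
      · rw [map_sub, sub_eq_zero]; exact hz.symm
    rw [sub_eq_zero.1 this]; exact hZ
end D6

end PartD6

section PartD7
section D7
open Matrix Complex
def swp : Matrix (Fin 2) (Fin 2) ℂ := !![0, 1; 1, 0]
theorem swp_mem : swp ∈ unitaryGroup (Fin 2) ℂ := by
  rw [mem_unitaryGroup_iff]
  ext i j; fin_cases i <;> fin_cases j <;> simp [swp, Matrix.mul_apply, star_eq_conjTranspose, Fin.sum_univ_two]

theorem swap_iff (Z : Matrix (Fin (1+1)) (Fin (1+1)) ℂ) :
    (Zᴴ = -Z ∧ BDm Z ∧ Z.trace = Z (Fin.last 1) (Fin.last 1)) ↔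
    ((swp * Z * swpᴴ)ᴴ = -(swp * Z * swpᴴ) ∧ BDm (swp * Z * swpᴴ) ∧
      (swp * Z * swpᴴ) (Fin.last 1) (Fin.last 1) = ((0:ℝ):ℂ) * ((swp * Z * swpᴴ).trace - (swp * Z * swpᴴ) (Fin.last 1) (Fin.last 1))) := by
  have e : swp * Z * swpᴴ = !![Z 1 1, Z 1 0; Z 0 1, Z 0 0] := by
    ext i j; fin_cases i <;> fin_cases j <;> simp [swp, Matrix.mul_apply, Fin.sum_univ_two, Matrix.vecMul, dotProduct]
  rw [e]
  have l : Fin.last 1 = (1 : Fin 2) := rfl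
  have hZ : Zᴴ = -Z ↔ (star (Z 0 0) = - Z 0 0 ∧ star (Z 1 0) = - Z 0 1) ∧ (star (Z 0 1) = - Z 1 0 ∧ star (Z 1 1) = - Z 1 1) := by
    rw [← Matrix.ext_iff]
    simp only [conjTranspose_apply, Matrix.neg_apply]
    refine (Fin.forall_fin_two (p := fun i => ∀ j : Fin (1+1), star (Z j i) = - Z i j)).trans ?_
    exact and_congr (Fin.forall_fin_two (p := fun j => star (Z j 0) = - Z 0 j)) (Fin.forall_fin_two (p := fun j => star (Z j 1) = - Z 1 j))
  have hZ' : (!![Z 1 1, Z 1 0; Z 0 1, Z 0 0] : Matrix (Fin 2) (Fin 2) ℂ)ᴴ = -!![Z 1 1, Z 1 0; Z 0 1, Z 0 0] ↔ (star (Z 1 1) = - Z 1 1 ∧ star (Z 0 1) = - Z 1 0) ∧ (star (Z 1 0) = - Z 0 1 ∧ star (Z 0 0) = - Z 0 0) := by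
    rw [← Matrix.ext_iff]
    simp only [Fin.forall_fin_two, conjTranspose_apply, Matrix.neg_apply]
    simp
  have hb : BDm Z ↔ Z 0 1 = 0 ∧ Z 1 0 = 0 := by
    unfold BDm
    constructor
    · intro h; exact h 0
    · intro h i; fin_cases i; exact h
  have hb' : BDm (!![Z 1 1, Z 1 0; Z 0 1, Z 0 0] : Matrix (Fin 2) (Fin 2) ℂ) ↔ Z 1 0 = 0 ∧ Z 0 1 = 0 := by
    unfold BDm
    constructor
    · intro h; exact h 0
    · intro h i; fin_cases i; exact h
  have ht : Z.trace = Z (Fin.last 1) (Fin.last 1) ↔ Z 0 0 = 0 := by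
    rw [l, Matrix.trace, Fin.sum_univ_two]; simp
  rw [hZ, hb, ht]
  refine Iff.trans ?_ (and_congr hZ' (and_congr hb' Iff.rfl)).symm
  rw [l]
  simp
  tauto

theorem main_aux {n : ℕ} (hn : 1 ≤ n)
    (H : Subgroup ↥(Matrix.unitaryGroup (Fin (n+1)) ℂ))
    (hclosed : IsClosed (H : Set ↥(Matrix.unitaryGroup (Fin (n+1)) ℂ)))
    (hconn : IsConnected (H : Set ↥(Matrix.unitaryGroup (Fin (n+1)) ℂ)))
    (hdim : unitarySubgroupDim (n+1) H = ((n ^ 2 : ℕ) : ENNReal)) :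
    (n = 2 ∧ ∃ U : ↥(Matrix.unitaryGroup (Fin (n+1)) ℂ),
      (fun A => U * A * U⁻¹) '' (H : Set ↥(Matrix.unitaryGroup (Fin (n+1)) ℂ)) = eSO3Set (n+1)) ∨
    (2 ≤ n ∧ ∃ U : ↥(Matrix.unitaryGroup (Fin (n+1)) ℂ),
      (fun A => U * A * U⁻¹) '' (H : Set ↥(Matrix.unitaryGroup (Fin (n+1)) ℂ)) =
        suTimesU1Set (n+1)) ∨
    (∃ k₁ k₂ : ℤ, 0 < k₁ ∧ IsCoprime k₁ k₂ ∧
      ∃ U : ↥(Matrix.unitaryGroup (Fin (n+1)) ℂ),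
        (fun A => U * A * U⁻¹) '' (H : Set ↥(Matrix.unitaryGroup (Fin (n+1)) ℂ)) =
          HkSet (n+1) k₁ k₂) := by
  obtain ⟨h, hs, hb, hd, h1, h2⟩ := exists_lie_matrix H hclosed hconn.isPreconnected
  have hd' : Module.finrank ℝ h = n ^ 2 := by
    rw [hdim] at hd
    exact (Nat.cast_injective hd).symm
  obtain ⟨U, hU, hc⟩ := lie_class hn h hs hb hd'
  rcases hc with ⟨rfl, hA⟩ | hB | ⟨q, hC⟩
  · left
    refine ⟨rfl, ⟨U, hU⟩, ?_⟩
    obtain ⟨H', hset, hL⟩ := lieOf_conj H hclosed (fun X => X ∈ h) h1 h2 ⟨U, hU⟩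
      (fun Y => Yᴴ = -Y ∧ ∃ a : ℂ, Y + Yᵀ = a • 1) (dimA h hs hd' U hU hA)
    rw [← hset]
    exact caseA H' hL
  · right
    by_cases hn2 : 2 ≤ n
    · left
      refine ⟨hn2, ⟨U, hU⟩, ?_⟩
      obtain ⟨H', hset, hL⟩ := lieOf_conj H hclosed (fun X => X ∈ h) h1 h2 ⟨U, hU⟩ 
        (fun Y => Yᴴ = -Y ∧ BDm Y ∧ Y.trace = Y (Fin.last n) (Fin.last n)) hB
      rw [← hset]
      exact caseB hn H' hL
    · right
      obtain rfl : n = 1 := by omega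
      obtain ⟨H', hset, hL⟩ := lieOf_conj H hclosed (fun X => X ∈ h) h1 h2 ⟨swp * U, mul_mem swp_mem hU⟩ 
        (fun Y => Yᴴ = -Y ∧ BDm Y ∧ Y (Fin.last 1) (Fin.last 1) = ((0:ℝ):ℂ) * (Y.trace - Y (Fin.last 1) (Fin.last 1))) (by
          intro X
          rw [hB X, swap_iff]
          have : (swp * U) * X * (swp * U)ᴴ = swp * (U * X * Uᴴ) * swpᴴ := by
            rw [conjTranspose_mul]; simp only [Matrix.mul_assoc]
          rw [← this])
      obtain ⟨k₁, k₂, hk, hcop, he⟩ := caseC hn 0 H' hL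
      exact ⟨k₁, k₂, hk, hcop, _, hset ▸ he⟩
  · right; right
    obtain ⟨H', hset, hL⟩ := lieOf_conj H hclosed (fun X => X ∈ h) h1 h2 ⟨U, hU⟩
      (fun Y => Yᴴ = -Y ∧ BDm Y ∧ Y (Fin.last n) (Fin.last n) = (q:ℂ) * (Y.trace - Y (Fin.last n) (Fin.last n))) hC
    obtain ⟨k₁, k₂, hk, hcop, he⟩ := caseC hn q H' hL
    exact ⟨k₁, k₂, hk, hcop, _, hset ▸ he⟩
end D7

end PartD7

/-- A connected closed subgroup of `U(N)`, `N ≥ 2`, of dimension `(N-1)²` is conjugate in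
`U(N)` to `e^{iℝ}·SO(3,ℝ)` (only for `N = 3`), to the block-diagonal `SU(N-1) × U(1)`
(for `N ≥ 3`), or to `H^N_{k₁,k₂}` for some coprime integers `k₁ > 0`, `k₂`. -/
theorem stmt_13 {N : ℕ} (hN : 2 ≤ N)
    (H : Subgroup ↥(Matrix.unitaryGroup (Fin N) ℂ))
    (hclosed : IsClosed (H : Set ↥(Matrix.unitaryGroup (Fin N) ℂ)))
    (hconn : IsConnected (H : Set ↥(Matrix.unitaryGroup (Fin N) ℂ)))
    (hdim : unitarySubgroupDim N H = (((N - 1) ^ 2 : ℕ) : ℝ≥0∞)) :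
    (N = 3 ∧ ∃ U : ↥(Matrix.unitaryGroup (Fin N) ℂ),
      (fun A => U * A * U⁻¹) '' (H : Set ↥(Matrix.unitaryGroup (Fin N) ℂ)) = eSO3Set N) ∨
    (3 ≤ N ∧ ∃ U : ↥(Matrix.unitaryGroup (Fin N) ℂ),
      (fun A => U * A * U⁻¹) '' (H : Set ↥(Matrix.unitaryGroup (Fin N) ℂ)) =
        suTimesU1Set N) ∨
    (∃ k₁ k₂ : ℤ, 0 < k₁ ∧ IsCoprime k₁ k₂ ∧
      ∃ U : ↥(Matrix.unitaryGroup (Fin N) ℂ),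
        (fun A => U * A * U⁻¹) '' (H : Set ↥(Matrix.unitaryGroup (Fin N) ℂ)) =
          HkSet N k₁ k₂) := by
  obtain ⟨n, rfl⟩ : ∃ n, N = n + 1 := ⟨N - 1, by omega⟩
  rcases main_aux (n := n) (by omega) H hclosed hconn (by simpa using hdim) with ⟨h, hU⟩ | ⟨h, hU⟩ | h
  · exact Or.inl ⟨by omega, hU⟩
  · exact Or.inr (Or.inl ⟨by omega, hU⟩)
  · exact Or.inr (Or.inr h)
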